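/- arXiv:1304.3830 — 3 statements merged into one kernel-verified Lean document; each statement's English description precedes it below -/
import Mathlib

section
/- If Γ and Δ are finitely generated marked groups and m, n ≥ 2 are finite, then χ_B(G(Γ*Δ, m+n−1)) ≥ χ_B(G(Γ, m)) + χ_B(G(Δ, n)) − 1, where G(Γ, k) is formed using a base space of cardinality k. -/
/-- The left shift action of a group `G` on the product space `G → X`:
`(γ • y) β = y (γ⁻¹ * β)`. -/
def shift {G : Type*} [Group G] {X : Type*} (γ : G) (y : G → X) : G → X :=
  fun β => y (γ⁻¹ * β)

/-- The free part `Free(X^G)` of the left shift action of `G` on `G → X`. -/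
def freePart (G : Type*) [Group G] (X : Type*) : Set (G → X) :=
  {y | ∀ γ : G, γ ≠ 1 → shift γ y ≠ y}

/-- The Borel chromatic number of a (graph given by a) relation `G` on a measurable
space `X`: the least cardinality of a standard Borel space `Y` admitting a Borel
(measurable) coloring `c : X → Y` with `c x ≠ c y` whenever `G x y`. -/
noncomputable def borelChromaticNumber {X : Type} [mX : MeasurableSpace X]
    (G : X → X → Prop) : Cardinal :=
  sInf {κ : Cardinal | ∃ (Y : Type) (mY : MeasurableSpace Y),
    @StandardBorelSpace Y mY ∧ Cardinal.mk Y = κ ∧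
    ∃ c : X → Y, @Measurable X Y mX mY c ∧ ∀ x y, G x y → c x ≠ c y}

/-- The adjacency relation of the graph `G(Γ, X)` on the free part `Free(X^Γ)` determined
by a set `S` of generators of `Γ`: `x` and `y` are adjacent iff some `γ ∈ S` shifts `x`
to `y` or `y` to `x`. -/
def cayleyAdj {Γ : Type} [Group Γ] (S : Set Γ) (X : Type) :
    ↥(freePart Γ X) → ↥(freePart Γ X) → Prop :=
  fun x y => ∃ γ ∈ S,
    shift γ (x : Γ → X) = (y : Γ → X) ∨ shift γ (y : Γ → X) = (x : Γ → X)

/-- A pruned forest of positions graded by length, on which two players alternate: player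
`p : Bool` chooses the successor of a position of length `n` when `n.bodd = p`. -/
structure GameTree where
  /-- The positions of length `n`. -/
  Pos : ℕ → Type
  /-- The predecessor of a position. -/
  par : ∀ n, Pos (n + 1) → Pos n
  par_surj : ∀ n, Function.Surjective (par n)

namespace GameTree

/-- The infinite plays of a game tree. -/
def Branch (T : GameTree) : Type :=
  {x : ∀ n, T.Pos n // ∀ n, T.par n (x (n + 1)) = x n}

instance (T : GameTree) : CoeFun T.Branch fun _ => ∀ n, T.Pos n := ⟨Subtype.val⟩

/-- A strategy chooses a successor of every position; only its values at the turns of the player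
following it matter. -/
def Strat (T : GameTree) : Type :=
  {s : ∀ n, T.Pos n → T.Pos (n + 1) // ∀ n t, T.par n (s n t) = t}

instance (T : GameTree) : CoeFun T.Strat fun _ => ∀ n, T.Pos n → T.Pos (n + 1) :=
  ⟨Subtype.val⟩

/-- The play `x` is consistent with player `p` following `σ`. -/
def Follows {T : GameTree} (p : Bool) (σ : T.Strat) (x : T.Branch) : Prop :=
  ∀ n, n.bodd = p → x (n + 1) = σ n (x n)

variable {T : GameTree}

instance : Nonempty T.Strat :=
  ⟨⟨fun n t => (T.par_surj n t).choose, fun n t => (T.par_surj n t).choose_spec⟩⟩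

@[ext]
theorem Branch.ext {x y : T.Branch} (h : ∀ n, x n = y n) : x = y :=
  Subtype.ext (funext h)

theorem Branch.eq_of_le {x y : T.Branch} {m n : ℕ} (h : x n = y n) (hmn : m ≤ n) :
    x m = y m := by
  induction n, hmn using Nat.le_induction with
  | base => exact h
  | succ n _ ih => exact ih (by rw [← x.2 n, ← y.2 n, h])

theorem Strat.par_apply (σ : T.Strat) (n : ℕ) (t : T.Pos n) : T.par n (σ n t) = t := σ.2 n t

/-- A strategy can be modified at a single position. -/
theorem Strat.exists_override (σ : T.Strat) {n : ℕ} (t : T.Pos (n + 1)) :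
    ∃ τ : T.Strat, τ n (T.par n t) = t ∧ (∀ m, m ≠ n → τ m = σ m) := by
  classical
  let Q : ∀ m, T.Pos m → T.Pos (m + 1) → Prop := fun m s u =>
    T.par m u = s ∧ (⟨m + 1, u⟩ : Σ k, T.Pos k) = ⟨n + 1, t⟩
  refine ⟨⟨fun m s => if h : ∃ u, Q m s u then h.choose else σ m s, fun m s => ?_⟩, ?_, ?_⟩
  · dsimp only
    split_ifs with h
    · exact h.choose_spec.1
    · exact σ.2 m s
  · have h : ∃ u, Q n (T.par n t) u := ⟨t, rfl, rfl⟩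
    dsimp only
    rw [dif_pos h]
    exact eq_of_heq (Sigma.mk.inj h.choose_spec.2).2
  · intro m hm
    funext s
    dsimp only
    rw [dif_neg]
    rintro ⟨u, -, hu⟩
    exact hm (by have := (Sigma.mk.inj hu).1; omega)

/-- Every position lies on a branch following a given strategy from there on. -/
theorem exists_branch_follows (σ : T.Strat) {n : ℕ} (t : T.Pos n) :
    ∃ x : T.Branch, x n = t ∧ ∀ m, n ≤ m → x (m + 1) = σ m (x m) := by
  induction n generalizing σ with
  | zero =>
    refine ⟨⟨fun m => Nat.rec t (fun k s => σ k s) m, fun m => σ.2 m _⟩, rfl, fun m _ => rfl⟩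
  | succ n ih =>
    obtain ⟨τ, h1, h2⟩ := σ.exists_override t
    obtain ⟨x, hx, hf⟩ := ih τ (T.par n t)
    refine ⟨x, by rw [hf n le_rfl, hx, h1], fun m hm => ?_⟩
    rw [hf m (by omega), h2 m (by omega)]

/-- A branch through a given position. -/
noncomputable def ext {n : ℕ} (t : T.Pos n) : T.Branch :=
  (exists_branch_follows (Classical.arbitrary T.Strat) t).choose

@[simp]
theorem ext_self {n : ℕ} (t : T.Pos n) : ext t n = t :=
  (exists_branch_follows (Classical.arbitrary T.Strat) t).choose_spec.1

theorem ext_apply (x : T.Branch) {m n : ℕ} (h : m ≤ n) : ext (x n) m = x m :=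
  Branch.eq_of_le (ext_self (x n)) h

/-- A set of branches is open if membership is witnessed by finite initial segments. -/
def Open (A : Set T.Branch) : Prop := ∀ x ∈ A, ∃ n, ∀ y : T.Branch, y n = x n → y ∈ A

/-- A set of branches is clopen if it and its complement are open. -/
def Clopen (A : Set T.Branch) : Prop := Open A ∧ Open Aᶜ

/-- From `t`, player `p` can force the play to enter `U`. -/
def Win (p : Bool) (U : ∀ n, Set (T.Pos n)) (n : ℕ) (t : T.Pos n) : Prop :=
  ∃ σ : T.Strat, ∀ x : T.Branch, x n = t →
    (∀ m, n ≤ m → m.bodd = p → x (m + 1) = σ m (x m)) → ∃ m, n ≤ m ∧ x m ∈ U m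

theorem win_of_mem {p : Bool} {U : ∀ n, Set (T.Pos n)} {n : ℕ} {t : T.Pos n} (h : t ∈ U n) :
    Win p U n t :=
  ⟨Classical.arbitrary _, fun _ hx _ => ⟨n, le_rfl, hx ▸ h⟩⟩

theorem win_of_child {p : Bool} {U : ∀ n, Set (T.Pos n)} {n : ℕ} {t : T.Pos (n + 1)}
    (hn : n.bodd = p) (h : Win p U (n + 1) t) : Win p U n (T.par n t) := by
  obtain ⟨σ, hσ⟩ := h
  obtain ⟨τ, h1, h2⟩ := σ.exists_override t
  refine ⟨τ, fun x hx hf => ?_⟩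
  obtain ⟨m, hm, hU⟩ := hσ x (by rw [hf n le_rfl hn, hx, h1]) fun m hm hp => by
    rw [hf m (by omega) hp, h2 m (by omega)]
  exact ⟨m, by omega, hU⟩

open Classical in
/-- A winning strategy from `t` if there is one. -/
noncomputable def winStrat (p : Bool) (U : ∀ n, Set (T.Pos n)) (n : ℕ) (t : T.Pos n) : T.Strat :=
  if h : Win p U n t then h.choose else Classical.arbitrary _

theorem winStrat_spec {p : Bool} {U : ∀ n, Set (T.Pos n)} {n : ℕ} {t : T.Pos n}
    (h : Win p U n t) (x : T.Branch) (hx : x n = t)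
    (hf : ∀ m, n ≤ m → m.bodd = p → x (m + 1) = winStrat p U n t m (x m)) :
    ∃ m, n ≤ m ∧ x m ∈ U m := by
  rw [winStrat, dif_pos h] at hf
  exact h.choose_spec x hx hf

theorem win_of_forall {p : Bool} {U : ∀ n, Set (T.Pos n)} {n : ℕ} {t : T.Pos n}
    (h : ∀ t', T.par n t' = t → Win p U (n + 1) t') : Win p U n t := by
  refine ⟨⟨fun m y => winStrat p U (n + 1) (ext y (n + 1)) m y, fun m y => Strat.par_apply _ _ _⟩,
    fun x hx hf => ?_⟩
  obtain ⟨m, hm, hU⟩ := winStrat_spec (h (x (n + 1)) (by rw [x.2, hx])) x rfl fun m hm hp => by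
    rw [hf m (by omega) hp]
    dsimp only
    rw [ext_apply x hm]
  exact ⟨m, by omega, hU⟩

/-- A single strategy that, once the play enters the winning region after stage `K`,
forces it into `U`. -/
theorem exists_attractor (p : Bool) (U : ∀ n, Set (T.Pos n)) (K : ℕ) :
    ∃ σ : T.Strat, ∀ x : T.Branch, (∃ m, K ≤ m ∧ Win p U m (x m)) →
      (∀ n, n.bodd = p → (∃ m, K ≤ m ∧ m ≤ n ∧ Win p U m (x m)) →
        (∀ m, K ≤ m → m ≤ n → x m ∉ U m) → x (n + 1) = σ n (x n)) →
      ∃ m, K ≤ m ∧ x m ∈ U m := by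
  classical
  let e : ∀ n, T.Pos n → ℕ := fun n y => sInf {m | K ≤ m ∧ m ≤ n ∧ Win p U m (ext y m)}
  refine ⟨⟨fun n y => winStrat p U (e n y) (ext y (e n y)) n y,
    fun n y => Strat.par_apply _ _ _⟩, fun x hW hf => ?_⟩
  by_contra! hU
  let m₀ := Nat.find hW
  obtain ⟨hK, hm₀⟩ : K ≤ m₀ ∧ Win p U m₀ (x m₀) := Nat.find_spec hW
  have he : ∀ n, m₀ ≤ n → e n (x n) = m₀ := by
    intro n hn
    have hmem : m₀ ∈ {m | K ≤ m ∧ m ≤ n ∧ Win p U m (ext (x n) m)} :=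
      ⟨hK, hn, by rwa [ext_apply x hn]⟩
    refine le_antisymm (Nat.sInf_le hmem) ?_
    obtain ⟨h1, h2, h3⟩ := Nat.sInf_mem ⟨m₀, hmem⟩
    exact Nat.find_min' hW ⟨h1, by rwa [ext_apply x h2] at h3⟩
  obtain ⟨m, hm, hmU⟩ := winStrat_spec hm₀ x rfl fun n hn hp => by
    rw [hf n hp ⟨m₀, hK, hn, hm₀⟩ fun m h _ => hU m h]
    dsimp only
    rw [he n hn, ext_apply x hn]
  exact hU m (hK.trans hm) hmU

/-- A covering of the game on `T` by the game on `S` in the sense of Martin. -/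
structure Cover (S T : GameTree) where
  /-- The projection of positions. -/
  map : ∀ n, S.Pos n → T.Pos n
  map_par : ∀ n t, T.par n (map (n + 1) t) = map n (S.par n t)
  /-- The transfer of strategies. -/
  lift : Bool → S.Strat → T.Strat
  lift_local : ∀ p (σ τ : S.Strat) n, (∀ m ≤ n, σ m = τ m) → lift p σ n = lift p τ n
  exists_lift : ∀ p (σ : S.Strat) (x : T.Branch), Follows p (lift p σ) x →
    ∃ y : S.Branch, Follows p σ y ∧ ∀ n, map n (y n) = x n

namespace Cover

variable {R S T : GameTree}

/-- The map induced by a covering on branches. -/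
def branchMap (C : Cover S T) (x : S.Branch) : T.Branch :=
  ⟨fun n => C.map n (x n), fun n => by rw [C.map_par, x.2]⟩

/-- The covering is trivial on positions of length at most `k`. -/
structure Fixes (C : Cover S T) (k : ℕ) : Prop where
  bijective : ∀ n ≤ k, Function.Bijective (C.map n)
  lift_map : ∀ p (σ : S.Strat) n t, n < k → C.lift p σ n (C.map n t) = C.map (n + 1) (σ n t)

theorem Fixes.mono {C : Cover S T} {k l : ℕ} (h : C.Fixes l) (hkl : k ≤ l) : C.Fixes k :=
  ⟨fun n hn => h.1 n (hn.trans hkl), fun p σ n t hn => h.2 p σ n t (hn.trans_le hkl)⟩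

/-- The trivial covering. -/
def refl (T : GameTree) : Cover T T where
  map _ t := t
  map_par _ _ := rfl
  lift _ σ := σ
  lift_local _ _ _ n h := h n le_rfl
  exists_lift _ _ x hx := ⟨x, hx, fun _ => rfl⟩

/-- Composition of coverings. -/
def trans (D : Cover R S) (C : Cover S T) : Cover R T where
  map n t := C.map n (D.map n t)
  map_par n t := by rw [C.map_par, D.map_par]
  lift p σ := C.lift p (D.lift p σ)
  lift_local p σ τ n h :=
    C.lift_local p _ _ n fun m hm => D.lift_local p σ τ m fun l hl => h l (hl.trans hm)
  exists_lift p σ x hx := by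
    obtain ⟨y, hy, hyx⟩ := C.exists_lift p _ x hx
    obtain ⟨z, hz, hzy⟩ := D.exists_lift p σ y hy
    exact ⟨z, hz, fun n => by rw [hzy, hyx]⟩

theorem Fixes.trans {D : Cover R S} {C : Cover S T} {k : ℕ} (hD : D.Fixes k) (hC : C.Fixes k) :
    (D.trans C).Fixes k :=
  ⟨fun n hn => (hC.1 n hn).comp (hD.1 n hn), fun p σ n t hn => by
    simp only [Cover.trans]
    rw [hC.2 p _ n _ hn, hD.2 p σ n t hn]⟩

theorem branchMap_preimage_open (C : Cover S T) {A : Set T.Branch} (hA : Open A) :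
    Open (C.branchMap ⁻¹' A) := by
  intro x hx
  obtain ⟨n, hn⟩ := hA _ hx
  exact ⟨n, fun y hy => hn _ (by simp [branchMap, hy])⟩

theorem branchMap_preimage_clopen (C : Cover S T) {A : Set T.Branch} (hA : Clopen A) :
    Clopen (C.branchMap ⁻¹' A) :=
  ⟨C.branchMap_preimage_open hA.1, C.branchMap_preimage_open hA.2⟩

/-! ### Inverse limits of coverings -/

section Limit

variable {T : ℕ → GameTree} (D : ∀ i, Cover (T (i + 1)) (T i)) {k : ℕ}

/-- The positions of length `n` of the inverse limit. -/
def LimitPos (n : ℕ) : Type :=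
  {f : ∀ i, (T i).Pos n // ∀ i, (D i).map n (f (i + 1)) = f i}

variable {D}

theorem LimitPos.eq_of_apply_eq (hD : ∀ i, (D i).Fixes (k + i)) {n i : ℕ} (hn : n ≤ k + i)
    {f g : LimitPos D n} (h : f.1 i = g.1 i) : f = g := by
  have hup : ∀ j, f.1 (i + j) = g.1 (i + j) := by
    intro j
    induction j with
    | zero => exact h
    | succ j ih =>
      apply ((hD (i + j)).1 n (by omega)).1
      exact (f.2 (i + j)).trans (ih.trans (g.2 (i + j)).symm)
  have hdown : ∀ j l, f.1 (j + l) = g.1 (j + l) → f.1 j = g.1 j := by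
    intro j l
    induction l with
    | zero => exact id
    | succ l ih =>
      intro hl
      apply ih
      rw [← f.2 (j + l), ← g.2 (j + l)]
      exact congrArg _ hl
  apply Subtype.ext
  funext j
  refine hdown j i ?_
  rw [add_comm]
  exact hup j

theorem exists_limitPos {n : ℕ} (i : ℕ) {T : ℕ → GameTree} {D : ∀ i, Cover (T (i + 1)) (T i)}
    (hD : ∀ j, i ≤ j → Function.Surjective ((D j).map n)) (t : (T i).Pos n) :
    ∃ f : LimitPos D n, f.1 i = t := by
  induction i generalizing T with
  | zero =>
    choose g hg using fun j => hD j (Nat.zero_le j)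
    exact ⟨⟨fun j => Nat.rec t (fun j s => g j s) j, fun j => hg j _⟩, rfl⟩
  | succ i ih =>
    obtain ⟨f, hf⟩ := ih (T := fun j => T (j + 1)) (D := fun j => D (j + 1))
      (fun j hj => hD (j + 1) (by omega)) t
    refine ⟨⟨fun j => match j with
      | 0 => (D 0).map n (f.1 0)
      | j + 1 => f.1 j, fun j => match j with
        | 0 => rfl
        | j + 1 => f.2 j⟩, hf⟩

theorem exists_limitPos_of_fixes (hD : ∀ i, (D i).Fixes (k + i)) {n i : ℕ} (hn : n ≤ k + i)
    (t : (T i).Pos n) : ∃ f : LimitPos D n, f.1 i = t :=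
  exists_limitPos i (fun j hj => ((hD j).1 n (by omega)).2) t

/-- The predecessor map of the inverse limit. -/
def limitPar (n : ℕ) (f : LimitPos D (n + 1)) : LimitPos D n :=
  ⟨fun i => (T i).par n (f.1 i), fun i => by rw [← (D i).map_par, f.2]⟩

/-- The inverse limit of a sequence of coverings which are trivial up to increasing lengths. -/
def limit (hD : ∀ i, (D i).Fixes (k + i)) : GameTree where
  Pos := LimitPos D
  par := limitPar
  par_surj n f := by
    obtain ⟨t, ht⟩ := (T (n + 1)).par_surj n (f.1 (n + 1))
    obtain ⟨g, hg⟩ := exists_limitPos_of_fixes hD (i := n + 1) (by omega) t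
    refine ⟨g, LimitPos.eq_of_apply_eq hD (i := n + 1) (by omega) ?_⟩
    exact (congrArg _ hg).trans ht

variable (hD : ∀ i, (D i).Fixes (k + i))

open Classical in
/-- The strategy induced by a strategy on the limit at each stage, which is only meaningful for
short positions. -/
noncomputable def stageStrat (σ : (limit hD).Strat) (i : ℕ) : (T i).Strat :=
  ⟨fun n t => if h : ∃ f : LimitPos D n, f.1 i = t then (σ n h.choose).1 i
    else (Classical.arbitrary (T i).Strat) n t, fun n t => by
    dsimp only
    split_ifs with h
    · have := congrArg (fun f : LimitPos D n => f.1 i) (σ.2 n h.choose)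
      exact this.trans h.choose_spec
    · exact Strat.par_apply _ _ _⟩

theorem stageStrat_apply (σ : (limit hD).Strat) {i n : ℕ} (hn : n ≤ k + i) (f : LimitPos D n) :
    stageStrat hD σ i n (f.1 i) = (σ n f).1 i := by
  have h : ∃ g : LimitPos D n, g.1 i = f.1 i := ⟨f, rfl⟩
  have : h.choose = f := LimitPos.eq_of_apply_eq hD hn h.choose_spec
  simp only [stageStrat]
  rw [dif_pos h, this]

theorem stageStrat_local {σ τ : (limit hD).Strat} {n : ℕ} (h : σ n = τ n) (i : ℕ) :
    stageStrat hD σ i n = stageStrat hD τ i n := by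
  simp only [stageStrat, h]

/-- Transfer of the stage strategies down `d` coverings. -/
noncomputable def approxStrat (p : Bool) (σ : (limit hD).Strat) : ℕ → ∀ i, (T i).Strat
  | 0, i => stageStrat hD σ i
  | d + 1, i => (D i).lift p (approxStrat p σ d (i + 1))

theorem approxStrat_local (p : Bool) {σ τ : (limit hD).Strat} {n : ℕ} (h : ∀ m ≤ n, σ m = τ m)
    (d i : ℕ) : ∀ m ≤ n, approxStrat hD p σ d i m = approxStrat hD p τ d i m := by
  induction d generalizing i with
  | zero => exact fun m hm => stageStrat_local hD (h m hm) i
  | succ d ih =>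
    exact fun m hm => (D i).lift_local p _ _ m fun l hl => ih (i + 1) l (hl.trans hm)

theorem approxStrat_succ (p : Bool) (σ : (limit hD).Strat) (d i n : ℕ) (hn : n < k + i + d) :
    approxStrat hD p σ (d + 1) i n = approxStrat hD p σ d i n := by
  induction d generalizing i n with
  | zero =>
    funext t
    obtain ⟨f, rfl⟩ := exists_limitPos_of_fixes hD (i := i) (n := n) (by omega) t
    simp only [approxStrat]
    rw [stageStrat_apply hD σ (by omega), ← f.2 i, (hD i).2 _ _ _ _ (by omega),
      stageStrat_apply hD σ (by omega)]
    exact (σ n f).2 i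
  | succ d ih =>
    exact (D i).lift_local p _ _ n fun m hm => ih (i + 1) m (by omega)

theorem approxStrat_eq (p : Bool) (σ : (limit hD).Strat) {d e i n : ℕ} (hn : n < k + i + d)
    (hde : d ≤ e) : approxStrat hD p σ e i n = approxStrat hD p σ d i n := by
  induction e, hde using Nat.le_induction with
  | base => rfl
  | succ e he ih => rw [approxStrat_succ hD p σ e i n (by omega), ih]

/-- The limit of the approximating strategies. -/
noncomputable def limitStrat (p : Bool) (σ : (limit hD).Strat) (i : ℕ) : (T i).Strat :=
  ⟨fun n t => approxStrat hD p σ (n + 1) i n t, fun _ _ => Strat.par_apply _ _ _⟩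

theorem limitStrat_eq (p : Bool) (σ : (limit hD).Strat) {d i n : ℕ} (hn : n < k + i + d) :
    limitStrat hD p σ i n = approxStrat hD p σ d i n := by
  change approxStrat hD p σ (n + 1) i n = _
  rcases le_total (n + 1) d with h | h
  · exact (approxStrat_eq hD p σ (by omega) h).symm
  · exact approxStrat_eq hD p σ hn h

theorem lift_limitStrat (p : Bool) (σ : (limit hD).Strat) (i : ℕ) :
    (D i).lift p (limitStrat hD p σ (i + 1)) = limitStrat hD p σ i := by
  apply Subtype.ext
  funext n
  have h := (D i).lift_local p (limitStrat hD p σ (i + 1)) (approxStrat hD p σ (n + 1) (i + 1)) n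
    fun m hm => limitStrat_eq hD p σ (by omega)
  exact h.trans (limitStrat_eq hD p σ (d := n + 2) (by omega)).symm

theorem limitStrat_apply (p : Bool) (σ : (limit hD).Strat) {i n : ℕ} (hn : n < k + i)
    (f : LimitPos D n) : limitStrat hD p σ i n (f.1 i) = (σ n f).1 i := by
  rw [limitStrat_eq hD p σ (d := 0) (by omega)]
  exact stageStrat_apply hD σ hn.le f

/-- The inverse limit covers the first tree of the sequence. -/
noncomputable def limitCover : Cover (limit hD) (T 0) where
  map _ f := f.1 0
  map_par _ _ := rfl
  lift p σ := limitStrat hD p σ 0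
  lift_local p σ τ n h := approxStrat_local hD p h (n + 1) 0 n le_rfl
  exists_lift p σ x hx := by
    have step : ∀ i (y : (T i).Branch), Follows p (limitStrat hD p σ i) y →
        ∃ z : (T (i + 1)).Branch, Follows p (limitStrat hD p σ (i + 1)) z ∧
          ∀ n, (D i).map n (z n) = y n := fun i y hy =>
      (D i).exists_lift p _ y (by rwa [lift_limitStrat])
    choose g hg1 hg2 using step
    let z : ∀ i, {y : (T i).Branch // Follows p (limitStrat hD p σ i) y} := fun i =>
      Nat.rec ⟨x, hx⟩ (fun i z => ⟨g i z.1 z.2, hg1 i z.1 z.2⟩) i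
    let y : ∀ i, (T i).Branch := fun i => (z i).1
    have hy : ∀ i, Follows p (limitStrat hD p σ i) (y i) := fun i => (z i).2
    let f : ∀ n, LimitPos D n := fun n => ⟨fun i => y i n, fun i => hg2 i _ (hy i) n⟩
    refine ⟨⟨f, fun n => Subtype.ext (funext fun i => (y i).2 n)⟩, fun n hn => ?_, fun n => rfl⟩
    refine LimitPos.eq_of_apply_eq hD (i := n + 1) (by omega) ?_
    exact (hy (n + 1) n hn).trans (limitStrat_apply hD p σ (by omega) (f n))

theorem limitCover_fixes : (limitCover hD).Fixes k where
  bijective n hn := ⟨fun _ _ h => LimitPos.eq_of_apply_eq hD (i := 0) (by omega) h, fun t =>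
    exists_limitPos_of_fixes hD (i := 0) (by omega) t⟩
  lift_map p σ _ t hn := limitStrat_apply hD p σ (i := 0) (by omega) t

/-- The projection of branches of the inverse limit to the trees of the sequence. -/
def limitProj (i : ℕ) (x : (limit hD).Branch) : (T i).Branch :=
  ⟨fun n => (x n).1 i, fun n => congrArg (fun f : LimitPos D n => f.1 i) (x.2 n)⟩

theorem branchMap_limitProj (i : ℕ) (x : (limit hD).Branch) :
    (D i).branchMap (limitProj hD (i + 1) x) = limitProj hD i x :=
  Branch.ext fun n => (x n).2 i

theorem limitProj_preimage_open (i : ℕ) {A : Set (T i).Branch} (hA : Open A) :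
    Open (limitProj hD i ⁻¹' A) := by
  intro x hx
  obtain ⟨n, hn⟩ := hA _ hx
  exact ⟨n, fun y hy => hn _ (congrArg (fun f : LimitPos D n => f.1 i) hy)⟩

end Limit

end Cover

/-! ### Unravelling closed sets -/

section Unravel

variable {T : GameTree} (A : Set T.Branch) (K : ℕ)

theorem ext_par {m n : ℕ} (t : T.Pos (n + 1)) (h : m ≤ n) : ext (T.par n t) m = ext t m := by
  have : T.par n t = ext t n := by rw [← (ext t).2 n, ext_self]
  rw [this, ext_apply _ h]

/-- Some branch lies in `A` and passes through `s`. -/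
def Meets {n : ℕ} (s : T.Pos n) : Prop := ∃ x ∈ A, x n = s

/-- Some branch passes through both `s` and `u`. -/
def Compat {n N : ℕ} (s : T.Pos n) (u : T.Pos N) : Prop := ∃ x : T.Branch, x n = s ∧ x N = u

theorem Compat.ext_left {n N : ℕ} {s : T.Pos n} {u : T.Pos N} (h : Compat s u) (hn : N ≤ n) :
    ext s N = u := by
  obtain ⟨x, rfl, rfl⟩ := h
  exact ext_apply x hn

theorem Compat.ext_right {n N : ℕ} {s : T.Pos n} {u : T.Pos N} (h : Compat s u) (hn : n ≤ N) :
    ext u n = s := by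
  obtain ⟨x, rfl, rfl⟩ := h
  exact ext_apply x hn

theorem Compat.child {n N : ℕ} {s : T.Pos n} {u : T.Pos (N + 1)} (h : Compat s (T.par N u))
    (hn : n ≤ N) : Compat s u :=
  ⟨ext u, by rw [← ext_par u hn, h.ext_right hn], ext_self u⟩

/-- Quasistrategies for the player moving at even positions. -/
def IsQuasi (W : ∀ n, Set (T.Pos n)) : Prop :=
  ∀ n, ∀ s ∈ W n, (n.bodd = false → ∃ t ∈ W (n + 1), T.par n t = s) ∧
    (n.bodd = true → ∀ t, T.par n t = s → t ∈ W (n + 1))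

/-- `V` is a quasistrategy, for the player moving at odd positions in the game restricted to `W`,
all of whose positions meet `A`. -/
def IsCounter (W V : ∀ n, Set (T.Pos n)) : Prop :=
  ∀ n, ∀ s ∈ V n, s ∈ W n ∧ Meets A s ∧ (n.bodd = true → ∃ t ∈ V (n + 1), T.par n t = s) ∧
    (n.bodd = false → ∀ t ∈ W (n + 1), T.par n t = s → t ∈ V (n + 1))

variable (T) in
/-- The answers to an announced quasistrategy: a position at which `A` is left, or a
quasistrategy staying in `A`. -/
abbrev Answer : Type := (Σ N, T.Pos N) ⊕ (∀ n, Set (T.Pos n))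

/-- The answer `o` to `W` is legitimate at the position `t`. -/
def AnswerOK {n : ℕ} (t : T.Pos n) (W : ∀ n, Set (T.Pos n)) : Answer T → Prop
  | .inl ⟨N, u⟩ => K + 2 ≤ N ∧ u ∈ W N ∧ ¬ Meets A u ∧ Compat t u
  | .inr V => IsCounter A W V ∧ ∀ m, K + 2 ≤ m → m ≤ n → ext t m ∈ V m

variable (T) in
/-- Positions together with an announced quasistrategy and an answer to it. -/
@[ext]
structure Node (n : ℕ) where
  /-- The underlying position. -/
  pos : T.Pos n
  /-- The announced quasistrategy. -/
  quasi : ∀ n, Set (T.Pos n)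
  /-- The answer. -/
  answer : Answer T

/-- The quasistrategy and answer are legitimate at `t`. -/
structure Adm (n : ℕ) (t : T.Pos n) (W : ∀ n, Set (T.Pos n)) (o : Answer T) : Prop where
  quasi : K < n → IsQuasi W ∧ ext t (K + 1) ∈ W (K + 1)
  answer : K + 1 < n → AnswerOK A K t W o

theorem Adm.par {n : ℕ} {t : T.Pos (n + 1)} {W : ∀ n, Set (T.Pos n)} {o : Answer T}
    (h : Adm A K (n + 1) t W o) : Adm A K n (T.par n t) W o where
  quasi hn := by
    rw [ext_par t (by omega)]
    exact h.quasi (by omega)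
  answer hn := by
    have := h.answer (by omega)
    rcases o with ⟨N, u⟩ | V
    · obtain ⟨h1, h2, h3, x, rfl, hu⟩ := this
      exact ⟨h1, h2, h3, x, (x.2 n).symm, hu⟩
    · refine ⟨this.1, fun m h1 h2 => ?_⟩
      rw [ext_par t (by omega)]
      exact this.2 m h1 (by omega)

open Classical in
/-- The node with the given data, forgetting what has not been announced yet. -/
noncomputable def mkNode (n : ℕ) (t : T.Pos n) (W : ∀ n, Set (T.Pos n)) (o : Answer T) :
    Node T n :=
  ⟨t, if n ≤ K then fun _ => ∅ else W, if n ≤ K + 1 then .inr fun _ => ∅ else o⟩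

theorem adm_mkNode {n : ℕ} {t : T.Pos n} {W : ∀ n, Set (T.Pos n)} {o : Answer T}
    (h : Adm A K n t W o) :
    Adm A K n t (mkNode K n t W o).quasi (mkNode K n t W o).answer where
  quasi hn := by
    simp only [mkNode, if_neg hn.not_ge]
    exact h.quasi hn
  answer hn := by
    have : ¬ n ≤ K := by omega
    simp only [mkNode, if_neg hn.not_ge, if_neg this]
    exact h.answer hn

/-- The positions of the unravelling tree. -/
def UnravelPos (n : ℕ) : Type :=
  {a : Node T n // Adm A K n a.pos a.quasi a.answer ∧ mkNode K n a.pos a.quasi a.answer = a}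

/-- The position of the unravelling tree with the given data. -/
noncomputable def unravelPos {n : ℕ} (t : T.Pos n) (W : ∀ n, Set (T.Pos n)) (o : Answer T)
    (h : Adm A K n t W o) : UnravelPos A K n :=
  ⟨mkNode K n t W o, adm_mkNode A K h, by
    simp only [mkNode]
    congr 1 <;> split_ifs <;> rfl⟩

theorem adm_of_le {n : ℕ} (hn : n ≤ K) (t : T.Pos n) (W : ∀ n, Set (T.Pos n)) (o : Answer T) :
    Adm A K n t W o :=
  ⟨fun h => by omega, fun h => by omega⟩

theorem exists_child {n : ℕ} {t : T.Pos n} {W : ∀ n, Set (T.Pos n)} {o : Answer T}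
    (hK : K.bodd = false) (h : Adm A K n t W o) :
    ∃ t' W' o', T.par n t' = t ∧ Adm A K (n + 1) t' W' o' ∧ (K < n → W' = W) ∧
      (K + 1 < n → o' = o) := by
  obtain ⟨t', rfl⟩ := T.par_surj n t
  rcases Nat.lt_or_ge n (K + 1) with hn | hn
  · refine ⟨t', fun _ => Set.univ, o, rfl, ⟨fun _ => ⟨fun m s _ => ⟨fun _ => ?_, fun _ _ _ =>
      trivial⟩, trivial⟩, fun h => by omega⟩, fun h => by omega, fun _ => rfl⟩
    obtain ⟨u, hu⟩ := T.par_surj m s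
    exact ⟨u, trivial, hu⟩
  obtain ⟨hW, hs⟩ := h.quasi (by omega)
  rcases hn.eq_or_lt with rfl | hn
  · rw [ext_self] at hs
    have hodd : (K + 1).bodd = true := by simp [hK]
    have ht' : t' ∈ W (K + 2) := (hW _ _ hs).2 hodd t' rfl
    have hq : K < K + 2 → IsQuasi W ∧ ext t' (K + 1) ∈ W (K + 1) := fun _ =>
      ⟨hW, by rwa [← ext_par t' le_rfl, ext_self]⟩
    by_cases hu : ∃ N, ∃ u : T.Pos N, K + 2 ≤ N ∧ u ∈ W N ∧ ¬ Meets A u ∧ Compat t' u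
    · obtain ⟨N, u, hu⟩ := hu
      exact ⟨t', W, .inl ⟨N, u⟩, rfl, ⟨hq, fun _ => hu⟩, fun _ => rfl, fun h => by omega⟩
    · push Not at hu
      refine ⟨t', W, .inr fun n => {v | K + 2 ≤ n ∧ v ∈ W n ∧ Compat t' v}, rfl, ⟨hq, fun _ =>
        ⟨fun n v hv => ?_, fun m h1 h2 => ?_⟩⟩, fun _ => rfl, fun h => by omega⟩
      · obtain ⟨hn, hvW, hc⟩ := hv
        refine ⟨hvW, by_contra fun hm => hu n v hn hvW hm hc, fun hb => ?_, fun hb u huW huv => ?_⟩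
        · obtain ⟨u, rfl⟩ := T.par_surj n v
          exact ⟨u, ⟨by omega, (hW _ _ hvW).2 hb u rfl, hc.child hn⟩, rfl⟩
        · subst huv
          exact ⟨by omega, huW, hc.child hn⟩
      · obtain rfl : m = K + 1 + 1 := by omega
        rw [ext_self]
        exact ⟨le_rfl, ht', ext t', ext_self t', ext_self t'⟩
  · have hans := h.answer (by omega)
    have hq : ∀ t'' : T.Pos (n + 1), T.par n t'' = T.par n t' → K < n + 1 →
        IsQuasi W ∧ ext t'' (K + 1) ∈ W (K + 1) := fun t'' h'' _ =>
      ⟨hW, by rwa [← ext_par t'' (by omega), h'']⟩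
    rcases o with ⟨N, u⟩ | V
    · obtain ⟨h1, h2, h3, x, hx, hu⟩ := hans
      exact ⟨x (n + 1), W, .inl ⟨N, u⟩, (x.2 n).trans hx, ⟨hq _ ((x.2 n).trans hx),
        fun _ => ⟨h1, h2, h3, x, rfl, hu⟩⟩, fun _ => rfl, fun _ => rfl⟩
    · have hmem := hans.2 n (by omega) le_rfl
      rw [ext_self] at hmem
      obtain ⟨h1, h2, h3, h4⟩ := hans.1 n _ hmem
      obtain ⟨t'', htV, ht''⟩ : ∃ t ∈ V (n + 1), T.par n t = T.par n t' := by
        cases hb : n.bodd with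
        | true => exact h3 hb
        | false =>
          obtain ⟨t'', ht, ht''⟩ := (hW n _ h1).1 hb
          exact ⟨t'', h4 hb t'' ht ht'', ht''⟩
      refine ⟨t'', W, .inr V, ht'', ⟨hq _ ht'', fun _ => ⟨hans.1, fun m hm1 hm2 => ?_⟩⟩,
        fun _ => rfl, fun _ => rfl⟩
      rcases hm2.eq_or_lt with rfl | hm2
      · rwa [ext_self]
      · rw [← ext_par t'' (by omega), ht'']
        exact hans.2 m hm1 (by omega)

/-- The unravelling tree of `A`, in which the first player announces a quasistrategy at stage `K`,
and the second player answers it at the next stage. -/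
noncomputable def unravel (hK : K.bodd = false) : GameTree where
  Pos := UnravelPos A K
  par n a := unravelPos A K (T.par n a.1.pos) a.1.quasi a.1.answer (a.2.1.par)
  par_surj n a := by
    obtain ⟨t', W', o', rfl', h, hW, ho⟩ := exists_child A K hK a.2.1
    refine ⟨unravelPos A K t' W' o' h, Subtype.ext ?_⟩
    refine Eq.trans ?_ a.2.2
    simp only [unravelPos, mkNode, rfl', Node.mk.injEq, true_and]
    constructor
    · split_ifs <;> first | rfl | omega | exact hW (by omega)
    · split_ifs <;> first | rfl | omega | exact ho (by omega)

variable {A K}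

theorem unravelPos_congr {n : ℕ} {t : T.Pos n} {W W' : ∀ n, Set (T.Pos n)} {o o' : Answer T}
    (h : Adm A K n t W o) (h' : Adm A K n t W' o') (hW : K < n → W = W')
    (ho : K + 1 < n → o = o') : unravelPos A K t W o h = unravelPos A K t W' o' h' := by
  apply Subtype.ext
  simp only [unravelPos, mkNode, Node.mk.injEq, true_and]
  constructor
  · split_ifs with h
    · rfl
    · exact hW (by omega)
  · split_ifs with h
    · rfl
    · exact ho (by omega)

theorem unravelPos_eta {n : ℕ} (a : UnravelPos A K n) :
    unravelPos A K a.1.pos a.1.quasi a.1.answer a.2.1 = a :=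
  Subtype.ext a.2.2

variable {hK : K.bodd = false}

/-- The branch of the unravelling tree with the given data. -/
noncomputable def unravelBranch (x : T.Branch) (W : ∀ n, Set (T.Pos n)) (o : Answer T)
    (h : ∀ n, Adm A K n (x n) W o) : (unravel A K hK).Branch :=
  ⟨fun n => unravelPos A K (x n) W o (h n), fun n => by
    apply Subtype.ext
    simp only [unravel, unravelPos, mkNode, x.2, Node.mk.injEq, true_and]
    constructor <;> split_ifs <;> first | rfl | omega⟩

theorem quasi_answer_of_par_eq {n : ℕ} {a : UnravelPos A K (n + 1)} {t : T.Pos n}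
    {W : ∀ n, Set (T.Pos n)} {o : Answer T} {h : Adm A K n t W o}
    (ha : (unravel A K hK).par n a = unravelPos A K t W o h) :
    (K < n → a.1.quasi = W) ∧ (K + 1 < n → a.1.answer = o) := by
  have hpar := congrArg Subtype.val ha
  simp only [unravel, unravelPos, mkNode, Node.mk.injEq] at hpar
  obtain ⟨-, h2, h3⟩ := hpar
  refine ⟨fun hn => ?_, fun hn => ?_⟩
  · rwa [if_neg (by omega), if_neg (by omega)] at h2
  · rwa [if_neg (by omega), if_neg (by omega)] at h3

theorem follows_unravelBranch {p : Bool} {σ : (unravel A K hK).Strat} {x : T.Branch}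
    {W : ∀ n, Set (T.Pos n)} {o : Answer T} (h : ∀ n, Adm A K n (x n) W o)
    (hx : ∀ n, n.bodd = p → (σ n (unravelPos A K (x n) W o (h n))).1.pos = x (n + 1))
    (hW : K.bodd = p → (σ K (unravelPos A K (x K) W o (h K))).1.quasi = W)
    (ho : (K + 1).bodd = p → (σ (K + 1) (unravelPos A K (x (K + 1)) W o (h _))).1.answer = o) :
    Follows p σ (unravelBranch (hK := hK) x W o h) := by
  intro n hn
  obtain ⟨h2, h3⟩ := quasi_answer_of_par_eq (σ.2 n (unravelPos A K (x n) W o (h n)))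
  have h1 := hx n hn
  change unravelPos A K (x (n + 1)) W o (h (n + 1)) = σ n (unravelPos A K (x n) W o (h n))
  have hW' : K < n + 1 → (σ n (unravelPos A K (x n) W o (h n))).1.quasi = W := fun hn' => by
    rcases Nat.lt_or_ge K n with h' | h'
    · exact h2 h'
    · obtain rfl : n = K := by omega
      exact hW hn
  have ho' : K + 1 < n + 1 → (σ n (unravelPos A K (x n) W o (h n))).1.answer = o := fun hn' => by
    rcases Nat.lt_or_ge (K + 1) n with h' | h'
    · exact h3 h'
    · obtain rfl : n = K + 1 := by omega
      exact ho hn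
  generalize (σ n (unravelPos A K (x n) W o (h n)) : UnravelPos A K (n + 1)) = a at *
  rw [← unravelPos_eta a]
  obtain ⟨⟨t, W', o'⟩, ha⟩ := a
  obtain rfl : t = x (n + 1) := h1
  exact unravelPos_congr _ _ (fun hn => (hW' hn).symm) fun hn => (ho' hn).symm

open Classical in
/-- The move made by `f` at the position with the given data. -/
noncomputable def pick {n : ℕ} (f : UnravelPos A K n → UnravelPos A K (n + 1)) (t : T.Pos n)
    (W : ∀ n, Set (T.Pos n)) (o : Answer T) : T.Pos (n + 1) :=
  if h : ∃ h : Adm A K n t W o, T.par n (f (unravelPos A K t W o h)).1.pos = t then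
    (f (unravelPos A K t W o h.1)).1.pos
  else (Classical.arbitrary T.Strat) n t

theorem par_pick {n : ℕ} (f : UnravelPos A K n → UnravelPos A K (n + 1)) (t : T.Pos n)
    (W : ∀ n, Set (T.Pos n)) (o : Answer T) : T.par n (pick f t W o) = t := by
  unfold pick
  split_ifs with h
  · exact h.2
  · exact Strat.par_apply _ _ _

theorem pick_eq (σ : (unravel A K hK).Strat) {n : ℕ} {t : T.Pos n} {W : ∀ n, Set (T.Pos n)}
    {o : Answer T} (h : Adm A K n t W o) :
    pick (σ n) t W o = (σ n (unravelPos A K t W o h)).1.pos := by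
  have : T.par n (σ n (unravelPos A K t W o h)).1.pos = t :=
    congrArg (fun a : UnravelPos A K n => a.1.pos) (σ.2 n (unravelPos A K t W o h))
  unfold pick
  exact dif_pos ⟨h, this⟩

variable (T) in
/-- A plan for transferring strategies: try to reach the target, and announce or assume certain
quasistrategies and answers according to whether the target is reached. -/
structure Plan where
  /-- The positions to be reached. -/
  target : ∀ n, Set (T.Pos n)
  /-- The quasistrategy in force once the target is reached. -/
  reach : (Σ n, T.Pos n) → ∀ n, Set (T.Pos n)
  /-- The quasistrategy in force until the target can be reached. -/
  quasi : ∀ n, Set (T.Pos n)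
  /-- The answer in force until the target can be reached. -/
  answer : Answer T

open Classical in
/-- The move according to a plan. -/
noncomputable def Plan.move (P : Plan T) (p : Bool) (B : ℕ) {n : ℕ}
    (f : UnravelPos A K n → UnravelPos A K (n + 1)) (t : T.Pos n) : T.Pos (n + 1) :=
  if h : ∃ N, B ≤ N ∧ N ≤ n ∧ ext t N ∈ P.target N then
    pick f t (P.reach ⟨Nat.find h, ext t (Nat.find h)⟩) (.inl ⟨Nat.find h, ext t (Nat.find h)⟩)
  else if ∃ N, B ≤ N ∧ N ≤ n ∧ Win p P.target N (ext t N) then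
    (exists_attractor p P.target B).choose n t
  else pick f t P.quasi P.answer

theorem Plan.par_move (P : Plan T) (p : Bool) (B : ℕ) {n : ℕ}
    (f : UnravelPos A K n → UnravelPos A K (n + 1)) (t : T.Pos n) :
    T.par n (P.move p B f t) = t := by
  unfold Plan.move
  split_ifs
  · exact par_pick _ _ _ _
  · exact Strat.par_apply _ _ _
  · exact par_pick _ _ _ _

theorem Plan.reach_or_forall_not_win (P : Plan T) {p : Bool} {B : ℕ} (hB : K + 1 ≤ B)
    (f : ∀ n, UnravelPos A K n → UnravelPos A K (n + 1)) {x : T.Branch}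
    (hx : ∀ n, K + 1 ≤ n → n.bodd = p → x (n + 1) = P.move p B (f n) (x n)) :
    (∃ N, B ≤ N ∧ x N ∈ P.target N ∧ ∀ n, N ≤ n → n.bodd = p →
      x (n + 1) = pick (f n) (x n) (P.reach ⟨N, x N⟩) (.inl ⟨N, x N⟩)) ∨
    (∀ N, B ≤ N → ¬ Win p P.target N (x N)) ∧
      ∀ n, K + 1 ≤ n → n.bodd = p → x (n + 1) = pick (f n) (x n) P.quasi P.answer := by
  classical
  by_cases hr : ∃ N, B ≤ N ∧ x N ∈ P.target N
  · left
    obtain ⟨h1, h2⟩ := Nat.find_spec hr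
    refine ⟨Nat.find hr, h1, h2, fun n hn hp => ?_⟩
    have h : ∃ N, B ≤ N ∧ N ≤ n ∧ ext (x n) N ∈ P.target N :=
      ⟨Nat.find hr, h1, hn, by rwa [ext_apply x hn]⟩
    obtain ⟨h3, h4, h5⟩ := Nat.find_spec h
    rw [ext_apply x h4] at h5
    have hfind : Nat.find h = Nat.find hr :=
      le_antisymm (Nat.find_min' h ⟨h1, hn, by rwa [ext_apply x hn]⟩)
        (Nat.find_min' hr ⟨h3, h5⟩)
    rw [hx n (by omega) hp, Plan.move, dif_pos h, hfind, ext_apply x hn]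
  · right
    have hnot : ∀ n, ¬ ∃ N, B ≤ N ∧ N ≤ n ∧ ext (x n) N ∈ P.target N := by
      rintro n ⟨N, h1, h2, h3⟩
      exact hr ⟨N, h1, by rwa [ext_apply x h2] at h3⟩
    have hwin : ∀ N, B ≤ N → ¬ Win p P.target N (x N) := by
      intro N hN hw
      refine hr ((exists_attractor p P.target B).choose_spec x ⟨N, hN, hw⟩ fun n hp he _ => ?_)
      obtain ⟨m, h1, h2, h3⟩ := he
      rw [hx n (by omega) hp, Plan.move, dif_neg (hnot n),
        if_pos ⟨m, h1, h2, by rwa [ext_apply x h2]⟩]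
    refine ⟨hwin, fun n hn hp => ?_⟩
    rw [hx n hn hp, Plan.move, dif_neg (hnot n), if_neg]
    rintro ⟨m, h1, h2, h3⟩
    rw [ext_apply x h2] at h3
    exact hwin m h1 h3

theorem exists_lift_of_reach {p : Bool} {σ : (unravel A K hK).Strat} {x : T.Branch}
    {W : ∀ n, Set (T.Pos n)} {N : ℕ} (hN : K + 2 ≤ N) (hNW : x N ∈ W N) (hNA : ¬ Meets A (x N))
    (hW : IsQuasi W) (hxW : x (K + 1) ∈ W (K + 1))
    (hx₀ : ∀ n ≤ K, n.bodd = p → x (n + 1) = pick (σ n) (x n) (fun _ => ∅) (.inr fun _ => ∅))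
    (hx : ∀ n, N ≤ n → n.bodd = p → x (n + 1) = pick (σ n) (x n) W (.inl ⟨N, x N⟩))
    (hq : K.bodd = p → (σ K (unravelPos A K (x K) W (.inl ⟨N, x N⟩)
      (adm_of_le A K le_rfl _ _ _))).1.quasi = W)
    (ha : ∀ h, (K + 1).bodd = p → (σ (K + 1) (unravelPos A K (x (K + 1)) W (.inl ⟨N, x N⟩)
      h)).1.answer = .inl ⟨N, x N⟩) :
    ∃ y : (unravel A K hK).Branch, Follows p σ y ∧ ∀ n, (y n).1.pos = x n := by
  have hadm : ∀ n, Adm A K n (x n) W (.inl ⟨N, x N⟩) := fun n =>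
    ⟨fun hn => ⟨hW, by rwa [ext_apply x hn]⟩, fun _ => ⟨hN, hNW, hNA, x, rfl, rfl⟩⟩
  refine ⟨unravelBranch x W _ hadm, follows_unravelBranch hadm (fun n hn => ?_) hq (ha _),
    fun n => rfl⟩
  rcases le_or_gt n K with h1 | h1
  · rw [hx₀ n h1 hn, pick_eq σ (adm_of_le A K h1 _ _ _), unravelPos_congr]
    exacts [fun h => by omega, fun h => by omega]
  rcases le_or_gt N n with h2 | h2
  · rw [hx n h2 hn, pick_eq]
  · have h3 : (σ n (unravelPos A K (x n) W _ (hadm n))).1.answer = .inl ⟨N, x N⟩ := by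
      rcases Nat.lt_or_ge (K + 1) n with h' | h'
      · exact (quasi_answer_of_par_eq (σ.2 n (unravelPos A K (x n) W _ (hadm n)))).2 h'
      · obtain rfl : n = K + 1 := by omega
        exact ha _ hn
    have h4 := (σ n (unravelPos A K (x n) W _ (hadm n))).2.1.answer (by omega)
    rw [h3] at h4
    rw [← h4.2.2.2.ext_right (by omega), ext_apply x (by omega)]

theorem exists_lift_of_counter {p : Bool} {σ : (unravel A K hK).Strat} {x : T.Branch}
    {W V : ∀ n, Set (T.Pos n)} (hW : IsQuasi W) (hxW : x (K + 1) ∈ W (K + 1))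
    (hV : IsCounter A W V)
    (hx₀ : ∀ n ≤ K, n.bodd = p → x (n + 1) = pick (σ n) (x n) (fun _ => ∅) (.inr fun _ => ∅))
    (hx : ∀ n, K + 1 ≤ n → n.bodd = p → x (n + 1) = pick (σ n) (x n) W (.inr V))
    (hx' : ∀ n, K + 1 ≤ n → n.bodd ≠ p → (K + 2 ≤ n → x n ∈ V n) → x (n + 1) ∈ V (n + 1))
    (hq : K.bodd = p → (σ K (unravelPos A K (x K) W (.inr V)
      (adm_of_le A K le_rfl _ _ _))).1.quasi = W)
    (ha : ∀ h, (K + 1).bodd = p → (σ (K + 1) (unravelPos A K (x (K + 1)) W (.inr V)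
      h)).1.answer = .inr V) :
    ∃ y : (unravel A K hK).Branch, Follows p σ y ∧ ∀ n, (y n).1.pos = x n := by
  have hadm' : ∀ n, (∀ m, K + 2 ≤ m → m ≤ n → x m ∈ V m) → Adm A K n (x n) W (.inr V) :=
    fun n h => ⟨fun hn => ⟨hW, by rwa [ext_apply x hn]⟩, fun _ => ⟨hV, fun m h1 h2 => by
      rw [ext_apply x h2]; exact h m h1 h2⟩⟩
  have hmem : ∀ n, ∀ m, K + 2 ≤ m → m ≤ n → x m ∈ V m := by
    intro n
    induction n with
    | zero => intro m h1 h2; omega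
    | succ n ih =>
      intro m h1 h2
      rcases h2.lt_or_eq with h2 | rfl
      · exact ih m h1 (by omega)
      by_cases hp : n.bodd = p
      · have h := hadm' n ih
        rw [hx n (by omega) hp, pick_eq σ h]
        have h3 : (σ n (unravelPos A K (x n) W _ h)).1.answer = .inr V := by
          rcases Nat.lt_or_ge (K + 1) n with h' | h'
          · exact (quasi_answer_of_par_eq (σ.2 n (unravelPos A K (x n) W _ h))).2 h'
          · obtain rfl : n = K + 1 := by omega
            exact ha _ hp
        have h4 := (σ n (unravelPos A K (x n) W _ h)).2.1.answer (by omega)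
        rw [h3] at h4
        simpa using h4.2 (n + 1) (by omega) le_rfl
      · exact hx' n (by omega) hp fun h => ih n h le_rfl
  have hadm := fun n => hadm' n (hmem n)
  refine ⟨unravelBranch x W _ hadm, follows_unravelBranch hadm (fun n hn => ?_) hq (ha _),
    fun n => rfl⟩
  rcases le_or_gt n K with h1 | h1
  · rw [hx₀ n h1 hn, pick_eq σ (adm_of_le A K h1 _ _ _), unravelPos_congr]
    exacts [fun h => by omega, fun h => by omega]
  · rw [hx n h1 hn, pick_eq]

end Unravel

section Unravel

variable {T : GameTree} (A : Set T.Branch) {K : ℕ}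

/-- The plan of the first player having announced `W`. -/
def planFalse (W : ∀ n, Set (T.Pos n)) : Plan T where
  target n := {s | s ∈ W n ∧ ¬ Meets A s}
  reach _ := W
  quasi := W
  answer := .inr fun n => {s | s ∈ W n ∧ ¬ Win false (fun n => {s | s ∈ W n ∧ ¬ Meets A s}) n s}

variable {A}

theorem isCounter_planFalse {W : ∀ n, Set (T.Pos n)} (hW : IsQuasi W) :
    IsCounter A W fun n => {s | s ∈ W n ∧ ¬ Win false (planFalse A W).target n s} := by
  rintro n s ⟨hs, hw⟩
  refine ⟨hs, by_contra fun h => hw (win_of_mem ⟨hs, h⟩), fun hb => ?_, fun hb t ht hts => ?_⟩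
  · by_contra! h
    exact hw (win_of_forall fun t ht => by_contra fun hwt =>
      h t ⟨(hW n s hs).2 hb t ht, hwt⟩ ht)
  · subst hts
    exact ⟨ht, fun h => hw (win_of_child hb h)⟩

/-- The positions which the second player chooses as an answer to some quasistrategy. -/
def answerTarget (s : T.Pos (K + 1)) (f : UnravelPos A K (K + 1) → UnravelPos A K (K + 2)) (n : ℕ) :
    Set (T.Pos n) :=
  {u | ∃ W, ∃ h : Adm A K (K + 1) s W (.inr fun _ => ∅),
    (f (unravelPos A K s W _ h)).1.answer = .inl ⟨n, u⟩}

open Classical in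
/-- The plan of the second player who is to answer at the position `s`. -/
noncomputable def planTrue (s : T.Pos (K + 1))
    (f : UnravelPos A K (K + 1) → UnravelPos A K (K + 2)) : Plan T where
  target := answerTarget s f
  reach u := if h : u.2 ∈ answerTarget s f u.1 then h.choose else fun _ => ∅
  quasi n := {v | ¬ Win true (answerTarget s f) n v}
  answer :=
    if h : Adm A K (K + 1) s (fun n => {v | ¬ Win true (answerTarget s f) n v}) (.inr fun _ => ∅)
    then (f (unravelPos A K s _ _ h)).1.answer else .inr fun _ => ∅

theorem isQuasi_planTrue (s : T.Pos (K + 1))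
    (f : UnravelPos A K (K + 1) → UnravelPos A K (K + 2)) : IsQuasi (planTrue s f).quasi := by
  intro n v hv
  refine ⟨fun hb => ?_, fun hb t ht => ?_⟩
  · by_contra! h
    exact hv (win_of_forall fun t ht => by_contra fun hwt => h t hwt ht)
  · subst ht
    exact fun h => hv (win_of_child hb h)

variable (A K) in
/-- The moves of the transferred strategy. -/
noncomputable def unravelMove {hK : K.bodd = false} (p : Bool) (σ : (unravel A K hK).Strat) (n : ℕ)
    (t : T.Pos n) : T.Pos (n + 1) :=
  if n ≤ K then pick (A := A) (K := K) (σ n) t (fun _ => ∅) (.inr fun _ => ∅)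
  else match p with
  | false => (planFalse A (σ K (unravelPos A K (ext t K) (fun _ => ∅) (.inr fun _ => ∅)
      (adm_of_le A K le_rfl _ _ _))).1.quasi).move false (K + 2) (A := A) (K := K) (σ n) t
  | true => (planTrue (A := A) (ext t (K + 1)) (σ (K + 1))).move true (K + 1) (A := A) (K := K)
      (σ n) t

variable {hK : K.bodd = false}

theorem exists_lift_false {σ : (unravel A K hK).Strat} {x : T.Branch}
    (hx : ∀ n, n.bodd = false → x (n + 1) = unravelMove A K false σ n (x n)) :
    ∃ y : (unravel A K hK).Branch, Follows false σ y ∧ ∀ n, (y n).1.pos = x n := by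
  have hx₀ : ∀ n ≤ K, n.bodd = false →
      x (n + 1) = pick (A := A) (K := K) (σ n) (x n) (fun _ => ∅) (.inr fun _ => ∅) := fun n h h' =>
    (hx n h').trans (if_pos h)
  have hK' : (K + 1).bodd ≠ false := by simp [hK]
  set a := σ K (unravelPos A K (x K) (fun _ => ∅) (.inr fun _ => ∅)
      (adm_of_le A K le_rfl _ _ _)) with ha
  have hax : a.1.pos = x (K + 1) := by rw [hx₀ K le_rfl hK, pick_eq]
  obtain ⟨hW, hxW⟩ := a.2.1.quasi (by omega)
  rw [hax, ext_self] at hxW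
  have hq : ∀ o, (σ K (unravelPos A K (x K) a.1.quasi o (adm_of_le A K le_rfl _ _ _))).1.quasi =
      a.1.quasi := fun o => by
    rw [ha, unravelPos_congr]
    exacts [fun h => by omega, fun h => by omega]
  have hmove : ∀ n, K + 1 ≤ n → n.bodd = false →
      x (n + 1) = (planFalse A a.1.quasi).move false (K + 2) (A := A) (K := K) (σ n) (x n) := by
    intro n hn hb
    refine (hx n hb).trans ((if_neg (by omega)).trans ?_)
    simp only [ext_apply x (show K ≤ n by omega), ha]
  rcases Plan.reach_or_forall_not_win _ (by omega) (fun n => σ n) hmove with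
    ⟨N, hN, ⟨hNW, hNA⟩, hr⟩ | ⟨hnw, hr⟩
  · exact exists_lift_of_reach hN hNW hNA hW hxW hx₀ hr (fun _ => hq _) fun _ h => absurd h hK'
  · refine exists_lift_of_counter hW hxW (isCounter_planFalse hW) hx₀ hr (fun n hn hb hV => ?_)
      (fun _ => hq _) fun _ h => absurd h hK'
    have hxn : x n ∈ a.1.quasi n := by
      rcases hn.eq_or_lt with rfl | hn
      · exact hxW
      · exact (hV hn).1
    exact ⟨(hW n _ hxn).2 (by simpa using hb) _ (x.2 n), hnw _ (by omega)⟩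

theorem exists_lift_true {σ : (unravel A K hK).Strat} {x : T.Branch}
    (hx : ∀ n, n.bodd = true → x (n + 1) = unravelMove A K true σ n (x n)) :
    ∃ y : (unravel A K hK).Branch, Follows true σ y ∧ ∀ n, (y n).1.pos = x n := by
  have hx₀ : ∀ n ≤ K, n.bodd = true →
      x (n + 1) = pick (A := A) (K := K) (σ n) (x n) (fun _ => ∅) (.inr fun _ => ∅) := fun n h h' =>
    (hx n h').trans (if_pos h)
  have hK' : (K + 1).bodd = true := by simp [hK]
  set P := planTrue (A := A) (x (K + 1)) (σ (K + 1)) with hP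
  have hmove : ∀ n, K + 1 ≤ n → n.bodd = true →
      x (n + 1) = P.move true (K + 1) (A := A) (K := K) (σ n) (x n) := by
    intro n hn hb
    refine (hx n hb).trans ((if_neg (by omega)).trans ?_)
    simp only [ext_apply x (show K + 1 ≤ n by omega), hP]
  rcases Plan.reach_or_forall_not_win P le_rfl (fun n => σ n) hmove with
    ⟨N, hN, hT, hr⟩ | ⟨hnw, hr⟩
  · have hreach : P.reach ⟨N, x N⟩ = hT.choose := dif_pos hT
    rw [hreach] at hr
    obtain ⟨hadm, hans⟩ := hT.choose_spec
    generalize hT.choose = W at *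
    obtain ⟨hW, hxW⟩ := hadm.quasi (by omega)
    rw [ext_self] at hxW
    have hok := (σ (K + 1) (unravelPos A K (x (K + 1)) W _ hadm)).2.1.answer (by omega)
    have hquasi := (quasi_answer_of_par_eq
      (σ.2 (K + 1) (unravelPos A K (x (K + 1)) W _ hadm))).1 (by omega)
    rw [hans, hquasi] at hok
    obtain ⟨h1, h2, h3, -⟩ := hok
    refine exists_lift_of_reach h1 h2 h3 hW hxW hx₀ hr (fun h => by simp [hK] at h) fun h _ => ?_
    refine Eq.trans ?_ hans
    rw [unravelPos_congr]
    exacts [fun _ => rfl, fun h => by omega]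
  · have hW := isQuasi_planTrue (x (K + 1)) (σ (K + 1))
    have hxW : x (K + 1) ∈ P.quasi (K + 1) := hnw _ le_rfl
    have hadm : Adm A K (K + 1) (x (K + 1)) P.quasi (.inr fun _ => ∅) :=
      ⟨fun _ => ⟨hW, by rwa [ext_self]⟩, fun h => by omega⟩
    have hans : P.answer = (σ (K + 1) (unravelPos A K (x (K + 1)) P.quasi _ hadm)).1.answer :=
      dif_pos hadm
    have hok := (σ (K + 1) (unravelPos A K (x (K + 1)) P.quasi _ hadm)).2.1.answer (by omega)
    have hquasi := (quasi_answer_of_par_eq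
      (σ.2 (K + 1) (unravelPos A K (x (K + 1)) P.quasi _ hadm))).1 (by omega)
    rw [hquasi, ← hans] at hok
    have hσ : ∀ o h, (σ (K + 1) (unravelPos A K (x (K + 1)) P.quasi o h)).1.answer = P.answer :=
      fun o h => by
        rw [hans, unravelPos_congr]
        exacts [fun _ => rfl, fun h => by omega]
    rcases ho : P.answer with ⟨N, u⟩ | V
    · rw [ho] at hok
      have hu : u ∈ P.target N := ⟨_, hadm, hans.symm.trans ho⟩
      exact absurd (win_of_mem hu) hok.2.1
    · rw [ho] at hok hr hσ
      refine exists_lift_of_counter hW hxW hok.1 hx₀ hr (fun n hn hb hV => ?_)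
        (fun h => by simp [hK] at h) fun h _ => hσ _ h
      have hn' : K + 2 ≤ n := by
        rcases hn.eq_or_lt with rfl | hn
        · exact absurd hK' hb
        · exact hn
      exact (hok.1 n _ (hV hn')).2.2.2 (by simpa using hb) _ (hnw _ (by omega)) (x.2 n)

theorem unravelMove_local (p : Bool) {σ τ : (unravel A K hK).Strat} {n : ℕ}
    (h : ∀ m ≤ n, σ m = τ m) : unravelMove A K p σ n = unravelMove A K p τ n := by
  funext t
  unfold unravelMove
  rw [h n le_rfl]
  split_ifs with hn
  · rfl
  · rw [h K (by omega), h (K + 1) (by omega)]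

variable (A K hK) in
/-- The covering by the unravelling tree. -/
noncomputable def unravelCover : Cover (unravel A K hK) T where
  map _ a := a.1.pos
  map_par _ _ := rfl
  lift p σ := ⟨unravelMove A K p σ, fun n t => by
    unfold unravelMove
    split
    · exact par_pick _ _ _ _
    · split <;> exact Plan.par_move _ _ _ _ _⟩
  lift_local p _ _ _ h := unravelMove_local p h
  exists_lift p σ x hx := by
    cases p with
    | false => exact exists_lift_false hx
    | true => exact exists_lift_true hx

theorem unravelCover_fixes : (unravelCover A K hK).Fixes K where
  bijective n hn := by
    refine ⟨fun a b h => ?_, fun t => ⟨unravelPos A K t (fun _ => ∅) (.inr fun _ => ∅)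
      (adm_of_le A K hn _ _ _), rfl⟩⟩
    rw [← unravelPos_eta a, ← unravelPos_eta b]
    obtain ⟨⟨t, W, o⟩, ha⟩ := a
    obtain ⟨⟨t', W', o'⟩, hb⟩ := b
    obtain rfl : t = t' := h
    exact unravelPos_congr _ _ (fun h => by omega) (fun h => by omega)
  lift_map p σ n t hn := by
    refine (if_pos hn.le).trans ?_
    change pick (A := A) (K := K) (σ n) t.1.pos _ _ = (σ n t).1.pos
    rw [pick_eq σ (adm_of_le A K hn.le _ _ _)]
    rw [← unravelPos_congr t.2.1 _ (fun h => by omega) (fun h => by omega)]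
    exact congrArg (fun a : UnravelPos A K n => (σ n a).1.pos) (unravelPos_eta t)

theorem answer_eq (x : (unravel A K hK).Branch) {n : ℕ} (hn : K + 2 ≤ n) :
    (x n).1.answer = (x (K + 2)).1.answer := by
  induction n, hn using Nat.le_induction with
  | base => rfl
  | succ n hn ih =>
    rw [← ih]
    exact (quasi_answer_of_par_eq ((x.2 n).trans (unravelPos_eta (x n)).symm)).2 (by omega)

theorem mem_unravelCover_preimage_iff (hA : Open Aᶜ) (x : (unravel A K hK).Branch) :
    x ∈ (unravelCover A K hK).branchMap ⁻¹' A ↔ (x (K + 2)).1.answer.isRight := by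
  rcases ho : (x (K + 2)).1.answer with ⟨N, u⟩ | V
  · simp only [Set.mem_preimage, Sum.isRight_inl, Bool.false_eq_true, iff_false]
    intro hx
    have h := (x (N + K + 2)).2.1.answer (by omega)
    rw [answer_eq x (by omega), ho] at h
    exact h.2.2.1 ⟨_, hx, (ext_apply ((unravelCover A K hK).branchMap x)
      (show N ≤ N + K + 2 by omega)).symm.trans (h.2.2.2.ext_left (by omega))⟩
  · simp only [Set.mem_preimage, Sum.isRight_inr, iff_true]
    by_contra hx
    obtain ⟨n, hn⟩ := hA _ hx
    have h := (x (n + K + 2)).2.1.answer (by omega)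
    rw [answer_eq x (by omega), ho] at h
    have hmem := h.2 (n + K + 2) (by omega) le_rfl
    rw [ext_self] at hmem
    obtain ⟨y, hyA, hy⟩ := (h.1 _ _ hmem).2.1
    exact hn y (Branch.eq_of_le (y := (unravelCover A K hK).branchMap x) hy (by omega)) hyA

end Unravel

/-- Every open set of branches becomes clopen after a covering which is trivial up to stage `k`. -/
theorem exists_cover_of_open {T : GameTree} {A : Set T.Branch} (hA : Open A) (k : ℕ) :
    ∃ S, ∃ C : Cover S T, C.Fixes k ∧ Clopen (C.branchMap ⁻¹' A) := by
  have hK : (2 * k).bodd = false := by simp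
  have hA' : Open (Aᶜ)ᶜ := by rwa [compl_compl]
  refine ⟨_, unravelCover Aᶜ (2 * k) hK, unravelCover_fixes.mono (by omega), ?_⟩
  have key := mem_unravelCover_preimage_iff (hK := hK) hA'
  have key' : ∀ x y : (unravel Aᶜ (2 * k) hK).Branch, y (2 * k + 2) = x (2 * k + 2) →
      ((unravelCover Aᶜ (2 * k) hK).branchMap x ∈ A ↔
        (unravelCover Aᶜ (2 * k) hK).branchMap y ∈ A) := fun x y hxy => by
    have h1 := key x
    have h2 := key y
    rw [hxy, ← h1] at h2
    exact not_iff_not.1 h2.symm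
  exact ⟨fun x hx => ⟨_, fun y hy => (key' x y hy).1 hx⟩,
    fun x hx => ⟨_, fun y hy h => hx ((key' x y hy).2 h)⟩⟩

/-! ### Determinacy -/

variable {T : GameTree}

/-- A set of branches which becomes clopen after a further covering, trivial up to any given
stage, of any covering. -/
def Unravels (A : Set T.Branch) : Prop :=
  ∀ S (C : Cover S T) k, ∃ R, ∃ D : Cover R S, D.Fixes k ∧
    Clopen ((D.trans C).branchMap ⁻¹' A)

theorem Open.iUnion {ι : Type*} {A : ι → Set T.Branch} (h : ∀ i, Open (A i)) :
    Open (⋃ i, A i) := by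
  intro x hx
  obtain ⟨i, hi⟩ := Set.mem_iUnion.1 hx
  obtain ⟨n, hn⟩ := h i x hi
  exact ⟨n, fun y hy => Set.mem_iUnion.2 ⟨i, hn y hy⟩⟩

theorem Clopen.unravels {A : Set T.Branch} (h : Clopen A) : Unravels A := fun S _ _ =>
  ⟨S, Cover.refl S, ⟨fun _ _ => Function.bijective_id, fun _ _ _ _ _ => rfl⟩,
    Cover.branchMap_preimage_clopen _ h⟩

theorem Unravels.compl {A : Set T.Branch} (h : Unravels A) : Unravels Aᶜ := by
  intro S C k
  obtain ⟨R, D, hD, h1, h2⟩ := h S C k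
  exact ⟨R, D, hD, h2, by rwa [← Set.preimage_compl, compl_compl]⟩

theorem Unravels.iUnion {A : ℕ → Set T.Branch} (h : ∀ i, Unravels (A i)) :
    Unravels (⋃ i, A i) := by
  intro S C k
  choose R D hD hA using fun i (C : Σ S, Cover S T) => h i C.1 C.2 (k + i)
  let E : ℕ → Σ S, Cover S T := fun i =>
    Nat.rec ⟨S, C⟩ (fun i C => ⟨R i C, (D i C).trans C.2⟩) i
  have hE : ∀ i, (D i (E i)).Fixes (k + i) := fun i => hD i (E i)
  let L := Cover.limit (T := fun i => (E i).1) (D := fun i => D i (E i)) hE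
  let F : Cover L S := Cover.limitCover (T := fun i => (E i).1) (D := fun i => D i (E i)) hE
  have hproj : ∀ i (x : L.Branch), (F.trans C).branchMap x =
      (E i).2.branchMap
        (Cover.limitProj (T := fun i => (E i).1) (D := fun i => D i (E i)) hE i x) := by
    intro i x
    induction i with
    | zero => rfl
    | succ i ih =>
      rw [ih, ← Cover.branchMap_limitProj]
      rfl
  have hopen : Open ((F.trans C).branchMap ⁻¹' ⋃ i, A i) := by
    rw [Set.preimage_iUnion]
    refine Open.iUnion fun i => ?_
    have : (F.trans C).branchMap ⁻¹' A i = Cover.limitProj (T := fun i => (E i).1)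
        (D := fun i => D i (E i)) hE (i + 1) ⁻¹' ((E (i + 1)).2.branchMap ⁻¹' A i) := by
      ext x
      simp only [Set.mem_preimage, hproj (i + 1)]
    rw [this]
    exact Cover.limitProj_preimage_open (T := fun i => (E i).1) (D := fun i => D i (E i)) hE _
      (hA i (E i)).1
  obtain ⟨R', G, hG, hG'⟩ := exists_cover_of_open hopen k
  exact ⟨R', G.trans F, hG.trans (Cover.limitCover_fixes (T := fun i => (E i).1)
    (D := fun i => D i (E i)) hE), hG'⟩

/-- Determinacy of open games, from every initial position. -/
theorem Open.determined {A : Set T.Branch} (hA : Open A) :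
    ∃ W : Set (T.Pos 0), ∃ σ τ : T.Strat, ∀ x : T.Branch,
      (x 0 ∈ W → Follows false σ x → x ∈ A) ∧ (x 0 ∉ W → Follows true τ x → x ∉ A) := by
  classical
  let U : ∀ n, Set (T.Pos n) := fun n => {t | ∀ x : T.Branch, x n = t → x ∈ A}
  let τ : T.Strat := ⟨fun n t =>
    if h : ∃ t', T.par n t' = t ∧ ¬ Win false U (n + 1) t' then h.choose
    else (Classical.arbitrary T.Strat) n t, fun n t => by
      dsimp only
      split_ifs with h
      · exact h.choose_spec.1
      · exact Strat.par_apply _ _ _⟩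
  obtain ⟨σ, hσ⟩ := exists_attractor (T := T) false U 0
  refine ⟨{t | Win false U 0 t}, σ, τ, fun x => ⟨fun hx hf => ?_, fun hx hf hxA => ?_⟩⟩
  · obtain ⟨n, -, hn⟩ := hσ x ⟨0, le_rfl, hx⟩ fun n hn _ _ => hf n hn
    exact hn x rfl
  · have key : ∀ n, ¬ Win false U n (x n) := by
      intro n
      induction n with
      | zero => exact hx
      | succ n ih =>
        intro hw
        cases hb : n.bodd with
        | false => exact ih (by simpa [x.2] using win_of_child hb hw)
        | true =>
          have h : ∃ t', T.par n t' = x n ∧ ¬ Win false U (n + 1) t' := by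
            by_contra! h
            exact ih (win_of_forall h)
          rw [hf n hb] at hw
          have : τ n (x n) = h.choose := dif_pos h
          rw [this] at hw
          exact h.choose_spec.2 hw
    obtain ⟨n, hn⟩ := hA x hxA
    exact key n (win_of_mem hn)

/-- Determinacy of sets that unravel, from every initial position. -/
theorem Unravels.determined {A : Set T.Branch} (hA : Unravels A) :
    ∃ W : Set (T.Pos 0), ∃ σ τ : T.Strat, ∀ x : T.Branch,
      (x 0 ∈ W → Follows false σ x → x ∈ A) ∧ (x 0 ∉ W → Follows true τ x → x ∉ A) := by
  obtain ⟨S, C, hC, hopen, -⟩ := hA T (Cover.refl T) 0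
  obtain ⟨W, σ, τ, h⟩ := hopen.determined
  refine ⟨C.map 0 '' W, C.lift false σ, C.lift true τ, fun x => ⟨fun hx hf => ?_, fun hx hf => ?_⟩⟩
  · obtain ⟨y, hy, hyx⟩ := C.exists_lift _ _ _ hf
    obtain ⟨t, ht, htx⟩ := hx
    have hy0 : y 0 = t := (hC.1 0 le_rfl).1 (by rw [hyx, htx])
    have := (h y).1 (hy0 ▸ ht) hy
    rwa [show x = (C.trans (Cover.refl T)).branchMap y from Branch.ext fun n => (hyx n).symm]
  · obtain ⟨y, hy, hyx⟩ := C.exists_lift _ _ _ hf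
    have := (h y).2 (fun hW => hx ⟨_, hW, hyx 0⟩) hy
    rwa [show x = (C.trans (Cover.refl T)).branchMap y from Branch.ext fun n => (hyx n).symm]

end GameTree

/-! ### Free products -/

/-- Word length data for a group decomposed as the free product of two factors, in which the words
of level `n + 1` start in the factor given by the parity of `n`. -/
structure Levels {G : Type} [Group G] {M : Bool → Type} [∀ i, Group (M i)]
    (ι : ∀ i, M i →* G) where
  /-- The level of a group element. -/
  lev : G → ℕ
  lev_eq_zero_iff : ∀ g, lev g = 0 ↔ g = 1
  finite_le : ∀ n, {g | lev g ≤ n}.Finite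
  lev_mul : ∀ i a b, a ≠ 1 → (∀ n, lev b = n + 1 → n.bodd ≠ i) →
    lev b < lev (ι i a * b) ∧ ∃ n, n.bodd = i ∧ lev (ι i a * b) = n + 1
  exists_decomp : ∀ i g, ∃ a b, (∀ n, lev b = n + 1 → n.bodd ≠ i) ∧ g = ι i a * b

namespace Levels

section Existence

open Monoid CoprodI

variable {M : Bool → Type} (e : ∀ i, M i → ℕ)

/-- The weight of a list of letters. -/
def weight (l : List (Σ i, M i)) : ℕ := (l.map fun a => e a.1 a.2 + 1).sum

/-- The level of a list of letters. -/
def levelAux : List (Σ i, M i) → ℕ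
  | [] => 0
  | a :: l => 2 * (e a.1 a.2 + weight e l) + a.1.toNat + 1

theorem levelAux_le (l : List (Σ i, M i)) : levelAux e l ≤ 2 * weight e l := by
  cases l with
  | nil => simp [levelAux]
  | cons a l =>
    have := Bool.toNat_le a.1
    simp only [levelAux, weight, List.map_cons, List.sum_cons]
    omega

theorem weight_le (l : List (Σ i, M i)) : weight e l ≤ levelAux e l := by
  cases l with
  | nil => simp [weight]
  | cons a l =>
    simp only [levelAux, weight, List.map_cons, List.sum_cons]
    omega

variable [∀ i, Group (M i)]

theorem bodd_ne_of_fstIdx_ne {i : Bool} {w : Word M} (h : w.fstIdx ≠ some i) (n : ℕ)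
    (hn : levelAux e w.toList = n + 1) : n.bodd ≠ i := by
  obtain ⟨l, h1, h2⟩ := w
  cases l with
  | nil => simp [levelAux] at hn
  | cons a l =>
    simp only [levelAux, Nat.add_right_cancel_iff] at hn
    rintro rfl
    subst hn
    apply h
    obtain ⟨j, a⟩ := a
    cases j <;> simp [Word.fstIdx]

theorem fstIdx_ne_of_bodd_ne {i : Bool} {w : Word M}
    (h : ∀ n, levelAux e w.toList = n + 1 → n.bodd ≠ i) : w.fstIdx ≠ some i := by
  obtain ⟨l, h1, h2⟩ := w
  cases l with
  | nil => simp [Word.fstIdx]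
  | cons a l =>
    have := h _ rfl
    obtain ⟨j, a⟩ := a
    simp only [Word.fstIdx, List.head?_cons, Option.map_some, ne_eq, Option.some.injEq]
    rintro rfl
    apply this
    cases j <;> simp

theorem equiv_of_mul_prod [∀ i, DecidableEq (M i)] {i : Bool} (a : M i) (w : Word M)
    (h : w.fstIdx ≠ some i) (ha : a ≠ 1) :
    Word.equiv (of a * w.prod) = Word.cons a w h ha := by
  rw [← Word.prod_cons i a w ha h]
  exact (Word.equiv (M := M)).apply_symm_apply (Word.cons a w h ha)

theorem finite_weight_le (he : ∀ i, Function.Injective (e i)) (n : ℕ) :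
    {w : Word M | weight e w.toList ≤ n}.Finite := by
  have hinj : ∀ l l' : List (Σ i, M i),
      l.map (fun a => (a.1, e a.1 a.2)) = l'.map (fun a => (a.1, e a.1 a.2)) → l = l' := by
    intro l l' h
    refine List.map_injective_iff.2 ?_ h
    rintro ⟨i, a⟩ ⟨j, b⟩ hab
    simp only [Prod.mk.injEq] at hab
    obtain ⟨rfl, hab⟩ := hab
    rw [he i hab]
  have hlen : ∀ l : List (Σ i, M i), weight e l ≤ n →
      l.length ≤ n ∧ ∀ a ∈ l, e a.1 a.2 < n + 1 := by
    intro l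
    induction l generalizing n with
    | nil => simp
    | cons a l ih =>
      intro h
      simp only [weight, List.map_cons, List.sum_cons] at h
      obtain ⟨h1, h2⟩ := ih (n - (e a.1 a.2 + 1)) (by simp only [weight]; omega)
      simp only [List.length_cons, List.mem_cons, forall_eq_or_imp]
      exact ⟨by omega, by omega, fun b hb => by have := h2 b hb; omega⟩
  refine Set.Finite.of_finite_image (f := fun w : Word M =>
    w.toList.map (fun a => (a.1, Fin.ofNat (n + 1) (e a.1 a.2)))) ?_ ?_
  · refine (List.finite_length_le (Bool × Fin (n + 1)) n).subset ?_
    rintro _ ⟨w, hw, rfl⟩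
    simpa using (hlen _ hw).1
  · intro w hw w' hw' h
    apply Word.ext
    apply hinj
    have key : ∀ l : List (Σ i, M i), (∀ a ∈ l, e a.1 a.2 < n + 1) →
        l.map (fun a => (a.1, e a.1 a.2)) =
        (l.map (fun a => (a.1, Fin.ofNat (n + 1) (e a.1 a.2)))).map fun b => (b.1, b.2.val) := by
      intro l hl
      rw [List.map_map]
      refine List.map_congr_left fun a ha => ?_
      simp [Nat.mod_eq_of_lt (hl a ha)]
    rw [key _ (hlen _ hw).2, key _ (hlen _ hw').2]
    exact congrArg _ h

theorem nonempty_levels_coprodI [∀ i, Countable (M i)] :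
    Nonempty (Levels fun i => (of : M i →* CoprodI M)) := by
  classical
  choose e he using fun i => exists_injective_nat (M i)
  refine ⟨⟨fun g => levelAux e (Word.equiv g).toList, fun g => ?_, fun n => ?_,
    fun i a b ha hb => ?_, fun i g => ?_⟩⟩
  · obtain ⟨w, rfl⟩ := Word.equiv.symm.surjective g
    rw [Equiv.apply_symm_apply]
    change _ ↔ w.prod = 1
    constructor
    · intro h
      obtain ⟨l, h1, h2⟩ := w
      cases l with
      | nil => rfl
      | cons a l => simp [levelAux] at h
    · intro h
      have : w = Word.empty := Word.equiv.symm.injective (h.trans Word.prod_empty.symm)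
      rw [this]
      rfl
  · refine ((finite_weight_le e he n).preimage Word.equiv.injective.injOn).subset fun g hg => ?_
    exact (weight_le e _).trans hg
  · obtain ⟨w, rfl⟩ := Word.equiv.symm.surjective b
    rw [Equiv.apply_symm_apply] at hb ⊢
    change _ < levelAux e (Word.equiv (of a * w.prod)).toList ∧
      ∃ n, n.bodd = i ∧ levelAux e (Word.equiv (of a * w.prod)).toList = n + 1
    rw [equiv_of_mul_prod a w (fstIdx_ne_of_bodd_ne e hb) ha]
    have := levelAux_le e w.toList
    refine ⟨?_, 2 * (e i a + weight e w.toList) + i.toNat, ?_, rfl⟩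
    · change _ < 2 * (e i a + weight e w.toList) + i.toNat + 1
      omega
    · cases i <;> simp
  · obtain ⟨w, rfl⟩ := Word.equiv.symm.surjective g
    refine ⟨(Word.equivPair i w).head, (Word.equivPair i w).tail.prod, ?_, ?_⟩
    · have : Word.equiv (Word.equivPair i w).tail.prod = (Word.equivPair i w).tail :=
        Word.equiv.apply_symm_apply _
      rw [this]
      exact bodd_ne_of_fstIdx_ne e (Word.equivPair i w).fstIdx_ne
    · change w.prod = _
      rw [← Word.prod_rcons]
      congr 1
      exact ((Word.equivPair i).symm_apply_apply w).symm

end Existence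

section Coprod

variable (Γ Δ : Type) [Group Γ] [Group Δ]

/-- The factors of the free product `Γ * Δ`. -/
abbrev Factor (Γ Δ : Type) (i : Bool) : Type := cond i Δ Γ

instance (i : Bool) : Group (Factor Γ Δ i) :=
  match i with
  | false => inferInstanceAs (Group Γ)
  | true => inferInstanceAs (Group Δ)

/-- The inclusions of the factors in the free product. -/
def factorHom : ∀ i, Factor Γ Δ i →* Monoid.Coprod Γ Δ
  | false => (Monoid.Coprod.inl : Γ →* Monoid.Coprod Γ Δ)
  | true => (Monoid.Coprod.inr : Δ →* Monoid.Coprod Γ Δ)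

/-- The binary free product as an indexed free product. -/
def coprodEquiv : Monoid.Coprod Γ Δ ≃* Monoid.CoprodI (Factor Γ Δ) :=
  MonoidHom.toMulEquiv
    (Monoid.Coprod.lift (Monoid.CoprodI.of (M := Factor Γ Δ) (i := false))
      (Monoid.CoprodI.of (M := Factor Γ Δ) (i := true)))
    (Monoid.CoprodI.lift (factorHom Γ Δ))
    (by
      apply Monoid.Coprod.hom_ext
      · ext x
        exact Monoid.CoprodI.lift_of (factorHom Γ Δ) (i := false) x
      · ext x
        exact Monoid.CoprodI.lift_of (factorHom Γ Δ) (i := true) x)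
    (by
      apply Monoid.CoprodI.ext_hom
      rintro (_ | _)
      · ext x
        exact congrArg (Monoid.Coprod.lift (Monoid.CoprodI.of (M := Factor Γ Δ) (i := false))
          (Monoid.CoprodI.of (M := Factor Γ Δ) (i := true)))
          (Monoid.CoprodI.lift_of (factorHom Γ Δ) (i := false) x)
      · ext x
        exact congrArg (Monoid.Coprod.lift (Monoid.CoprodI.of (M := Factor Γ Δ) (i := false))
          (Monoid.CoprodI.of (M := Factor Γ Δ) (i := true)))
          (Monoid.CoprodI.lift_of (factorHom Γ Δ) (i := true) x))

theorem coprodEquiv_factorHom (i : Bool) (a : Factor Γ Δ i) :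
    coprodEquiv Γ Δ (factorHom Γ Δ i a) = Monoid.CoprodI.of a := by
  cases i <;> rfl

theorem nonempty_levels [Countable Γ] [Countable Δ] : Nonempty (Levels (factorHom Γ Δ)) := by
  have : ∀ i, Countable (Factor Γ Δ i) := by
    rintro (_ | _)
    · exact inferInstanceAs (Countable Γ)
    · exact inferInstanceAs (Countable Δ)
  obtain ⟨L⟩ := nonempty_levels_coprodI (M := Factor Γ Δ)
  refine ⟨⟨fun g => L.lev (coprodEquiv Γ Δ g), fun g => ?_, fun n => ?_, fun i a b ha hb => ?_,
    fun i g => ?_⟩⟩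
  · rw [L.lev_eq_zero_iff]
    exact (coprodEquiv Γ Δ).map_eq_one_iff
  · exact (L.finite_le n).preimage (coprodEquiv Γ Δ).injective.injOn
  · rw [map_mul, coprodEquiv_factorHom]
    exact L.lev_mul i a _ ha hb
  · obtain ⟨a, b, hb, h⟩ := L.exists_decomp i (coprodEquiv Γ Δ g)
    refine ⟨a, (coprodEquiv Γ Δ).symm b, by simpa using hb, ?_⟩
    apply (coprodEquiv Γ Δ).injective
    rw [map_mul, coprodEquiv_factorHom, h, MulEquiv.apply_symm_apply]

end Coprod

/-! ### The game on a free product -/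

open GameTree

variable {G : Type} [Group G] {M : Bool → Type} [∀ i, Group (M i)] {ι : ∀ i, M i →* G}
  (L : Levels ι)

/-- The reduced word of `b` does not start in the factor `i`. -/
def Avoids (i : Bool) (b : G) : Prop := ∀ n, L.lev b = n + 1 → n.bodd ≠ i

variable {L}

theorem lev_one : L.lev 1 = 0 := (L.lev_eq_zero_iff 1).2 rfl

theorem avoids_one (i : Bool) : L.Avoids i 1 := fun n hn => by simp [lev_one] at hn

theorem not_avoids_mul {i : Bool} {a : M i} {b : G} (ha : a ≠ 1) (hb : L.Avoids i b) :
    ¬ L.Avoids i (ι i a * b) := fun h => by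
  obtain ⟨-, n, hn, hl⟩ := L.lev_mul i a b ha hb
  exact h n hl hn

theorem decomp_unique {i : Bool} {a a' : M i} {b b' : G} (hb : L.Avoids i b)
    (hb' : L.Avoids i b') (h : ι i a * b = ι i a' * b') : a = a' ∧ b = b' := by
  have : a = a' := by
    by_contra hne
    refine not_avoids_mul (a := a'⁻¹ * a) (fun h => hne (inv_mul_eq_one.1 h).symm) hb ?_
    rwa [map_mul, mul_assoc, h, map_inv, inv_mul_cancel_left]
  subst this
  exact ⟨rfl, mul_left_cancel h⟩

theorem hom_injective (L : Levels ι) (i : Bool) : Function.Injective (ι i) := fun a a' h =>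
  (decomp_unique (L := L) (avoids_one i) (avoids_one i) (by rw [h])).1

variable (L)

/-- The initial letter of `g` in the factor `i`, which is `1` if there is none. -/
noncomputable def left (i : Bool) (g : G) : M i := (L.exists_decomp i g).choose

/-- What remains of `g` after removing its initial letter in the factor `i`. -/
noncomputable def right (i : Bool) (g : G) : G := (L.exists_decomp i g).choose_spec.choose

variable {L}

theorem avoids_right (i : Bool) (g : G) : L.Avoids i (L.right i g) :=
  (L.exists_decomp i g).choose_spec.choose_spec.1

theorem left_mul_right (i : Bool) (g : G) : ι i (L.left i g) * L.right i g = g :=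
  (L.exists_decomp i g).choose_spec.choose_spec.2.symm

theorem left_right_of_avoids {i : Bool} {b : G} (hb : L.Avoids i b) (a : M i) :
    L.left i (ι i a * b) = a ∧ L.right i (ι i a * b) = b :=
  decomp_unique (avoids_right i _) hb (left_mul_right i _)

theorem left_right_mul (i : Bool) (a : M i) (g : G) :
    L.left i (ι i a * g) = a * L.left i g ∧ L.right i (ι i a * g) = L.right i g :=
  decomp_unique (avoids_right i _) (avoids_right i _) (by
    rw [left_mul_right, map_mul, mul_assoc, left_mul_right])

theorem lev_right_le (i : Bool) (g : G) : L.lev (L.right i g) ≤ L.lev g := by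
  by_cases h : L.left i g = 1
  · have := left_mul_right (L := L) i g
    rw [h, map_one, one_mul] at this
    rw [this]
  · have := (L.lev_mul i _ _ h (avoids_right i g)).1.le
    rwa [left_mul_right] at this

variable (L) in
/-- The game on a free product: positions of length `n` are labellings of the words of level at
most `n`, so the two players label the words starting in the respective factors. -/
def tree (K : Type) [Nonempty K] : GameTree where
  Pos n := {g // L.lev g ≤ n} → K
  par n f g := f ⟨g.1, g.2.trans n.le_succ⟩
  par_surj n f := by
    classical
    refine ⟨fun g => if h : L.lev g.1 ≤ n then f ⟨g.1, h⟩ else Classical.arbitrary K, ?_⟩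
    funext g
    simp [g.2]

section Game

variable {K : Type} [Nonempty K]

variable (L) in
/-- The play given by a labelling. -/
def toBranch (y : G → K) : (L.tree K).Branch := ⟨fun _ g => y g.1, fun _ => rfl⟩

/-- The labelling given by a play. -/
def ofBranch (x : (L.tree K).Branch) (g : G) : K := x (L.lev g) ⟨g, le_rfl⟩

theorem unravels_ofBranch_preimage [MeasurableSpace K] {A : Set (G → K)} (hA : MeasurableSet A) :
    Unravels {x : (L.tree K).Branch | ofBranch x ∈ A} := by
  let m : MeasurableSpace (G → K) :=
    { MeasurableSet' := fun A => Unravels {x : (L.tree K).Branch | ofBranch x ∈ A}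
      measurableSet_empty := Clopen.unravels
        ⟨fun _ h => h.elim, fun _ _ => ⟨0, fun _ _ h => h.elim⟩⟩
      measurableSet_compl := fun _ h => h.compl
      measurableSet_iUnion := fun A h => by
        have := Unravels.iUnion h
        convert this using 1
        ext x
        simp }
  have hle : MeasurableSpace.pi ≤ m := by
    refine iSup_le fun g => ?_
    rintro _ ⟨B, -, rfl⟩
    have h : ∀ x y : (L.tree K).Branch, y (L.lev g) = x (L.lev g) →
        ofBranch y g = ofBranch x g := fun x y hxy => congrFun hxy _
    exact Clopen.unravels ⟨fun x hx => ⟨L.lev g, fun y hy => by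
      simpa [h x y hy] using hx⟩, fun x hx => ⟨L.lev g, fun y hy => by simpa [h x y hy] using hx⟩⟩
  exact hle A hA

variable (L) in
theorem determined [MeasurableSpace K] {A : Set (G → K)} (hA : MeasurableSet A) :
    ∃ W : Set K, ∃ σ τ : (L.tree K).Strat, ∀ y : G → K,
      (y 1 ∈ W → Follows false σ (L.toBranch y) → y ∈ A) ∧
      (y 1 ∉ W → Follows true τ (L.toBranch y) → y ∉ A) := by
  obtain ⟨W, σ, τ, h⟩ := (unravels_ofBranch_preimage (L := L) hA).determined
  refine ⟨{k | (fun _ => k) ∈ W}, σ, τ, fun y => ?_⟩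
  have h0 : (fun _ => y 1) = L.toBranch y 0 := by
    funext g
    exact congrArg y ((L.lev_eq_zero_iff _).1 (Nat.le_zero.1 g.2)).symm
  simp only [Set.mem_ofPred_eq, h0]
  exact h (L.toBranch y)

/-- The labelling of a free product which restricts to `x` on the factor `q` and is determined by
the strategy `σ` for the other player along all translates by the factor `q`. -/
noncomputable def spread (q : Bool) (σ : (L.tree K).Strat) (x : M q → K) (g : G) : K :=
  match h : L.lev (L.right q g) with
  | 0 => x (L.left q g)
  | n + 1 => σ n (fun b => spread q σ x (ι q (L.left q g) * b.1)) ⟨L.right q g, h.le⟩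
termination_by L.lev (L.right q g)
decreasing_by
  rw [(left_right_mul q _ _).2, h]
  exact Nat.lt_succ_of_le ((lev_right_le q b.1).trans b.2)

variable {q : Bool} (σ : (L.tree K).Strat)

theorem spread_of_zero (x : M q → K) {g : G} (h : L.lev (L.right q g) = 0) :
    spread q σ x g = x (L.left q g) := by
  rw [spread]
  split
  · rfl
  · omega

theorem spread_of_succ (x : M q → K) {g : G} {n : ℕ} (h : L.lev (L.right q g) = n + 1) :
    spread q σ x g =
      σ n (fun b => spread q σ x (ι q (L.left q g) * b.1)) ⟨L.right q g, h.le⟩ := by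
  rw [spread]
  split
  · omega
  · rename_i k hk
    obtain rfl : n = k := by omega
    rfl

theorem spread_hom (x : M q → K) (a : M q) : spread q σ x (ι q a) = x a := by
  have := left_right_of_avoids (L := L) (avoids_one q) a
  rw [mul_one] at this
  rw [spread_of_zero, this.1]
  rw [this.2, lev_one]

theorem spread_hom_mul (x : M q → K) (a : M q) (g : G) :
    spread q σ x (ι q a * g) = spread q σ (fun b => x (a * b)) g := by
  induction hk : L.lev (L.right q g) using Nat.strong_induction_on generalizing g with
  | _ k ih =>
    obtain ⟨h1, h2⟩ := left_right_mul (L := L) q a g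
    cases k with
    | zero => rw [spread_of_zero _ _ hk, spread_of_zero _ _ (by rw [h2, hk]), h1]
    | succ n =>
      rw [spread_of_succ _ _ hk, spread_of_succ _ _ (by rw [h2, hk])]
      simp only [h2, h1]
      refine congrFun (congrArg (σ n) (funext fun b => ?_)) _
      rw [map_mul, mul_assoc]
      refine ih _ ?_ _ rfl
      rw [(left_right_mul q _ _).2]
      exact Nat.lt_succ_of_le ((lev_right_le q b.1).trans b.2)

theorem spread_shift (x : M q → K) (a : M q) :
    spread q σ (shift a x) = shift (ι q a) (spread q σ x) := by
  funext g
  change _ = spread q σ x ((ι q a)⁻¹ * g)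
  rw [← map_inv, spread_hom_mul]
  rfl

theorem follows_spread {p : Bool} (hpq : p ≠ q) (x : M q → K) :
    Follows p σ (L.toBranch (spread q σ x)) := by
  intro n hn
  funext g
  obtain ⟨g, hg⟩ := g
  change spread q σ x g = _
  rcases hg.lt_or_eq with h | h
  · have := congrFun (σ.par_apply n (L.toBranch (spread q σ x) n)) ⟨g, Nat.le_of_lt_succ h⟩
    exact this.symm
  · have hav : L.Avoids q g := fun m hm => by
      obtain rfl : m = n := by omega
      rwa [hn]
    have h1 := left_right_of_avoids hav (1 : M q)
    rw [map_one, one_mul] at h1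
    rw [spread_of_succ _ _ (by rw [h1.2, h])]
    simp only [h1.1, h1.2, map_one, one_mul]
    rfl

theorem measurable_spread {k : ℕ} [Nonempty (Fin k)] (σ : (L.tree (Fin k)).Strat) :
    Measurable (spread q σ) := by
  refine measurable_pi_lambda _ fun g => ?_
  induction hk : L.lev (L.right q g) using Nat.strong_induction_on generalizing g with
  | _ n ih =>
    cases n with
    | zero =>
      simp only [spread_of_zero _ _ hk]
      exact measurable_pi_apply _
    | succ n =>
      simp only [spread_of_succ _ _ hk]
      have : Finite {g // L.lev g ≤ n} := (L.finite_le n).to_subtype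
      refine (measurable_of_countable
        (fun f : {g // L.lev g ≤ n} → Fin k => σ n f ⟨L.right q g, hk.le⟩)).comp
        (measurable_pi_lambda _ fun b => ?_)
      refine ih _ ?_ _ rfl
      rw [(left_right_mul q _ _).2]
      exact Nat.lt_succ_of_le ((lev_right_le q b.1).trans b.2)

end Game

end Levels

/-! ### Orienting the nonfree orbits -/

namespace Levels

section Walks

variable {G : Type} [Group G] {M : Bool → Type} [∀ i, Group (M i)] {ι : ∀ i, M i →* G}
  {L : Levels ι}

theorem eq_one_of_avoids {i : Bool} {g : G} (h : L.Avoids i g) (h' : L.Avoids (!i) g) :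
    g = 1 := by
  rw [← L.lev_eq_zero_iff]
  cases hl : L.lev g with
  | zero => rfl
  | succ n =>
    have h1 := h n hl
    have h2 := h' n hl
    cases i <;> cases hb : n.bodd <;> simp_all

/-- Every element of a free product is the end of an alternating walk starting at the identity;
the walk is indexed backwards. -/
theorem exists_walk (g : G) (i : Bool) (hg : L.Avoids (!i) g) :
    ∃ (n : ℕ) (w : ℕ → G), w 0 = g ∧ w n = 1 ∧
      ∀ s < n, ∃ a : M (xor s.bodd i), a ≠ 1 ∧ w s = ι _ a * w (s + 1) := by
  induction hk : L.lev g using Nat.strong_induction_on generalizing g i with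
  | _ k ih =>
    have hlr := left_mul_right (L := L) i g
    have hav := avoids_right (L := L) i g
    by_cases ha : L.left i g = 1
    · rw [ha, map_one, one_mul] at hlr
      rw [hlr] at hav
      exact ⟨0, fun _ => g, rfl, eq_one_of_avoids hav hg, fun s hs => absurd hs (by omega)⟩
    · have hlt := (L.lev_mul i _ _ ha hav).1
      rw [hlr, hk] at hlt
      obtain ⟨n, w, h0, hn, hw⟩ := ih _ hlt (L.right i g) (!i) (by simpa using hav) rfl
      refine ⟨n + 1, fun s => Nat.casesOn s g w, rfl, hn, fun s hs => ?_⟩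
      cases s with
      | zero =>
        rw [Nat.bodd_zero, Bool.false_xor]
        refine ⟨_, ha, ?_⟩
        change g = _ * w 0
        rw [h0, hlr]
      | succ s =>
        have := hw s (by omega)
        rw [show xor (s + 1).bodd i = xor s.bodd (!i) by
          rw [Nat.bodd_succ]; cases s.bodd <;> cases i <;> rfl]
        exact this

theorem hom_induction (L : Levels ι) {p : G → Prop} (one : p 1)
    (mul : ∀ i (a : M i) g, p g → p (ι i a * g))
    (g : G) : p g := by
  have key : ∀ g i, L.Avoids (!i) g → p g := by
    intro g i hg
    obtain ⟨n, w, rfl, hn, hw⟩ := exists_walk g i hg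
    have : ∀ s ≤ n, p (w s) := fun s hs => by
      induction hs using Nat.decreasingInduction with
      | self => rwa [hn]
      | of_succ s hs ih =>
        obtain ⟨a, -, h⟩ := hw s hs
        rw [h]
        exact mul _ a _ ih
    exact this 0 (Nat.zero_le _)
  rw [← left_mul_right (L := L) true g]
  exact mul _ _ _ (key _ false (avoids_right true g))

variable {Y : Type} [MulAction G Y]

/-- A nonfree orbit on which both factors act freely contains a directed cycle. -/
theorem exists_cycle (L : Levels ι) {y : Y} {g : G} (hg : g ≠ 1) (hgy : g • y = y)
    (hfree : ∀ i (a : M i) (h : G), a ≠ 1 → ι i a • h • y ≠ h • y) :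
    ∃ P : Bool → Finset G, (∃ i, (P i).Nonempty) ∧
      (∀ i, ∀ a ∈ P i, ∃ b ∈ P (!i), ∃ c : M (!i), ι _ c • a • y = b • y) ∧
      ∀ a ∈ P false, ∀ b ∈ P true, a • y ≠ b • y := by
  classical
  obtain ⟨i, hi⟩ : ∃ i, L.Avoids (!i) g := by
    by_contra! h
    have h1 : ¬ L.Avoids true g := h false
    have h2 : ¬ L.Avoids false g := h true
    simp only [Avoids] at h1 h2
    push Not at h1 h2
    obtain ⟨k, hk, h1⟩ := h1
    obtain ⟨l, hl, h2⟩ := h2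
    obtain rfl : k = l := by omega
    simp [h1] at h2
  obtain ⟨n, w, h0, hn, hw⟩ := exists_walk g i hi
  have hstep : ∀ s < n, ∃ a : M (xor s.bodd i), a ≠ 1 ∧ ι _ a • w s • y = w (s + 1) • y := by
    intro s hs
    obtain ⟨a, ha, h⟩ := hw s hs
    exact ⟨a⁻¹, inv_ne_one.2 ha, by rw [h, map_inv, ← mul_smul, inv_mul_cancel_left]⟩
  have hn0 : 0 < n := Nat.pos_of_ne_zero fun h => hg (by rw [← h0, ← hn, h])
  have hex : ∃ d, 0 < d ∧ ∃ j, j + d ≤ n ∧ w j • y = w (j + d) • y :=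
    ⟨n, hn0, 0, by omega, by rw [zero_add, h0, hn, hgy, one_smul]⟩
  obtain ⟨hd0, j, hjd, hj⟩ := Nat.find_spec hex
  have hmin := fun m hm => Nat.find_min hex (m := m) hm
  generalize Nat.find hex = d at hd0 hjd hj hmin
  have hdist : ∀ s t, s < t → t ≤ n → t < s + d → w s • y ≠ w t • y := fun s t hst htn htd h =>
    hmin (t - s) (by omega) ⟨by omega, s, by omega, by rwa [show s + (t - s) = t by omega]⟩
  obtain ⟨u, e, he0, he, hue, hed, hclose⟩ : ∃ u e, 0 < e ∧ e.bodd = false ∧ u + e ≤ n ∧ e ≤ d ∧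
      ∃ c : M (xor (u + e - 1).bodd i), ι _ c • w (u + e - 1) • y = w u • y := by
    cases hb : d.bodd with
    | false =>
      refine ⟨j, d, hd0, hb, hjd, le_rfl, ?_⟩
      obtain ⟨a, -, ha⟩ := hstep (j + d - 1) (by omega)
      exact ⟨a, by rw [ha, hj, show j + d - 1 + 1 = j + d by omega]⟩
    | true =>
      have hd1 : d ≠ 1 := by
        rintro rfl
        obtain ⟨a, ha, h⟩ := hstep j (by omega)
        exact hfree _ a (w j) ha (h.trans hj.symm)
      obtain ⟨e, rfl⟩ : ∃ e, d = e + 1 := ⟨d - 1, by omega⟩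
      have heb : e.bodd = false := by simpa using hb
      refine ⟨j + 1, e, by omega, heb, by omega, by omega, ?_⟩
      have hj' : j + 1 + e - 1 = j + e := by omega
      rw [hj']
      have hlast := hstep (j + e) (by omega)
      rw [show (j + e).bodd = j.bodd by simp [heb]] at hlast ⊢
      obtain ⟨a, -, ha⟩ := hlast
      obtain ⟨b, -, hb⟩ := hstep j (by omega)
      exact ⟨b * a, by rw [map_mul, mul_smul, ha, ← hb, hj]; rfl⟩
  refine ⟨fun k => ((Finset.Ico u (u + e)).filter fun s => xor s.bodd i = !k).image w,
    ⟨!(xor u.bodd i), w u, Finset.mem_image_of_mem _ ?_⟩, ?_, ?_⟩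
  · simp [he0]
  · intro k a ha
    obtain ⟨s, hs, rfl⟩ := Finset.mem_image.1 ha
    obtain ⟨hs, hk⟩ := Finset.mem_filter.1 hs
    rw [Finset.mem_Ico] at hs
    rw [← hk]
    by_cases hlast : s + 1 = u + e
    · obtain ⟨c, hc⟩ := hclose
      obtain rfl : s = u + e - 1 := by omega
      refine ⟨w u, Finset.mem_image_of_mem _ ?_, c, hc⟩
      have hpar : (u + e - 1).bodd = !u.bodd := by
        have : (u + e - 1 + 1).bodd = u.bodd := by
          rw [hlast]; simp [he]
        rw [Nat.bodd_succ] at this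
        rw [← this, Bool.not_not]
      rw [hpar]
      simp only [Finset.mem_filter, Finset.mem_Ico]
      refine ⟨by omega, ?_⟩
      cases u.bodd <;> cases i <;> rfl
    · obtain ⟨c, -, hc⟩ := hstep s (by omega)
      refine ⟨w (s + 1), Finset.mem_image_of_mem _ ?_, c, hc⟩
      simp only [Finset.mem_filter, Finset.mem_Ico]
      refine ⟨by omega, ?_⟩
      rw [Nat.bodd_succ]
      cases s.bodd <;> cases i <;> rfl
  · intro a ha b hb
    obtain ⟨s, hs, rfl⟩ := Finset.mem_image.1 ha
    obtain ⟨t, ht, rfl⟩ := Finset.mem_image.1 hb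
    simp only [Finset.mem_filter, Finset.mem_Ico] at hs ht
    rcases lt_trichotomy s t with h | rfl | h
    · exact hdist s t h (by omega) (by omega)
    · simp_all
    · exact (hdist t s h (by omega) (by omega)).symm

end Walks

section Orient

variable {G : Type} [Group G] {M : Bool → Type} [∀ i, Group (M i)] (ι : ∀ i, M i →* G)
  {Y : Type} [MulAction G Y]

/-- The points whose orbit under the factor `i` is at distance at most `n` from the given seeds or
from orbits with nontrivial stabilizers. -/
def Near (O : Bool → Y → Prop) : ℕ → Bool → Y → Prop
  | 0, i, y => (∃ a : M i, a ≠ 1 ∧ ι i a • y = y) ∨ ∃ a : M i, O i (ι i a • y)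
  | n + 1, i, y => Near O n i y ∨ ∃ a : M i, Near O n (!i) (ι i a • y)

variable {ι} {O : Bool → Y → Prop}

theorem Near.smul {n : ℕ} {i : Bool} {y : Y} (h : Near ι O n i y) (a : M i) :
    Near ι O n i (ι i a • y) := by
  induction n with
  | zero =>
    rcases h with ⟨b, hb, h⟩ | ⟨b, h⟩
    · refine Or.inl ⟨a * b * a⁻¹, by simpa using hb, ?_⟩
      rw [← mul_smul, ← map_mul, inv_mul_cancel_right, map_mul, mul_smul, h]
    · exact Or.inr ⟨b * a⁻¹, by rwa [← mul_smul, ← map_mul, inv_mul_cancel_right]⟩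
  | succ n ih =>
    rcases h with h | ⟨b, h⟩
    · exact Or.inl (ih h)
    · exact Or.inr ⟨b * a⁻¹, by rwa [← mul_smul, ← map_mul, inv_mul_cancel_right]⟩

theorem Near.of_smul {n : ℕ} {i : Bool} {y : Y} {a : M i} (h : Near ι O n i (ι i a • y)) :
    Near ι O n i y := by
  simpa [← mul_smul, ← map_mul] using h.smul a⁻¹

theorem Near.mono {m n : ℕ} (hmn : m ≤ n) {i : Bool} {y : Y} (h : Near ι O m i y) :
    Near ι O n i y := by
  induction n, hmn using Nat.le_induction with
  | base => exact h
  | succ n _ ih => exact Or.inl ih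

theorem Near.succ_not {n : ℕ} {i : Bool} {y : Y} (h : Near ι O n i y) :
    Near ι O (n + 1) (!i) y :=
  Or.inr ⟨1, by rwa [map_one, one_smul, Bool.not_not]⟩

theorem Near.exists_smul (L : Levels ι) {n : ℕ} {i : Bool} {y : Y} (h : Near ι O n i y) (g : G)
    (j : Bool) : ∃ m, Near ι O m j (g • y) := by
  have hall : ∀ {n i} {z : Y}, Near ι O n i z → ∀ j, ∃ m, Near ι O m j z := by
    intro n i z h j
    by_cases hij : j = i
    · exact ⟨n, hij ▸ h⟩
    · obtain rfl : j = !i := Bool.eq_not.2 hij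
      exact ⟨n + 1, h.succ_not⟩
  induction g using hom_induction (L := L) generalizing j with
  | one => rw [one_smul]; exact hall h j
  | mul k a g ih =>
    obtain ⟨m, hm⟩ := ih k
    rw [mul_smul]
    exact hall (hm.smul a) j

/-- The point `y` is given to its orbit under the factor `i` since its orbit under the other
factor is nearer to the seeds. -/
def Outward (ι : ∀ i, M i →* G) (O : Bool → Y → Prop) (i : Bool) (y : Y) : Prop :=
  ∃ n, Near ι O n (!i) y ∧ ¬ Near ι O n i y

theorem Outward.not_not {i : Bool} {y : Y} (h : Outward ι O i y) : ¬ Outward ι O (!i) y := by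
  rintro ⟨m, h1, h2⟩
  obtain ⟨n, h3, h4⟩ := h
  rw [Bool.not_not] at h1
  rcases le_total m n with hmn | hmn
  · exact h4 (h1.mono hmn)
  · exact h2 (h3.mono hmn)

variable [Countable G] [MeasurableSpace Y]

theorem measurable_near (L : Levels ι) (hact : ∀ g : G, Measurable fun y : Y => g • y)
    {B : ℕ → Y → Prop} (hB : ∀ n, Measurable (B n)) (hsep : ∀ y z, (∀ n, B n y → B n z) → y = z)
    (hO : ∀ i, Measurable (O i)) (n : ℕ) (i : Bool) : Measurable (Near ι O n i) := by
  have : ∀ i, Countable (M i) := fun i => (hom_injective L i).countable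
  have heq : ∀ g : G, Measurable fun y : Y => g • y = y := fun g => by
    have : (fun y : Y => g • y = y) = fun y => ∀ n, B n (g • y) → B n y := by
      funext y
      exact propext ⟨fun h n => by rw [h]; exact id, fun h => hsep _ _ h⟩
    rw [this]
    exact Measurable.forall fun n => ((hB n).comp (hact g)).imp (hB n)
  induction n generalizing i with
  | zero =>
    exact (Measurable.exists fun a => measurable_const.and (heq _)).or
      (Measurable.exists fun a => (hO i).comp (hact _))
  | succ n ih =>
    exact (ih i).or (Measurable.exists fun a => (ih (!i)).comp (hact _))

/-- Seeds on the orbits without nontrivial stabilizers in the factors can be extended to an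
assignment of the points to the two factors which hits each free orbit of a factor. -/
theorem exists_orientation_of_seeds (L : Levels ι)
    (hact : ∀ g : G, Measurable fun y : Y => g • y)
    {B : ℕ → Y → Prop} (hB : ∀ n, Measurable (B n)) (hsep : ∀ y z, (∀ n, B n y → B n z) → y = z)
    (hO : ∀ i, Measurable (O i)) (hdisj : ∀ y, O false y → ¬ O true y)
    (hnext : ∀ i y, O i y → ∃ a : M (!i), O (!i) (ι _ a • y))
    (hseed : ∀ (y : Y) (g : G), g ≠ 1 → g • y = y →
      (∀ i (a : M i) (h : G), a ≠ 1 → ι i a • h • y ≠ h • y) → ∃ (h : G) (i : Bool), O i (h • y)) :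
    ∃ V : Y → Prop, Measurable V ∧ ∀ i y, (∃ g : G, g ≠ 1 ∧ g • y = y) →
      (∀ a : M i, a ≠ 1 → ι i a • y ≠ y) → ∃ a : M i, V (ι i a • y) ↔ i = true := by
  have hnear := measurable_near L hact hB hsep hO
  have hout : ∀ i, Measurable (Outward ι O i) := fun i =>
    Measurable.exists fun n => (hnear n _).and (hnear n _).not
  refine ⟨fun y => Outward ι O true y ∨ ¬ Outward ι O false y ∧ O true y,
    (hout _).or ((hout _).not.and (hO _)), ?_⟩
  rintro i y ⟨g, hg, hgy⟩ hfree
  have hex : ∃ n, Near ι O n i y := by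
    obtain ⟨h, j, hj⟩ : ∃ (h : G) (j : Bool), Near ι O 0 j (h • y) := by
      by_cases hall : ∀ i (a : M i) (h : G), a ≠ 1 → ι i a • h • y ≠ h • y
      · obtain ⟨h, j, hO⟩ := hseed y g hg hgy hall
        exact ⟨h, j, Or.inr ⟨1, by rwa [map_one, one_smul]⟩⟩
      · push Not at hall
        obtain ⟨j, a, h, ha, he⟩ := hall
        exact ⟨h, j, Or.inl ⟨a, ha, he⟩⟩
    simpa [← mul_smul] using hj.exists_smul L h⁻¹ i
  classical
  obtain ⟨n, hn, hmin⟩ : ∃ n, Near ι O n i y ∧ ∀ m < n, ¬ Near ι O m i y :=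
    ⟨Nat.find hex, Nat.find_spec hex, fun m hm => Nat.find_min hex hm⟩
  cases n with
  | zero =>
    rcases hn with ⟨a, ha, h⟩ | ⟨a, ha⟩
    · exact absurd h (hfree a ha)
    · refine ⟨a, ?_⟩
      have h1 : ∀ j, Near ι O 0 j (ι i a • y) := by
        intro j
        by_cases hij : j = i
        · subst hij
          exact Or.inr ⟨1, by rwa [map_one, one_smul]⟩
        · obtain rfl : j = !i := Bool.eq_not.2 hij
          exact Or.inr (hnext i _ ha)
      have h2 : ∀ j, ¬ Outward ι O j (ι i a • y) := fun j ⟨n, _, hn⟩ =>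
        hn ((h1 j).mono (Nat.zero_le n))
      cases i
      · simpa [h2] using hdisj _ ha
      · simpa [h2] using ha
  | succ n =>
    rcases hn with h | ⟨a, ha⟩
    · exact absurd h (hmin n n.lt_succ_self)
    · refine ⟨a, ?_⟩
      have h1 : Outward ι O i (ι i a • y) :=
        ⟨n, ha, fun h => hmin n n.lt_succ_self h.of_smul⟩
      have h2 := h1.not_not
      cases i with
      | false => simpa [h1] using h2
      | true => simpa using Or.inl h1

/-- The nonfree points can be assigned to the two factors in a measurable way so that each free
orbit of a factor contains a point which is assigned to this factor. -/
theorem exists_orientation (L : Levels ι) (hact : ∀ g : G, Measurable fun y : Y => g • y)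
    {B : ℕ → Y → Prop} (hB : ∀ n, Measurable (B n))
    (hsep : ∀ y z, (∀ n, B n y → B n z) → y = z) :
    ∃ V : Y → Prop, Measurable V ∧ ∀ i y, (∃ g : G, g ≠ 1 ∧ g • y = y) →
      (∀ a : M i, a ≠ 1 → ι i a • y ≠ y) → ∃ a : M i, V (ι i a • y) ↔ i = true := by
  have : ∀ i, Countable (M i) := fun i => (hom_injective L i).countable
  have heq : ∀ g h : G, Measurable fun y : Y => g • y = h • y := fun g h => by
    have : (fun y : Y => g • y = h • y) = fun y => ∀ n, B n (g • y) → B n (h • y) := by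
      funext y
      exact propext ⟨fun h n => by rw [h]; exact id, fun h => hsep _ _ h⟩
    rw [this]
    exact Measurable.forall fun n => ((hB n).comp (hact g)).imp ((hB n).comp (hact h))
  let C := (Bool → Finset G) × Finset (G × ℕ)
  obtain ⟨c, hc⟩ : ∃ c : ℕ → C, Function.Surjective c := exists_surjective_nat C
  let Base : ℕ → Y → Prop := fun k y =>
    (∀ p : G × ℕ, p ∈ (c k).2 → B p.2 y ∧ ¬ B p.2 (p.1 • y)) ∧
    ∀ i, ∀ a : G, a ∈ (c k).1 i → ∃ b : G, b ∈ (c k).1 (!i) ∧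
      ∃ d : M (!i), (ι _ d * a) • y = b • y
  have hBase : ∀ k, Measurable (Base k) := fun k =>
    (Measurable.forall fun p => measurable_const.imp
      ((hB _).and ((hB _).comp (hact _)).not)).and
    (Measurable.forall fun i => Measurable.forall fun a => measurable_const.imp
      (Measurable.exists fun b => measurable_const.and (Measurable.exists fun d => heq _ _)))
  let Out : Bool → ℕ → Y → Prop := fun i k y => ∃ a : G, a ∈ (c k).1 i ∧ Base k (a⁻¹ • y)
  have hOut : ∀ i k, Measurable (Out i k) := fun i k =>
    Measurable.exists fun a => measurable_const.and ((hBase k).comp (hact _))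
  let Good : ℕ → Y → Prop := fun k y =>
    (∃ (g : G) (i : Bool), Out i k (g • y)) ∧ ∀ g : G, ¬ (Out false k (g • y) ∧ Out true k (g • y))
  have hGood : ∀ k, Measurable (Good k) := fun k =>
    (Measurable.exists fun g => Measurable.exists fun i => (hOut i k).comp (hact g)).and
    (Measurable.forall fun g => (((hOut _ k).comp (hact g)).and ((hOut _ k).comp (hact g))).not)
  have hinv : ∀ k (g : G) y, Good k (g • y) ↔ Good k y := by
    have : ∀ k (g : G) y, Good k y → Good k (g • y) := by
      rintro k g y ⟨⟨h, i, h1⟩, h2⟩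
      refine ⟨⟨h * g⁻¹, i, ?_⟩, fun h => ?_⟩
      · rwa [← mul_smul, inv_mul_cancel_right]
      · rw [← mul_smul]
        exact h2 _
    exact fun k g y => ⟨fun h => by simpa [← mul_smul] using this k g⁻¹ _ h, this k g y⟩
  refine exists_orientation_of_seeds (O := fun i y => ∃ k, (Good k y ∧ ∀ l < k, ¬ Good l y) ∧
    Out i k y) L hact hB hsep ?_ ?_ ?_ ?_
  · exact fun i => Measurable.exists fun k => ((hGood k).and (Measurable.forall fun l =>
      measurable_const.imp (hGood l).not)).and (hOut i k)
  · rintro y ⟨k, ⟨h1, h2⟩, h3⟩ ⟨l, ⟨h4, h5⟩, h6⟩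
    obtain rfl : k = l := by
      rcases lt_trichotomy k l with h | h | h
      · exact absurd h1 (h5 k h)
      · exact h
      · exact absurd h4 (h2 l h)
    refine h1.2 1 ?_
    rw [one_smul]
    exact ⟨h3, h6⟩
  · rintro i y ⟨k, hk, a, ha, hy⟩
    obtain ⟨b, hb, d, hd⟩ := hy.2 i a ha
    rw [mul_smul, smul_inv_smul] at hd
    refine ⟨d, k, by simpa only [hinv] using hk, b, hb, ?_⟩
    rwa [hd, inv_smul_smul]
  · intro y g hg hgy hfree
    obtain ⟨P, ⟨j, a, ha⟩, hP, hne⟩ := exists_cycle L hg hgy hfree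
    have hsep' : ∀ g : G, ∃ n, g • y ≠ y → B n y ∧ ¬ B n (g • y) := by
      intro g
      by_cases h : g • y = y
      · exact ⟨0, fun h' => absurd h h'⟩
      · have := mt (hsep y (g • y)) (Ne.symm h)
        push Not at this
        exact this.imp fun n hn _ => hn
    choose s hs using hsep'
    classical
    obtain ⟨k, hk⟩ := hc (P, ((P false ×ˢ P true).image fun p => (p.2⁻¹ * p.1, s (p.2⁻¹ * p.1))))
    have hbase : Base k y := by
      refine ⟨fun p hp => ?_, fun i a ha => ?_⟩
      · rw [hk] at hp
        obtain ⟨⟨a, b⟩, hab, rfl⟩ := Finset.mem_image.1 hp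
        rw [Finset.mem_product] at hab
        refine hs _ fun h => hne a hab.1 b hab.2 ?_
        rw [mul_smul, inv_smul_eq_iff] at h
        exact h
      · rw [hk] at ha ⊢
        simpa only [mul_smul] using hP i a ha
    have hgood : Good k y := by
      refine ⟨⟨a, j, a, by rwa [hk], by rwa [inv_smul_smul]⟩, ?_⟩
      rintro h ⟨⟨a, ha, h1⟩, b, hb, h2⟩
      have := h1.1 (b⁻¹ * a, s (b⁻¹ * a)) (by
        rw [hk] at ha hb ⊢
        exact Finset.mem_image.2 ⟨(a, b), Finset.mem_product.2 ⟨ha, hb⟩, rfl⟩)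
      rw [mul_smul, smul_inv_smul] at this
      have h' := h2.1 (b⁻¹ * a, s (b⁻¹ * a)) (by
        rw [hk] at ha hb ⊢
        exact Finset.mem_image.2 ⟨(a, b), Finset.mem_product.2 ⟨ha, hb⟩, rfl⟩)
      exact this.2 h'.1
    have hex : ∃ k, Good k y := ⟨k, hgood⟩
    obtain ⟨k, hk, hmin⟩ : ∃ k, Good k y ∧ ∀ l < k, ¬ Good l y :=
      ⟨Nat.find hex, Nat.find_spec hex, fun m hm => Nat.find_min hex hm⟩
    obtain ⟨⟨h, i, ho⟩, -⟩ := id hk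
    exact ⟨h, i, k, by simpa only [hinv] using ⟨hk, hmin⟩, ho⟩

end Orient

end Levels

/-! ### Colorings of free parts of shifts -/

section Shift

variable {H : Type} [Group H] {k : ℕ}

theorem shift_one (y : H → Fin k) : shift 1 y = y := by
  funext g
  simp [shift]

theorem shift_mul (a b : H) (y : H → Fin k) : shift (a * b) y = shift a (shift b y) := by
  funext g
  simp [shift, mul_assoc]

theorem measurable_shift (a : H) : Measurable (shift a : (H → Fin k) → H → Fin k) :=
  measurable_pi_lambda _ fun _ => measurable_pi_apply _

theorem measurableSet_freePart [Countable H] : MeasurableSet (freePart H (Fin k)) := by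
  have : freePart H (Fin k) = ⋂ a : H, ⋂ _ : a ≠ 1, {y | shift a y = y}ᶜ := by
    ext y
    simp [freePart]
  rw [this]
  exact MeasurableSet.iInter fun a => MeasurableSet.iInter fun _ =>
    (measurableSet_eq_fun (measurable_shift a) measurable_id).compl

theorem nonempty_freePart (hk : 2 ≤ k) : Nonempty (freePart H (Fin k)) := by
  classical
  refine ⟨⟨fun g => if g = 1 then ⟨0, by omega⟩ else ⟨1, by omega⟩, fun a ha h => ha ?_⟩⟩
  have := congrFun h 1
  simpa [shift] using this

theorem exists_measurable_coloring [Countable H] {S : Set H} (hS : 1 ∉ S) (k : ℕ) :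
    ∃ (Z : Type) (_ : MeasurableSpace Z), StandardBorelSpace Z ∧
      Cardinal.mk Z = borelChromaticNumber (cayleyAdj S (Fin k)) ∧
      ∃ c : freePart H (Fin k) → Z, Measurable c ∧
        ∀ x y, cayleyAdj S (Fin k) x y → c x ≠ c y := by
  refine csInf_mem (s := {κ : Cardinal | ∃ (Z : Type) (mZ : MeasurableSpace Z),
    @StandardBorelSpace Z mZ ∧ Cardinal.mk Z = κ ∧ ∃ c : freePart H (Fin k) → Z,
      Measurable c ∧ ∀ x y, cayleyAdj S (Fin k) x y → c x ≠ c y})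
    ⟨_, freePart H (Fin k), inferInstance, measurableSet_freePart.standardBorel, rfl, id,
      measurable_id, ?_⟩
  rintro x y ⟨a, ha, h⟩ rfl
  exact x.2 a (fun h1 => hS (h1 ▸ ha)) (h.elim id id)

theorem borelChromaticNumber_ne_zero [Countable H] {S : Set H} (hS : 1 ∉ S) (hk : 2 ≤ k) :
    borelChromaticNumber (cayleyAdj S (Fin k)) ≠ 0 := by
  obtain ⟨Z, mZ, -, hZ, c, -, -⟩ := exists_measurable_coloring hS k
  obtain ⟨x⟩ := nonempty_freePart (H := H) hk
  rw [← hZ, Cardinal.mk_ne_zero_iff]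
  exact ⟨c x⟩

end Shift

theorem borelChromaticNumber_le_mk {X : Type} [MeasurableSpace X] {R : X → X → Prop} {Z : Type}
    [MeasurableSpace Z] [StandardBorelSpace Z] {c : X → Z} (hc : Measurable c)
    (hR : ∀ x y, R x y → c x ≠ c y) {Z' : Set Z} (hZ' : MeasurableSet Z') (h : ∀ x, c x ∈ Z') :
    borelChromaticNumber R ≤ Cardinal.mk Z' :=
  csInf_le' ⟨Z', inferInstance, hZ'.standardBorel, rfl, fun x => ⟨c x, h x⟩, hc.subtype_mk,
    fun x y hxy he => hR x y hxy (congrArg Subtype.val he)⟩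

namespace Levels

open GameTree

section

variable {G : Type} [Group G] {M : Bool → Type} [∀ i, Group (M i)] {ι : ∀ i, M i →* G}
  {L : Levels ι} {k : ℕ}

theorem countable (L : Levels ι) : Countable G := by
  have : (⋃ n, {g | L.lev g ≤ n}) = Set.univ :=
    Set.eq_univ_of_forall fun g => Set.mem_iUnion.2 ⟨L.lev g, le_refl (L.lev g)⟩
  rw [← Set.countable_univ_iff, ← this]
  exact Set.countable_iUnion fun n => (L.finite_le n).countable

theorem exists_orientation_shift (L : Levels ι) [Countable G] [Nonempty (Fin k)] :
    ∃ V : (G → Fin k) → Prop, Measurable V ∧ ∀ i, ∀ y ∉ freePart G (Fin k),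
      (∀ a : M i, a ≠ 1 → shift (ι i a) y ≠ y) → ∃ a : M i, V (shift (ι i a) y) ↔ i = true := by
  let _ : MulAction G (G → Fin k) :=
    { smul := shift
      one_smul := shift_one
      mul_smul := shift_mul }
  obtain ⟨e, he⟩ := exists_surjective_nat (G × Fin k)
  obtain ⟨V, hV, h⟩ := exists_orientation (Y := G → Fin k) L measurable_shift
    (B := fun n y => y (e n).1 = (e n).2)
    (fun n => (measurable_of_countable fun j => j = (e n).2).comp (measurable_pi_apply _))
    (fun y z h => funext fun g => by
      obtain ⟨n, hn⟩ := he (g, y g)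
      have := h n
      rw [hn] at this
      exact (this rfl).symm)
  refine ⟨V, hV, fun i y hy => h i y ?_⟩
  simp only [freePart, Set.mem_ofPred_eq] at hy
  push Not at hy
  exact hy

/-- A winning strategy gives an equivariant map from the free part of the shift of a factor into
the winning set, provided that this set contains no nonfree orbit on which the factor acts
freely. -/
theorem exists_equivariant_map [Nonempty (Fin k)] {p q : Bool} (hpq : p ≠ q)
    {σ : (L.tree (Fin k)).Strat} {W : Set (Fin k)} {A : Set (G → Fin k)}
    (hσ : ∀ y, y 1 ∈ W → Follows p σ (L.toBranch y) → y ∈ A)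
    (hA : ∀ y ∉ freePart G (Fin k), (∀ a : M q, a ≠ 1 → shift (ι q a) y ≠ y) →
      ∃ a : M q, shift (ι q a) y ∉ A)
    {m : ℕ} {e : Fin m → Fin k} (he : Function.Injective e) (heW : ∀ j, e j ∈ W) :
    ∃ f : freePart (M q) (Fin m) → freePart G (Fin k), Measurable f ∧ (∀ x, (f x : G → Fin k) ∈ A) ∧
      ∀ (x x' : freePart (M q) (Fin m)) a, shift a x.1 = x'.1 →
        shift (ι q a) (f x).1 = (f x').1 := by
  let F : (M q → Fin m) → G → Fin k := fun x => spread q σ (e ∘ x)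
  have hFA : ∀ x, F x ∈ A := fun x =>
    hσ _ (by
      have := spread_hom σ (e ∘ x) 1
      rw [map_one] at this
      change spread q σ (e ∘ x) 1 ∈ W
      rw [this]
      exact heW _) (follows_spread σ hpq _)
  have hFs : ∀ x a, shift (ι q a) (F x) = F (shift a x) := fun x a =>
    (spread_shift σ (e ∘ x) a).symm
  have hF : ∀ x ∈ freePart (M q) (Fin m), F x ∈ freePart G (Fin k) := by
    intro x hx
    by_contra hn
    obtain ⟨a, ha⟩ := hA _ hn fun a ha h => by
      refine hx a ha (funext fun b => he ?_)
      have := congrFun h (ι q b)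
      rw [hFs] at this
      exact (spread_hom σ (e ∘ shift a x) b).symm.trans (this.trans (spread_hom σ (e ∘ x) b))
    rw [hFs] at ha
    exact ha (hFA _)
  refine ⟨fun x => ⟨F x, hF x x.2⟩, Measurable.subtype_mk ?_, fun x => hFA x, fun x x' a h => ?_⟩
  · refine (measurable_spread σ).comp (measurable_pi_lambda _ fun b => ?_)
    exact (measurable_of_countable e).comp ((measurable_pi_apply b).comp measurable_subtype_coe)
  · exact (hFs x a).trans (congrArg F h)

end

end Levels

section Coprod

open Levels GameTree

variable {Γ Δ : Type} [Group Γ] [Group Δ] [Countable Γ] [Countable Δ]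

/-- Whenever the colors of a coloring for a free product are divided into two parts, one of them
suffices for the respective factor. -/
theorem borelChromaticNumber_le_or {m n : ℕ} (hm : 2 ≤ m) {S : Set Γ} {T : Set Δ}
    {Z : Type} [MeasurableSpace Z] [StandardBorelSpace Z]
    {c : freePart (Monoid.Coprod Γ Δ) (Fin (m + n - 1)) → Z} (hc : Measurable c)
    (hcol : ∀ x y, cayleyAdj ((fun γ => Monoid.Coprod.inl γ) '' S ∪
      (fun δ => Monoid.Coprod.inr δ) '' T : Set (Monoid.Coprod Γ Δ)) (Fin (m + n - 1)) x y →
        c x ≠ c y)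
    {Z' : Set Z} (hZ' : MeasurableSet Z') :
    borelChromaticNumber (cayleyAdj T (Fin n)) ≤ Cardinal.mk Z' ∨
      borelChromaticNumber (cayleyAdj S (Fin m)) ≤ Cardinal.mk ↥Z'ᶜ := by
  obtain ⟨L⟩ := nonempty_levels Γ Δ
  have : Countable (Monoid.Coprod Γ Δ) := L.countable
  have : Nonempty (Fin (m + n - 1)) := ⟨⟨0, by omega⟩⟩
  obtain ⟨V, hV, hVo⟩ := exists_orientation_shift L (k := m + n - 1)
  let A : Set (Monoid.Coprod Γ Δ → Fin (m + n - 1)) :=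
    Subtype.val '' (c ⁻¹' Z') ∪ ((freePart _ _)ᶜ ∩ {y | ¬ V y})
  have hA : MeasurableSet A := (measurableSet_freePart.subtype_image (hc hZ')).union
    (measurableSet_freePart.compl.inter (measurableSet_setOfPred.2 hV.not))
  have hAfree : ∀ x : freePart (Monoid.Coprod Γ Δ) (Fin (m + n - 1)), x.1 ∈ A ↔ c x ∈ Z' :=
    fun x => ⟨fun h => by
      rcases h with ⟨y, hy, hyx⟩ | ⟨h, -⟩
      · rwa [← Subtype.ext hyx]
      · exact absurd x.2 h, fun h => Or.inl ⟨x, h, rfl⟩⟩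
  have hAnon : ∀ y ∉ freePart (Monoid.Coprod Γ Δ) (Fin (m + n - 1)), y ∈ A ↔ ¬ V y :=
    fun y hy => ⟨fun h => by
      rcases h with ⟨x, -, rfl⟩ | ⟨-, h⟩
      · exact absurd x.2 hy
      · exact h, fun h => Or.inr ⟨hy, h⟩⟩
  have hshift : ∀ (a : Monoid.Coprod Γ Δ), ∀ y ∉ freePart (Monoid.Coprod Γ Δ) (Fin (m + n - 1)),
      shift a y ∉ freePart (Monoid.Coprod Γ Δ) (Fin (m + n - 1)) := by
    intro a y hy h
    refine hy fun b hb hby => h (a * b * a⁻¹) (by simpa using hb) ?_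
    rw [← shift_mul, inv_mul_cancel_right, shift_mul, hby]
  obtain ⟨W, σ, τ, hW⟩ := L.determined hA
  have hemb : ∀ (l : ℕ) (U : Set (Fin (m + n - 1))), l ≤ U.ncard →
      ∃ e : Fin l → Fin (m + n - 1), Function.Injective e ∧ ∀ j, e j ∈ U := by
    intro l U hl
    have hcard : Fintype.card (Fin l) ≤ Nat.card U := by
      simpa [Set.ncard] using hl
    have := Fintype.ofFinite U
    obtain ⟨e⟩ := Function.Embedding.nonempty_of_card_le
      (hcard.trans_eq (Nat.card_eq_fintype_card (α := U)))
    exact ⟨fun j => e j, fun i j h => e.injective (Subtype.ext h), fun j => (e j).2⟩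
  have hcard : W.ncard + Wᶜ.ncard = m + n - 1 := by
    rw [Set.ncard_add_ncard_compl, Nat.card_fin]
  rcases (by omega : n ≤ W.ncard ∨ m ≤ Wᶜ.ncard) with h | h
  · left
    obtain ⟨e, he, heW⟩ := hemb _ _ h
    obtain ⟨f, hf, hfA, hfs⟩ := exists_equivariant_map (q := true) Bool.false_ne_true
      (fun y => (hW y).1) (fun y hy hfree => by
        obtain ⟨a, ha⟩ := hVo true y hy hfree
        exact ⟨a, by rw [hAnon _ (hshift _ _ hy)]; simpa using ha⟩) he heW
    refine borelChromaticNumber_le_mk (hc.comp hf) ?_ hZ' fun x => (hAfree _).1 (hfA x)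
    rintro x y ⟨a, ha, h⟩
    exact hcol _ _ ⟨_, Or.inr ⟨a, ha, rfl⟩, h.imp (hfs x y a) (hfs y x a)⟩
  · right
    obtain ⟨e, he, heW⟩ := hemb _ _ h
    obtain ⟨f, hf, hfA, hfs⟩ := exists_equivariant_map (q := false) (A := Aᶜ) Bool.true_eq_false.mp
      (fun y => (hW y).2) (fun y hy hfree => by
        obtain ⟨a, ha⟩ := hVo false y hy hfree
        exact ⟨a, by
          rw [Set.notMem_compl_iff, hAnon _ (hshift _ _ hy)]; simpa using ha⟩) he heW
    refine borelChromaticNumber_le_mk (hc.comp hf) ?_ hZ'.compl fun x => fun hx =>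
      hfA x ((hAfree _).2 hx)
    rintro x y ⟨a, ha, h⟩
    exact hcol _ _ ⟨_, Or.inl ⟨a, ha, rfl⟩, h.imp (hfs x y a) (hfs y x a)⟩

end Coprod

theorem countable_of_closure_eq_top {H : Type} [Group H] {S : Set H} (hS : S.Finite)
    (h : Subgroup.closure S = ⊤) : Countable H := by
  have : Finite S := hS
  have : Countable (FreeGroup S) := inferInstanceAs (Countable (Quot _))
  refine (MonoidHom.range_eq_top (f := FreeGroup.lift ((↑) : S → H)).1 ?_).countable
  rw [FreeGroup.range_lift_eq_closure, Subtype.range_coe, h]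

/-- If `Γ` and `Δ` are finitely generated marked groups and `m, n ≥ 2` are finite, then
`χ_B(G(Γ*Δ, m+n−1)) ≥ χ_B(G(Γ, m)) + χ_B(G(Δ, n)) − 1`, where `G(Γ, k)` is formed using a
base space of cardinality `k` and `Γ*Δ` is marked by the union of the generators. (The
inequality is stated as `χ_B(G(Γ,m)) + χ_B(G(Δ,n)) ≤ χ_B(G(Γ*Δ,m+n−1)) + 1`.) -/
theorem stmt_12 (Γ Δ : Type) [Group Γ] [Group Δ]
    (m n : ℕ) (hm : 2 ≤ m) (hn : 2 ≤ n)
    (S : Set Γ) (T : Set Δ)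
    (hSfin : S.Finite) (hTfin : T.Finite)
    (hS1 : (1 : Γ) ∉ S) (hT1 : (1 : Δ) ∉ T)
    (hSgen : Subgroup.closure S = ⊤) (hTgen : Subgroup.closure T = ⊤) :
    borelChromaticNumber (cayleyAdj S (Fin m)) + borelChromaticNumber (cayleyAdj T (Fin n)) ≤
      borelChromaticNumber
        (cayleyAdj ((fun γ => Monoid.Coprod.inl γ) '' S ∪ (fun δ => Monoid.Coprod.inr δ) '' T :
          Set (Monoid.Coprod Γ Δ)) (Fin (m + n - 1))) + 1 := by
  have := countable_of_closure_eq_top hSfin hSgen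
  have := countable_of_closure_eq_top hTfin hTgen
  have hne : (1 : Monoid.Coprod Γ Δ) ∉ ((fun γ => Monoid.Coprod.inl γ) '' S ∪
      (fun δ => Monoid.Coprod.inr δ) '' T : Set (Monoid.Coprod Γ Δ)) := by
    rintro (⟨γ, hγ, h⟩ | ⟨δ, hδ, h⟩)
    · exact hS1 (Monoid.Coprod.inl_injective (h.trans (map_one _).symm) ▸ hγ)
    · exact hT1 (Monoid.Coprod.inr_injective (h.trans (map_one _).symm) ▸ hδ)
  obtain ⟨L⟩ := Levels.nonempty_levels Γ Δ
  have : Countable (Monoid.Coprod Γ Δ) := L.countable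
  obtain ⟨Z, mZ, hZ, hκ, c, hc, hcol⟩ := exists_measurable_coloring hne (m + n - 1)
  rw [← hκ]
  have hsplit : ∀ Z' : Set Z, MeasurableSet Z' →
      borelChromaticNumber (cayleyAdj T (Fin n)) ≤ Cardinal.mk Z' ∨
        borelChromaticNumber (cayleyAdj S (Fin m)) ≤ Cardinal.mk ↥Z'ᶜ :=
    fun Z' hZ' => borelChromaticNumber_le_or hm hc hcol hZ'
  have hS0 := borelChromaticNumber_ne_zero hS1 hm
  have hT0 := borelChromaticNumber_ne_zero hT1 hn
  generalize borelChromaticNumber (cayleyAdj S (Fin m)) = a at hsplit hS0 ⊢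
  generalize borelChromaticNumber (cayleyAdj T (Fin n)) = b at hsplit hT0 ⊢
  have hb : b ≤ Cardinal.mk Z := by simpa [hS0] using hsplit Set.univ MeasurableSet.univ
  have ha : a ≤ Cardinal.mk Z := by simpa [hT0] using hsplit ∅ MeasurableSet.empty
  rcases finite_or_infinite Z with hfin | hinf
  · have := Fintype.ofFinite Z
    have hlt : Cardinal.mk Z < Cardinal.aleph0 := Cardinal.lt_aleph0_of_finite Z
    lift a to ℕ using ha.trans_lt hlt
    lift b to ℕ using hb.trans_lt hlt
    rw [Cardinal.mk_fintype] at ha hb ⊢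
    norm_cast at *
    by_contra! hlt'
    obtain ⟨Z', -, hZ'⟩ := Finset.exists_subset_card_eq
      (s := (Finset.univ : Finset Z)) (n := b - 1) (by rw [Finset.card_univ]; omega)
    have := hsplit (Z' : Set Z) Z'.measurableSet
    rw [← Set.cast_ncard (Set.toFinite (Z' : Set Z)), ← Set.cast_ncard (Set.toFinite (Z' : Set Z)ᶜ),
      Nat.cast_le, Nat.cast_le, Set.ncard_coe_finset] at this
    have hcompl := Set.ncard_add_ncard_compl (Z' : Set Z)
    rw [Set.ncard_coe_finset, Nat.card_eq_fintype_card] at hcompl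
    omega
  · calc a + b ≤ Cardinal.mk Z + Cardinal.mk Z := add_le_add ha hb
      _ = Cardinal.mk Z := Cardinal.add_eq_self (Cardinal.aleph0_le_mk Z)
      _ ≤ Cardinal.mk Z + 1 := le_self_add
end

section
/- Let μ be a Borel probability measure on a standard Borel space X, and let E and F be aperiodic countable Borel equivalence relations on X. Then there exist disjoint Borel sets A, B ⊆ X such that A meets the E-class of μ-almost every point of X and B meets the F-class of μ-almost every point of X. -/
open MeasureTheory

open Set Filter Topology ENNReal

/-- The range of a continuous map on Baire space is inner regular for compact sets, with respect to
any finite measure. -/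
theorem exists_isCompact_subset_range_of_lt {α : Type*} [TopologicalSpace α] [PolishSpace α]
    [MeasurableSpace α] [BorelSpace α] (μ : Measure α) [IsFiniteMeasure μ]
    {f : (ℕ → ℕ) → α} (hf : Continuous f) {c : ℝ≥0∞} (hc : c < μ (range f)) :
    ∃ C ⊆ range f, IsCompact C ∧ c ≤ μ C := by
  have step : ∀ (S : Set (ℕ → ℕ)) (k : ℕ), ∃ m : ℕ,
      c < μ (f '' S) → c < μ (f '' (S ∩ {x | x k ≤ m})) := by
    intro S k
    by_cases h : c < μ (f '' S)
    · have hmono : Monotone fun m : ℕ => f '' (S ∩ {x | x k ≤ m}) := fun m n hmn =>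
        image_mono (inter_subset_inter_right _ fun x (hx : x k ≤ m) => hx.trans hmn)
      have hU : ⋃ m : ℕ, f '' (S ∩ {x | x k ≤ m}) = f '' S := by
        rw [← image_iUnion, ← inter_iUnion]
        congr 1
        exact inter_eq_left.2 fun x _ => mem_iUnion.2 ⟨x k, by simp⟩
      have ht := tendsto_measure_iUnion_atTop (μ := μ) hmono
      rw [hU] at ht
      obtain ⟨m, hm⟩ := (ht.eventually (lt_mem_nhds h)).exists
      exact ⟨m, fun _ => hm⟩
    · exact ⟨0, fun h' => absurd h' h⟩
  choose m hm using step
  let T : ℕ → Set (ℕ → ℕ) := fun k => Nat.rec univ (fun k S => S ∩ {x | x k ≤ m S k}) k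
  let b : ℕ → ℕ := fun k => m (T k) k
  have hTs : ∀ k, T (k + 1) = T k ∩ {x | x k ≤ b k} := fun k => rfl
  have hTc : ∀ k, c < μ (f '' T k) := by
    intro k
    induction k with
    | zero => simpa [T] using hc
    | succ k ih => exact hm _ _ ih
  have hTanti : Antitone T := antitone_nat_of_succ_le fun k => by
    rw [hTs]; exact inter_subset_left
  have hTb : ∀ {k x}, x ∈ T k → ∀ i < k, x i ≤ b i := by
    intro k x hx i hi
    have := hTanti (Nat.succ_le_of_lt hi) hx
    rw [Nat.succ_eq_add_one, hTs] at this
    exact this.2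
  have hK : IsCompact (univ.pi fun i => Iic (b i)) :=
    isCompact_univ_pi fun i => (finite_Iic (b i)).isCompact
  refine ⟨f '' univ.pi fun i => Iic (b i), image_subset_range _ _, hK.image hf, ?_⟩
  have hsub : ⋂ k, closure (f '' T k) ⊆ f '' univ.pi fun i => Iic (b i) := by
    intro y hy
    let := TopologicalSpace.upgradeIsCompletelyMetrizable α
    have hx : ∀ k : ℕ, ∃ x ∈ T k, dist y (f x) < 1 / ((k : ℝ) + 1) := by
      intro k
      obtain ⟨_, ⟨x, hx, rfl⟩, hd⟩ :=
        Metric.mem_closure_iff.1 (mem_iInter.1 hy k) _ (Nat.one_div_pos_of_nat (α := ℝ) (n := k))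
      exact ⟨x, hx, hd⟩
    choose x hxT hxd using hx
    obtain ⟨z, hz, φ, hφ, hlim⟩ := hK.tendsto_subseq (x := fun k i => min (x k i) (b i))
      fun k i _ => mem_Iic.2 (min_le_right _ _)
    have hlim' : Tendsto (fun k => x (φ k)) atTop (𝓝 z) := by
      rw [tendsto_pi_nhds] at hlim ⊢
      intro i
      refine (hlim i).congr' ?_
      filter_upwards [eventually_gt_atTop i] with k hk
      exact min_eq_left (hTb (hxT (φ k)) i (hk.trans_le (hφ.id_le k)))
    refine ⟨z, hz, tendsto_nhds_unique ((hf.tendsto z).comp hlim') ?_⟩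
    have : Tendsto (fun k => f (x k)) atTop (𝓝 y) := by
      rw [tendsto_iff_dist_tendsto_zero]
      refine squeeze_zero (fun _ => dist_nonneg) (fun k => ?_) tendsto_one_div_add_atTop_nhds_zero_nat
      rw [dist_comm]
      exact (hxd k).le
    exact this.comp hφ.tendsto_atTop
  refine le_trans ?_ (measure_mono hsub)
  have ht := tendsto_measure_iInter_atTop (μ := μ) (s := fun k => closure (f '' T k))
    (fun k => isClosed_closure.measurableSet.nullMeasurableSet)
    (fun i j hij => closure_mono (image_mono (hTanti hij))) ⟨0, measure_ne_top _ _⟩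
  exact ge_of_tendsto' ht fun k => (hTc k).le.trans (measure_mono subset_closure)

/-- Analytic sets are universally measurable. -/
theorem MeasureTheory.AnalyticSet.nullMeasurableSet {α : Type*} [TopologicalSpace α] [PolishSpace α]
    [MeasurableSpace α] [BorelSpace α] {s : Set α} (hs : AnalyticSet s)
    (μ : Measure α) [IsFiniteMeasure μ] : NullMeasurableSet s μ := by
  rw [AnalyticSet] at hs
  obtain rfl | ⟨f, hf, rfl⟩ := hs
  · exact nullMeasurableSet_empty
  rcases eq_or_ne (μ (range f)) 0 with h0 | h0
  · exact NullMeasurableSet.of_null h0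
  obtain ⟨u, -, hu, hulim⟩ := exists_seq_strictMono_tendsto' (pos_iff_ne_zero.2 h0)
  choose C hCs hC hCu using fun n => exists_isCompact_subset_range_of_lt μ hf (hu n).2
  have hle : μ (range f) ≤ μ (⋃ n, C n) :=
    le_of_tendsto' hulim fun n => (hCu n).trans (measure_mono (subset_iUnion C n))
  have hm : MeasurableSet (⋃ n, C n) := .iUnion fun n => (hC n).measurableSet
  exact hm.nullMeasurableSet.congr
    (ae_eq_of_subset_of_measure_ge (iUnion_subset hCs) hle hm.nullMeasurableSet
      (measure_ne_top _ _))

/-- Projections of Borel sets are universally measurable. -/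
theorem MeasurableSet.nullMeasurableSet_exists {Z Y : Type*} [MeasurableSpace Z]
    [StandardBorelSpace Z] [MeasurableSpace Y] [StandardBorelSpace Y] {S : Set (Z × Y)}
    (hS : MeasurableSet S) (μ : Measure Z) [IsFiniteMeasure μ] :
    NullMeasurableSet {z | ∃ y, (z, y) ∈ S} μ := by
  let := upgradeStandardBorel Z
  have : {z | ∃ y, (z, y) ∈ S} = Prod.fst '' S := by
    ext z
    simp
  rw [this]
  exact (hS.analyticSet_image measurable_fst).nullMeasurableSet μ

/-- A standard Borel space has a sequence of countable Borel partitions, given by maps to `ℕ`, which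
eventually separates any two distinct points. -/
theorem exists_measurable_eventually_ne (X : Type*) [MeasurableSpace X] [StandardBorelSpace X] :
    ∃ π : ℕ → X → ℕ, (∀ n, Measurable (π n)) ∧
      ∀ x y, x ≠ y → ∀ᶠ n in atTop, π n x ≠ π n y := by
  obtain ⟨f, hf, hinj⟩ := MeasurableSpace.measurable_injection_nat_bool_of_countablySeparated X
  refine ⟨fun n x => Encodable.encode fun i : Fin n => f x i, fun n => ?_, fun x y hxy => ?_⟩
  · exact (Measurable.of_discrete (f := fun v : Fin n → Bool => Encodable.encode v)).comp
      (measurable_pi_lambda _ fun i => (measurable_pi_apply (i : ℕ)).comp hf)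
  · obtain ⟨i, hi⟩ := Function.ne_iff.1 (hinj.ne hxy)
    filter_upwards [eventually_gt_atTop i] with n hn heq
    exact hi (congrFun (Encodable.encode_injective heq) ⟨i, hn⟩)

/-- The class of `x` under `E` meets at least `K` fibers of `p`. -/
def MeetsFibers {X : Type*} (E : X → X → Prop) (p : X → ℕ) (K : ℕ) (x : X) : Prop :=
  ∃ s : Finset ℕ, s.card = K ∧ ∀ t ∈ s, ∃ y, E x y ∧ p y = t

section

variable {X : Type*} [MeasurableSpace X] [StandardBorelSpace X] {E : X → X → Prop}

theorem nullMeasurableSet_meetsFibers (hE : MeasurableSet {p : X × X | E p.1 p.2}) {p : X → ℕ}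
    (hp : Measurable p) (K : ℕ) (μ : Measure X) [IsFiniteMeasure μ] :
    NullMeasurableSet {x | MeetsFibers E p K x} μ := by
  have : {x | MeetsFibers E p K x} = ⋃ s : Finset ℕ, ⋃ _ : s.card = K, ⋂ t ∈ s,
      {x | ∃ y, (x, y) ∈ {q : X × X | E q.1 q.2} ∩ {q | p q.2 = t}} := by
    ext x
    simp [MeetsFibers]
  rw [this]
  refine .iUnion fun s => .iUnion fun _ => Finset.nullMeasurableSet_biInter s fun t _ => ?_
  exact (hE.inter ((hp.comp measurable_snd) (measurableSet_singleton t))).nullMeasurableSet_exists μ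

theorem eventually_measure_not_meetsFibers_le (hE : MeasurableSet {p : X × X | E p.1 p.2})
    (hinf : ∀ x, {y | E x y}.Infinite) {π : ℕ → X → ℕ} (hπ : ∀ n, Measurable (π n))
    (hsep : ∀ x y, x ≠ y → ∀ᶠ n in atTop, π n x ≠ π n y) (K : ℕ)
    (μ : Measure X) [IsFiniteMeasure μ] {ε : ℝ≥0∞} (hε : 0 < ε) :
    ∀ᶠ n in atTop, μ {x | ¬ MeetsFibers E (π n) K x} ≤ ε := by
  have hev : ∀ x, ∀ᶠ n in atTop, MeetsFibers E (π n) K x := by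
    intro x
    obtain ⟨t, ht, hcard⟩ := (hinf x).exists_subset_card_eq K
    have : ∀ᶠ n in atTop, ∀ y ∈ t, ∀ z ∈ t, y ≠ z → π n y ≠ π n z := by
      simp only [Filter.eventually_all_finset, Filter.eventually_imp_distrib_left]
      exact fun y _ z _ h => hsep y z h
    filter_upwards [this] with n hn
    refine ⟨t.image (π n), ?_, ?_⟩
    · rw [Finset.card_image_of_injOn, hcard]
      intro y hy z hz h
      by_contra hne
      exact hn y hy z hz hne h
    · intro k hk
      obtain ⟨y, hy, rfl⟩ := Finset.mem_image.1 hk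
      exact ⟨y, ht hy, rfl⟩
  let H : ℕ → Set X := fun N => ⋃ n, ⋃ _ : N ≤ n, {x | MeetsFibers E (π n) K x}ᶜ
  have hlim := tendsto_measure_iInter_atTop (μ := μ) (s := H)
    (fun N => .iUnion fun n => .iUnion fun _ =>
      (nullMeasurableSet_meetsFibers hE (hπ n) K μ).compl)
    (fun M N hMN => iUnion_mono fun n => iUnion_mono' fun h => ⟨hMN.trans h, le_rfl⟩)
    ⟨0, measure_ne_top _ _⟩
  have hempty : ⋂ N, H N = ∅ := by
    refine eq_empty_of_forall_notMem fun x hx => ?_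
    obtain ⟨N, hN⟩ := eventually_atTop.1 (hev x)
    obtain ⟨n, hn⟩ := mem_iUnion.1 (mem_iInter.1 hx N)
    obtain ⟨hNn, hn⟩ := mem_iUnion.1 hn
    exact hn (hN n hNn)
  rw [hempty, measure_empty] at hlim
  filter_upwards [hlim.eventually (gt_mem_nhds hε)] with n hn
  refine le_trans (measure_mono ?_) hn.le
  exact fun x hx => mem_iUnion.2 ⟨n, mem_iUnion.2 ⟨le_rfl, hx⟩⟩

end

/-- At stage `j`, the label `ω (j, ρ j x)` either recolors `x` or, if it is `0`, leaves it unchanged.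
This is the set of points whose last recoloring is to the color `c`. -/
def lastColored {X : Type*} (ρ : ℕ → X → ℕ) (ω : ℕ × ℕ → Fin 3) (c : Fin 3) : Set X :=
  {x | ∃ j, ω (j, ρ j x) = c ∧ ∀ l > j, ω (l, ρ l x) = 0}

theorem disjoint_lastColored {X : Type*} (ρ : ℕ → X → ℕ) (ω : ℕ × ℕ → Fin 3) {c d : Fin 3}
    (hc : c ≠ 0) (hd : d ≠ 0) (hcd : c ≠ d) :
    Disjoint (lastColored ρ ω c) (lastColored ρ ω d) := by
  rw [Set.disjoint_left]
  rintro x ⟨i, hi, hi'⟩ ⟨j, hj, hj'⟩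
  rcases lt_trichotomy i j with h | rfl | h
  · exact hd (hj ▸ hi' j h)
  · exact hcd (hi.symm.trans hj)
  · exact hc (hi ▸ hj' i h)

theorem measurableSet_lastColored_prod {X : Type*} [MeasurableSpace X] {ρ : ℕ → X → ℕ}
    (hρ : ∀ j, Measurable (ρ j)) (c : Fin 3) :
    MeasurableSet {q : (ℕ × ℕ → Fin 3) × X | q.2 ∈ lastColored ρ q.1 c} := by
  have hm : ∀ j, Measurable fun q : (ℕ × ℕ → Fin 3) × X => q.1 (j, ρ j q.2) := fun j =>
    (measurable_from_prod_countable_left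
      (f := fun q : (ℕ × ℕ → Fin 3) × ℕ => q.1 (j, q.2)) fun n => measurable_pi_apply (j, n)).comp
      (measurable_fst.prodMk ((hρ j).comp measurable_snd))
  have : {q : (ℕ × ℕ → Fin 3) × X | q.2 ∈ lastColored ρ q.1 c} =
      ⋃ j, {q | q.1 (j, ρ j q.2) = c} ∩ ⋂ l, ⋂ _ : l > j, {q | q.1 (l, ρ l q.2) = 0} := by
    ext q
    simp [lastColored]
  rw [this]
  exact .iUnion fun j => (hm j (measurableSet_singleton c)).inter
    (.iInter fun l => .iInter fun _ => hm l (measurableSet_singleton 0))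

section

variable {X : Type*} {E : X → X → Prop} {ν : ℕ → Measure (Fin 3)} [∀ j, IsProbabilityMeasure (ν j)]

theorem measure_not_exists_lastColored_le {ρ : ℕ → X → ℕ} {c : Fin 3} {j K : ℕ} {x : X}
    (hx : MeetsFibers E (ρ j) K x) :
    Measure.infinitePi (fun i : ℕ × ℕ => ν i.1) {ω | ¬ ∃ y, E x y ∧ y ∈ lastColored ρ ω c} ≤
      (1 - ν j {c}) ^ K + K * ∑' i, ν (j + 1 + i) {0}ᶜ := by
  obtain ⟨s, hs, hy⟩ := hx
  have : Nonempty X := ⟨x⟩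
  choose! y hEy hρy using hy
  set P := Measure.infinitePi (fun i : ℕ × ℕ => ν i.1)
  have hsub : {ω | ¬ ∃ y, E x y ∧ y ∈ lastColored ρ ω c} ⊆
      Set.pi (s.map ⟨fun t => (j, t), Prod.mk_right_injective j⟩ : Finset (ℕ × ℕ))
        (fun _ => {c}ᶜ) ∪ ⋃ t ∈ s, ⋃ i,
          Function.eval (j + 1 + i, ρ (j + 1 + i) (y t)) ⁻¹' {0}ᶜ := by
    intro ω hω
    by_contra hcon
    simp only [mem_union, not_or, mem_iUnion, not_exists] at hcon
    obtain ⟨h1, h2⟩ := hcon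
    simp only [Set.mem_pi, Finset.coe_map, Function.Embedding.coeFn_mk, not_forall] at h1
    obtain ⟨_, ⟨t, ht, rfl⟩, hc⟩ := h1
    refine hω ⟨y t, hEy t ht, j, ?_, fun l hl => ?_⟩
    · rw [hρy t ht]
      simpa using hc
    · obtain ⟨i, rfl⟩ := Nat.exists_eq_add_of_le (Nat.succ_le_of_lt hl)
      simpa using h2 t ht i
  refine (measure_mono hsub).trans ((measure_union_le _ _).trans (add_le_add ?_ ?_))
  · rw [Measure.infinitePi_pi _ fun _ _ => MeasurableSet.of_discrete]
    simp [prob_compl_eq_one_sub, hs]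
  · calc P (⋃ t ∈ s, ⋃ i, Function.eval (j + 1 + i, ρ (j + 1 + i) (y t)) ⁻¹' {0}ᶜ)
        ≤ ∑ t ∈ s, P (⋃ i, Function.eval (j + 1 + i, ρ (j + 1 + i) (y t)) ⁻¹' {0}ᶜ) :=
          measure_biUnion_finset_le _ _
      _ ≤ ∑ t ∈ s, ∑' i, ν (j + 1 + i) {0}ᶜ := by
          refine Finset.sum_le_sum fun t _ => (measure_iUnion_le _).trans_eq ?_
          refine tsum_congr fun i => ?_
          exact (measurePreserving_eval_infinitePi (fun i : ℕ × ℕ => ν i.1) _).measure_preimage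
            MeasurableSet.of_discrete.nullMeasurableSet
      _ = K * ∑' i, ν (j + 1 + i) {0}ᶜ := by simp [hs]

theorem ae_ae_exists_mem_lastColored [MeasurableSpace X] [StandardBorelSpace X] {μ : Measure X}
    [IsFiniteMeasure μ] (hE : MeasurableSet {p : X × X | E p.1 p.2}) {ρ : ℕ → X → ℕ}
    (hρ : ∀ j, Measurable (ρ j)) {K : ℕ → ℕ}
    (hmeets : ∀ᵐ x ∂μ, ∀ᶠ j in atTop, MeetsFibers E (ρ j) (K j) x) {c : Fin 3}
    (hlim : Tendsto (fun j => (1 - ν j {c}) ^ K j + K j * ∑' i, ν (j + 1 + i) {0}ᶜ) atTop (𝓝 0)) :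
    ∀ᵐ ω ∂Measure.infinitePi (fun i : ℕ × ℕ => ν i.1),
      ∀ᵐ x ∂μ, ∃ y, E x y ∧ y ∈ lastColored ρ ω c := by
  set P := Measure.infinitePi (fun i : ℕ × ℕ => ν i.1)
  have hnull : NullMeasurableSet {q : X × (ℕ × ℕ → Fin 3) |
      ∃ y, E q.1 y ∧ y ∈ lastColored ρ q.2 c} (μ.prod P) := by
    have hS : MeasurableSet
        ({r : (X × (ℕ × ℕ → Fin 3)) × X | E r.1.1 r.2} ∩ {r | r.2 ∈ lastColored ρ r.1.2 c}) :=
      ((measurable_fst.fst.prodMk measurable_snd) hE).inter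
        ((measurable_fst.snd.prodMk measurable_snd) (measurableSet_lastColored_prod hρ c))
    exact hS.nullMeasurableSet_exists _
  have hx : ∀ᵐ x ∂μ, P {ω | ¬ ∃ y, E x y ∧ y ∈ lastColored ρ ω c} = 0 := by
    filter_upwards [hmeets] with x hx
    refine le_antisymm (ge_of_tendsto hlim ?_) zero_le
    filter_upwards [hx] with j hj
    exact measure_not_exists_lastColored_le hj
  have hprod : ∀ᵐ q ∂μ.prod P, ∃ y, E q.1 y ∧ y ∈ lastColored ρ q.2 c := by
    obtain ⟨t, hts, ht, hae⟩ := hnull.compl.exists_measurable_subset_ae_eq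
    rw [ae_iff]
    refine (measure_congr hae).symm.trans (Measure.measure_prod_null_of_ae_null ht ?_)
    filter_upwards [hx] with x hx
    exact measure_mono_null (fun ω hω => hts hω) hx
  exact Measure.ae_ae_of_ae_prod
    (Measure.measurePreserving_swap.quasiMeasurePreserving.ae hprod)

end

/-- The probability measure giving mass `p` to both of the colors `1` and `2`. -/
noncomputable def colorMeasure (p : ℝ≥0∞) : Measure (Fin 3) :=
  (1 - (p + p)) • Measure.dirac 0 + p • Measure.dirac 1 + p • Measure.dirac 2

theorem isProbabilityMeasure_colorMeasure {p : ℝ≥0∞} (hp : p + p ≤ 1) :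
    IsProbabilityMeasure (colorMeasure p) :=
  ⟨by simp [colorMeasure, add_assoc, tsub_add_cancel_of_le hp]⟩

theorem colorMeasure_singleton (p : ℝ≥0∞) {c : Fin 3} (hc : c ≠ 0) : colorMeasure p {c} = p := by
  fin_cases c <;> simp_all [colorMeasure]

theorem colorMeasure_compl_zero (p : ℝ≥0∞) : colorMeasure p {0}ᶜ = 2 * p := by
  simp [colorMeasure, two_mul]

theorem tendsto_color_error_zero :
    Tendsto (fun j : ℕ => (1 - (2⁻¹ : ℝ≥0∞) ^ (j + 1) ^ 2) ^ 2 ^ ((j + 1) ^ 2 + j) +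
      ((2 ^ ((j + 1) ^ 2 + j) : ℕ) : ℝ≥0∞) * ∑' i, 2 * (2⁻¹ : ℝ≥0∞) ^ (j + 1 + i + 1) ^ 2)
      atTop (𝓝 0) := by
  have h1 : ∀ j : ℕ, (1 - (2⁻¹ : ℝ≥0∞) ^ (j + 1) ^ 2) ^ 2 ^ ((j + 1) ^ 2 + j) ≤
      ENNReal.ofReal (Real.exp (-2 ^ j)) := by
    intro j
    have h2 : (2⁻¹ : ℝ≥0∞) ^ (j + 1) ^ 2 = ENNReal.ofReal ((2⁻¹ : ℝ) ^ (j + 1) ^ 2) := by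
      rw [ENNReal.ofReal_pow (by norm_num), ENNReal.ofReal_inv_of_pos (by norm_num)]
      simp
    have h3 : (2⁻¹ : ℝ) ^ (j + 1) ^ 2 ≤ 1 := pow_le_one₀ (by norm_num) (by norm_num)
    rw [h2, ← ENNReal.ofReal_one, ← ENNReal.ofReal_sub _ (by positivity),
      ← ENNReal.ofReal_pow (by linarith)]
    refine ENNReal.ofReal_le_ofReal ?_
    calc (1 - (2⁻¹ : ℝ) ^ (j + 1) ^ 2) ^ 2 ^ ((j + 1) ^ 2 + j)
        ≤ Real.exp (-(2⁻¹ : ℝ) ^ (j + 1) ^ 2) ^ 2 ^ ((j + 1) ^ 2 + j) :=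
          pow_le_pow_left₀ (by linarith) (Real.one_sub_le_exp_neg _) _
      _ = Real.exp (-2 ^ j) := by
          rw [← Real.exp_nat_mul]
          congr 1
          push_cast
          rw [pow_add, mul_neg, mul_right_comm, ← mul_pow]
          norm_num
  have h2 : ∀ j : ℕ, ((2 ^ ((j + 1) ^ 2 + j) : ℕ) : ℝ≥0∞) *
      ∑' i, 2 * (2⁻¹ : ℝ≥0∞) ^ (j + 1 + i + 1) ^ 2 ≤ 2⁻¹ ^ j := by
    intro j
    rw [← ENNReal.tsum_mul_left]
    calc ∑' i, ((2 ^ ((j + 1) ^ 2 + j) : ℕ) : ℝ≥0∞) * (2 * (2⁻¹ : ℝ≥0∞) ^ (j + 1 + i + 1) ^ 2)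
        ≤ ∑' i, 2⁻¹ ^ (j + 1) * 2⁻¹ ^ i := by
          refine ENNReal.tsum_le_tsum fun i => ?_
          have he : (j + 1 + i + 1) ^ 2 =
              ((j + 1) ^ 2 + j + 1) + ((j + 1 + i) + (i * (2 * j + i + 3) + 1)) := by ring
          rw [he, pow_add _ ((j + 1) ^ 2 + j + 1), ← mul_assoc, ← mul_assoc]
          push_cast
          rw [← pow_succ, ← mul_pow, ENNReal.mul_inv_cancel (by simp) (by simp), one_pow, one_mul,
            ← pow_add]
          exact pow_le_pow_right_of_le_one' (by simp) (by omega)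
      _ = 2⁻¹ ^ j := by
          rw [ENNReal.tsum_mul_left, ENNReal.tsum_geometric, ENNReal.one_sub_inv_two, inv_inv,
            pow_succ, mul_assoc, ENNReal.inv_mul_cancel (by simp) (by simp), mul_one]
  have l1 : Tendsto (fun j : ℕ => ENNReal.ofReal (Real.exp (-2 ^ j))) atTop (𝓝 0) := by
    rw [← ENNReal.ofReal_zero]
    refine ENNReal.tendsto_ofReal (Real.tendsto_exp_neg_atTop_nhds_zero.comp ?_)
    exact tendsto_pow_atTop_atTop_of_one_lt one_lt_two
  have l2 : Tendsto (fun j : ℕ => (2⁻¹ : ℝ≥0∞) ^ j) atTop (𝓝 0) :=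
    ENNReal.tendsto_pow_atTop_nhds_zero_of_lt_one (by simp)
  have l3 := l1.add l2
  rw [add_zero] at l3
  exact tendsto_of_tendsto_of_tendsto_of_le_of_le tendsto_const_nhds l3 (fun _ => zero_le)
    fun j => add_le_add (h1 j) (h2 j)

theorem ae_eventually_of_measure_not_le {X : Type*} [MeasurableSpace X] {μ : Measure X}
    {p : ℕ → X → Prop} (h : ∀ j, μ {x | ¬ p j x} ≤ 2⁻¹ ^ j) : ∀ᵐ x ∂μ, ∀ᶠ j in atTop, p j x := by
  have := ae_eventually_notMem (μ := μ) (s := fun j => {x | ¬ p j x})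
    (ne_top_of_le_ne_top (by simp [ENNReal.tsum_geometric]) (ENNReal.tsum_le_tsum h))
  simpa using this

/-- If `μ` is a Borel probability measure on a standard Borel space `X` and `E`, `F` are
aperiodic countable Borel equivalence relations on `X`, then there are disjoint Borel
sets `A`, `B` such that `A` meets the `E`-class of `μ`-almost every point and `B` meets
the `F`-class of `μ`-almost every point. -/
theorem stmt_13 (X : Type) [MeasurableSpace X] [StandardBorelSpace X]
    (μ : Measure X) [IsProbabilityMeasure μ]
    (E F : X → X → Prop)
    (hE : Equivalence E) (hF : Equivalence F)
    (hEBorel : MeasurableSet {p : X × X | E p.1 p.2})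
    (hFBorel : MeasurableSet {p : X × X | F p.1 p.2})
    (hECtble : ∀ x, {y | E x y}.Countable)
    (hFCtble : ∀ x, {y | F x y}.Countable)
    (hEAper : ∀ x, {y | E x y}.Infinite)
    (hFAper : ∀ x, {y | F x y}.Infinite) :
    ∃ A B : Set X, MeasurableSet A ∧ MeasurableSet B ∧ Disjoint A B ∧
      (∀ᵐ x ∂μ, ∃ y, E x y ∧ y ∈ A) ∧
      (∀ᵐ x ∂μ, ∃ y, F x y ∧ y ∈ B) := by
  obtain ⟨π, hπ, hsep⟩ := exists_measurable_eventually_ne X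
  let K : ℕ → ℕ := fun j => 2 ^ ((j + 1) ^ 2 + j)
  have hpos : ∀ j : ℕ, (0 : ℝ≥0∞) < 2⁻¹ ^ j := fun j => ENNReal.pow_pos (by simp) j
  choose n hnE hnF using fun j =>
    ((eventually_measure_not_meetsFibers_le hEBorel hEAper hπ hsep (K j) μ (hpos j)).and
      (eventually_measure_not_meetsFibers_le hFBorel hFAper hπ hsep (K j) μ (hpos j))).exists
  let ν : ℕ → Measure (Fin 3) := fun j => colorMeasure (2⁻¹ ^ (j + 1) ^ 2)
  have hν : ∀ j, IsProbabilityMeasure (ν j) := fun j =>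
    isProbabilityMeasure_colorMeasure <| by
      have : (2⁻¹ : ℝ≥0∞) ^ (j + 1) ^ 2 ≤ 2⁻¹ := pow_le_of_le_one (by simp) (by simp) (by simp)
      exact (add_le_add this this).trans_eq ENNReal.inv_two_add_inv_two
  have hlim : ∀ c : Fin 3, c ≠ 0 → Tendsto
      (fun j => (1 - ν j {c}) ^ K j + K j * ∑' i, ν (j + 1 + i) {0}ᶜ) atTop (𝓝 0) := by
    intro c hc
    simpa only [ν, K, colorMeasure_singleton _ hc, colorMeasure_compl_zero] using
      tendsto_color_error_zero
  have hρ : ∀ j, Measurable (π (n j)) := fun j => hπ (n j)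
  obtain ⟨ω, hωE, hωF⟩ :=
    ((ae_ae_exists_mem_lastColored hEBorel hρ (ae_eventually_of_measure_not_le hnE)
      (hlim 1 (by decide))).and
    (ae_ae_exists_mem_lastColored hFBorel hρ (ae_eventually_of_measure_not_le hnF)
      (hlim 2 (by decide)))).exists
  exact ⟨lastColored (fun j => π (n j)) ω 1, lastColored (fun j => π (n j)) ω 2,
    measurable_prodMk_left (measurableSet_lastColored_prod hρ 1),
    measurable_prodMk_left (measurableSet_lastColored_prod hρ 2),
    disjoint_lastColored _ _ (by decide) (by decide) (by decide), hωE, hωF⟩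
end

section
/- Suppose G is a locally countable Borel graph on a standard Borel space X, and f is a partial Borel antimatching of G such that ran(f) ⊆ dom(f) and every connected component of G contains some point of dom(f). Then f can be extended to a total Borel antimatching f* of G. -/
open Set Filter Topology MeasureTheory

section LusinNovikov

variable {P X : Type*}

/-- `s` is covered by countably many measurable sets on each of which `p` is injective. -/
def SigmaInjOn [MeasurableSpace P] (p : P → X) (s : Set P) : Prop :=
  ∃ B : Set (Set P), B.Countable ∧ (∀ t ∈ B, MeasurableSet t ∧ InjOn p t) ∧ s ⊆ ⋃₀ B

theorem SigmaInjOn.iUnion [MeasurableSpace P] {p : P → X} {ι : Type*} [Countable ι]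
    {s : ι → Set P} (h : ∀ i, SigmaInjOn p (s i)) : SigmaInjOn p (⋃ i, s i) := by
  choose B hBc hB hs using h
  refine ⟨⋃ i, B i, countable_iUnion hBc, ?_, ?_⟩
  · intro t ht
    obtain ⟨i, hi⟩ := mem_iUnion.1 ht
    exact hB i t hi
  · rw [sUnion_iUnion]
    exact iUnion_mono hs

theorem SigmaInjOn.union_measurableSet [MeasurableSpace P] {p : P → X} {s t : Set P}
    (hs : SigmaInjOn p s) (ht : MeasurableSet t) (hinj : InjOn p t) : SigmaInjOn p (s ∪ t) := by
  obtain ⟨B, hBc, hB, hsB⟩ := hs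
  refine ⟨insert t B, hBc.insert t, ?_, ?_⟩
  · rintro u (rfl | hu)
    · exact ⟨ht, hinj⟩
    · exact hB u hu
  · rw [sUnion_insert, union_comm]
    exact union_subset_union_right t hsB

/-- An analytic set on which a measurable map is injective can be enlarged to a measurable set
with the same property. -/
theorem MeasureTheory.AnalyticSet.exists_measurableSet_injOn [TopologicalSpace P] [PolishSpace P]
    [MeasurableSpace P] [BorelSpace P] [MeasurableSpace X] [StandardBorelSpace X]
    {p : P → X} (hp : Measurable p) {A : Set P} (hA : AnalyticSet A) (hinj : InjOn p A) :
    ∃ B, A ⊆ B ∧ MeasurableSet B ∧ InjOn p B := by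
  have hE : MeasurableSet {q : P × P | p q.1 = p q.2 ∧ q.1 ≠ q.2} :=
    (measurableSet_eq_fun (hp.comp measurable_fst) (hp.comp measurable_snd)).inter
      (measurableSet_eq_fun measurable_fst measurable_snd).compl
  let N : Set P → Set P := fun S =>
    Prod.snd '' ({q : P × P | p q.1 = p q.2 ∧ q.1 ≠ q.2} ∩ Prod.fst ⁻¹' S)
  have hNan : ∀ S, AnalyticSet S → AnalyticSet (N S) := fun S hS => by
    refine AnalyticSet.image_of_continuous ?_ continuous_snd
    rw [inter_eq_iInter]
    exact .iInter (Bool.forall_bool.2 ⟨hS.preimage continuous_fst, hE.analyticSet⟩)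
  have hmem : ∀ {S x y}, x ∈ S → p x = p y → x ≠ y → y ∈ N S := fun {S x y} hx h hne =>
    ⟨(x, y), ⟨⟨h, hne⟩, hx⟩, rfl⟩
  obtain ⟨B, hAB, hNB, hB⟩ := hA.measurablySeparable (hNan A hA) (by
    rw [disjoint_left]
    rintro y hy ⟨⟨x, y'⟩, ⟨⟨h, hne⟩, hx⟩, rfl⟩
    exact hne (hinj hx hy h))
  obtain ⟨C, hAC, hNC, hC⟩ := hA.measurablySeparable (hNan B hB.analyticSet) (by
    rw [disjoint_left]
    rintro y hy ⟨⟨x, y'⟩, ⟨⟨h, hne⟩, hx⟩, rfl⟩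
    exact disjoint_left.1 hNB (hmem hy h.symm (Ne.symm hne)) hx)
  refine ⟨B ∩ C, subset_inter hAB hAC, hB.inter hC, fun x hx y hy h => ?_⟩
  by_contra hne
  exact disjoint_left.1 hNC (hmem hx.1 h hne) hy.2

/-- The condition `c`, prescribing for each `j` the basic set `b (c j)`, is met by a sequence
within a single fibre of `p`, even after removing any `SigmaInjOn` set. -/
def RobustCondition [MeasurableSpace P] (p : P → X) (b : ℕ → Set P) (c : ℕ →₀ ℕ) : Prop :=
  ∀ Y, MeasurableSet Y → SigmaInjOn p Yᶜ →
    ∃ z : ℕ → P, ∀ j, z j ∈ Y ∧ z j ∈ b (c j) ∧ p (z j) = p (z 0)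

/-- `c'` shrinks the entries of `c` indexed by `F`, and splits the entry `i` into two
disjoint pieces, one of which becomes the entry `m`. -/
structure SplitsCondition [PseudoMetricSpace P] (b : ℕ → Set P) (F : Finset ℕ) (i m : ℕ) (ε : ℝ)
    (c c' : ℕ →₀ ℕ) : Prop where
  eq_of_notMem : ∀ j ∉ F, c' j = c j
  closure_subset : ∀ j ∈ F, closure (b (c' j)) ⊆ b (c j)
  dist_le : ∀ j ∈ F, ∀ u ∈ b (c' j), ∀ v ∈ b (c' j), dist u v ≤ ε
  subset : b (c' m) ⊆ b (c i)
  disjoint : Disjoint (b (c' i)) (b (c' m))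

theorem exists_splitsCondition [MetricSpace P] {b : ℕ → Set P} (hbo : ∀ n, IsOpen (b n))
    (hb : ∀ x, ∀ U ∈ 𝓝 x, ∃ n, x ∈ b n ∧ b n ⊆ U) {c : ℕ →₀ ℕ} {F : Finset ℕ} {i m : ℕ}
    (hi : i ∈ F) (hm : m ∈ F) {ε : ℝ} (hε : 0 < ε) {w : ℕ → P}
    (hw : ∀ j, w j ∈ b (c j)) (hwm : w m ∈ b (c i)) (hne : w i ≠ w m) :
    ∃ c', SplitsCondition b F i m ε c c' ∧ ∀ j, w j ∈ b (c' j) := by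
  obtain ⟨U, V, hU, hV, hwU, hwV, hUV⟩ := t2_separation hne
  have hev : ∀ j, ∀ᶠ y in 𝓝 (w j), y ∈ b (c j) ∧ dist y (w j) < ε / 2 ∧
      (j = i → y ∈ U) ∧ (j = m → y ∈ V ∧ y ∈ b (c i)) := fun j => by
    refine .and ((hbo _).mem_nhds (hw j)) (.and (Metric.ball_mem_nhds _ (half_pos hε))
      (.and ?_ ?_))
    · rw [eventually_imp_distrib_left]
      rintro rfl
      exact hU.mem_nhds hwU
    · rw [eventually_imp_distrib_left]
      rintro rfl
      exact .and (hV.mem_nhds hwV) ((hbo _).mem_nhds hwm)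
  choose K hK hKc hKs using fun j => exists_mem_nhds_isClosed_subset (hev j)
  choose n hn hnK using fun j => hb (w j) (K j) (hK j)
  classical
  let c' : ℕ →₀ ℕ := Finsupp.onFinset (F ∪ c.support) (fun j => if j ∈ F then n j else c j) (by
    intro j hj
    by_cases h : j ∈ F
    · exact Finset.mem_union_left _ h
    · rw [if_neg h] at hj
      exact Finset.mem_union_right _ (Finsupp.mem_support_iff.2 hj))
  have hF : ∀ j ∈ F, c' j = n j := fun j hj => if_pos hj
  have hF' : ∀ j ∉ F, c' j = c j := fun j hj => if_neg hj
  have hsub : ∀ j, b (n j) ⊆ _ := fun j => (hnK j).trans (hKs j)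
  refine ⟨c', ⟨hF', ?_, ?_, ?_, ?_⟩, ?_⟩
  · intro j hj y hy
    rw [hF j hj] at hy
    exact (hKs j (closure_minimal (hnK j) (hKc j) hy)).1
  · intro j hj u hu v hv
    rw [hF j hj] at hu hv
    have h1 := (hsub j hu).2.1
    have h2 := (hsub j hv).2.1
    have h3 := dist_triangle_right u v (w j)
    linarith
  · intro y hy
    rw [hF m hm] at hy
    exact ((hsub m hy).2.2.2 rfl).2
  · rw [hF i hi, hF m hm]
    exact hUV.mono (fun y hy => (hsub i hy).2.2.1 rfl) fun y hy => ((hsub m hy).2.2.2 rfl).1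
  · intro j
    by_cases h : j ∈ F
    · rw [hF j h]; exact hn j
    · rw [hF' j h]; exact hw j

theorem RobustCondition.exists_split [MetricSpace P] [PolishSpace P] [MeasurableSpace P]
    [BorelSpace P] [MeasurableSpace X] [StandardBorelSpace X] {p : P → X} (hp : Measurable p)
    {b : ℕ → Set P} (hb0 : b 0 = univ) (hbo : ∀ n, IsOpen (b n))
    (hb : ∀ x, ∀ U ∈ 𝓝 x, ∃ n, x ∈ b n ∧ b n ⊆ U) {c : ℕ →₀ ℕ} (hc : RobustCondition p b c)
    {F : Finset ℕ} {i m : ℕ} (hi : i ∈ F) (hm : m ∈ F) (hne : i ≠ m) (hcm : c m = 0)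
    {ε : ℝ} (hε : 0 < ε) :
    ∃ c', RobustCondition p b c' ∧ SplitsCondition b F i m ε c c' := by
  by_contra! hcon
  have hbad : ∀ c' : {c' // SplitsCondition b F i m ε c c'}, ∃ Y, MeasurableSet Y ∧
      SigmaInjOn p Yᶜ ∧ ∀ z : ℕ → P, ¬ ∀ j, z j ∈ Y ∧ z j ∈ b (c'.1 j) ∧ p (z j) = p (z 0) := by
    rintro ⟨c', hc'⟩
    have h : ¬ RobustCondition p b c' := fun h => hcon c' h hc'
    simp only [RobustCondition] at h
    push Not at h
    simpa only [not_forall, not_and] using h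
  choose Y hY hYs hYz using hbad
  have hYm : MeasurableSet (⋂ c', Y c') := .iInter hY
  have hYi : SigmaInjOn p (⋂ c', Y c')ᶜ := by
    rw [compl_iInter]
    exact .iUnion hYs
  set S : Set (ℕ → P) := {z | ∀ j, z j ∈ ⋂ c', Y c' ∧ z j ∈ b (c j) ∧ p (z j) = p (z 0)}
    with hS
  have hSm : MeasurableSet S := by
    rw [hS, ofPred_forall]
    refine .iInter fun j => ?_
    exact (measurable_pi_apply j hYm).inter ((measurable_pi_apply j (hbo _).measurableSet).inter
      (measurableSet_eq_fun (hp.comp (measurable_pi_apply j)) (hp.comp (measurable_pi_apply (X := fun _ => P) 0))))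
  have hSa : AnalyticSet ((fun z : ℕ → P => z i) '' S) :=
    hSm.analyticSet.image_of_continuous (continuous_apply i)
  obtain ⟨B, hSB, hB, hBi⟩ := hSa.exists_measurableSet_injOn hp (by
    rintro _ ⟨z, hz, rfl⟩ _ ⟨z', hz', rfl⟩ h
    by_contra hzz
    dsimp only at h hzz
    set w := Function.update z m (z' i)
    have hwm : w m = z' i := Function.update_self ..
    have hwj : ∀ j, j ≠ m → w j = z j := fun j hj => Function.update_of_ne hj ..
    have hp0 : ∀ j, p (w j) = p (z 0) := fun j => by
      by_cases hj : j = m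
      · rw [hj, hwm, ← h, (hz i).2.2]
      · rw [hwj j hj, (hz j).2.2]
    obtain ⟨c', hc', hwc'⟩ := exists_splitsCondition hbo hb (w := w) (c := c) hi hm hε (fun j => by
      by_cases hj : j = m
      · rw [hj, hcm, hb0]; trivial
      · rw [hwj j hj]; exact (hz j).2.1) (by rw [hwm]; exact (hz' i).2.1)
      (by rwa [hwm, hwj i hne])
    refine hYz ⟨c', hc'⟩ w fun j => ⟨?_, hwc' j, by rw [hp0, hp0]⟩
    by_cases hj : j = m
    · rw [hj, hwm]; exact mem_iInter.1 (hz' i).1 _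
    · rw [hwj j hj]; exact mem_iInter.1 (hz j).1 _)
  obtain ⟨z, hz⟩ := hc ((⋂ c', Y c') ∩ Bᶜ) (hYm.inter hB.compl) (by
    rw [compl_inter, compl_compl]
    exact hYi.union_measurableSet hB hBi)
  exact (hz i).1.2 (hSB ⟨z, fun j => ⟨(hz j).1.1, (hz j).2⟩, rfl⟩)

theorem exists_nat_basis (P : Type*) [TopologicalSpace P] [SecondCountableTopology P] :
    ∃ b : ℕ → Set P, b 0 = univ ∧ (∀ n, IsOpen (b n)) ∧
      ∀ x, ∀ U ∈ 𝓝 x, ∃ n, x ∈ b n ∧ b n ⊆ U := by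
  obtain ⟨B, hBc, -, hB⟩ := TopologicalSpace.exists_countable_basis P
  obtain ⟨e, he⟩ := (hBc.insert univ).exists_eq_range (insert_nonempty _ _)
  refine ⟨fun n => n.casesOn univ e, rfl, ?_, fun x U hU => ?_⟩
  · rintro (_ | n)
    · exact isOpen_univ
    · have : e n ∈ insert univ B := he ▸ mem_range_self n
      rcases this with h | h
      · exact h ▸ isOpen_univ
      · exact hB.isOpen h
  · obtain ⟨t, ht, hxt, htU⟩ := hB.mem_nhds_iff.1 hU
    have : t ∈ range e := he ▸ mem_insert_of_mem _ ht
    obtain ⟨n, rfl⟩ := this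
    exact ⟨n + 1, hxt, htU⟩

/-- A continuous map from a Polish space with countable fibres is injective on each piece of
a countable measurable cover. -/
theorem sigmaInjOn_univ_of_continuous [TopologicalSpace P] [PolishSpace P] [MeasurableSpace P]
    [BorelSpace P] [TopologicalSpace X] [PolishSpace X] [MeasurableSpace X] [BorelSpace X]
    {p : P → X} (hp : Continuous p) (hcount : ∀ x, (p ⁻¹' {x}).Countable) :
    SigmaInjOn p univ := by
  let := TopologicalSpace.upgradeIsCompletelyMetrizable P
  by_contra hlarge
  obtain ⟨b, hb0, hbo, hb⟩ := exists_nat_basis P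
  have hrobust : RobustCondition p b 0 := by
    intro Y _ hYs
    obtain ⟨y, hy⟩ : Y.Nonempty := by
      rw [nonempty_iff_ne_empty]
      rintro rfl
      exact hlarge (by rwa [compl_empty] at hYs)
    exact ⟨fun _ => y, fun j => ⟨hy, by simp [hb0], rfl⟩⟩
  have hsplit : ∀ n (c : {c : ℕ →₀ ℕ // RobustCondition p b c ∧ ∀ j, n < j → c j = 0}),
      ∃ c' : {c : ℕ →₀ ℕ // RobustCondition p b c ∧ ∀ j, n + 1 < j → c j = 0},
        SplitsCondition b (Finset.range (n + 2)) n.unpair.1 (n + 1) ((1 / 2 : ℝ) ^ (n + 1))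
          c.1 c'.1 := by
    rintro n ⟨c, hc, hc0⟩
    have hle := Nat.unpair_left_le n
    obtain ⟨c', hc', hs⟩ := hc.exists_split hp.measurable hb0 hbo hb (F := Finset.range (n + 2))
      (i := n.unpair.1) (m := n + 1) (by simp; omega) (by simp) (by omega) (hc0 _ (by omega))
      (ε := (1 / 2 : ℝ) ^ (n + 1)) (by positivity)
    refine ⟨⟨c', hc', fun j hj => ?_⟩, hs⟩
    rw [hs.eq_of_notMem j (by simp; omega), hc0 j (by omega)]
  choose next hnext using hsplit
  let C : ∀ n, {c : ℕ →₀ ℕ // RobustCondition p b c ∧ ∀ j, n < j → c j = 0} :=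
    Nat.rec ⟨0, hrobust, fun _ _ => rfl⟩ next
  let d : ℕ → ℕ → Set P := fun n j => b ((C n).1 j)
  have hC : ∀ n, SplitsCondition b (Finset.range (n + 2)) n.unpair.1 (n + 1)
      ((1 / 2 : ℝ) ^ (n + 1)) (C n).1 (C (n + 1)).1 := fun n => hnext n (C n)
  have hclosure : ∀ n j, j ≤ n + 1 → closure (d (n + 1) j) ⊆ d n j := fun n j hj =>
    (hC n).closure_subset j (by simp; omega)
  have hanti : ∀ j n k, j ≤ n + 1 → n ≤ k → d k j ⊆ d n j := by
    intro j n k hj hk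
    induction k, hk using Nat.le_induction with
    | base => rfl
    | succ k hk ih => exact subset_closure.trans ((hclosure k j (by omega)).trans ih)
  choose w hw using fun n => (C n).2.1 univ .univ (by
    rw [compl_univ]; exact ⟨∅, countable_empty, by simp, by simp⟩)
  have hlim : ∀ j, ∃ z, Tendsto (fun n => w n j) atTop (𝓝 z) := fun j => by
    refine cauchySeq_tendsto_of_complete ?_
    rw [← cauchySeq_shift (k := j + 1)]
    refine cauchySeq_of_le_tendsto_0 (fun n => (1 / 2 : ℝ) ^ (n + j + 1)) (fun k l N hk hl => ?_) ?_
    · exact (hC (N + j)).dist_le j (by simp; omega)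
        _ (hanti j (N + j + 1) (k + (j + 1)) (by omega) (by omega) (hw (k + (j + 1)) j).2.1)
        _ (hanti j (N + j + 1) (l + (j + 1)) (by omega) (by omega) (hw (l + (j + 1)) j).2.1)
    · exact (tendsto_pow_atTop_nhds_zero_of_lt_one (by norm_num) (by norm_num)).comp
        (tendsto_atTop_mono (fun n => by simp only [id]; omega) tendsto_id)
  choose z hz using hlim
  have hzd : ∀ n j, j ≤ n + 1 → z j ∈ d n j := fun n j hj => by
    refine hclosure n j hj (mem_closure_of_tendsto (hz j) ?_)
    filter_upwards [eventually_ge_atTop (n + 1)] with k hk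
    exact hanti j (n + 1) k (by omega) hk (hw k j).2.1
  have hpz : ∀ j, p (z j) = p (z 0) := fun j => by
    refine tendsto_nhds_unique ((hp.tendsto _).comp (hz j)) ?_
    refine ((hp.tendsto _).comp (hz 0)).congr fun n => ?_
    exact (hw n j).2.2.symm
  have hpre : Preperfect (range z) := by
    rw [preperfect_iff_nhds]
    rintro _ ⟨i, rfl⟩ U hU
    obtain ⟨ε, hε, hεU⟩ := Metric.mem_nhds_iff.1 hU
    obtain ⟨k, hk⟩ := exists_pow_lt_of_lt_one hε (by norm_num : (1 / 2 : ℝ) < 1)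
    set n := Nat.pair i (max i k + 1) with hn
    have hni : n.unpair.1 = i := by rw [hn, Nat.unpair_pair]
    have hkn : max i k + 1 ≤ n := Nat.right_le_pair _ _
    have hs := hC n
    rw [hni] at hs
    refine ⟨z (n + 1), ⟨hεU ?_, mem_range_self _⟩, fun h => ?_⟩
    · obtain ⟨l, hl⟩ : ∃ l, n = l + 1 := ⟨n - 1, by omega⟩
      have h1 : z (n + 1) ∈ d n i := hs.subset (hzd (n + 1) (n + 1) (by omega))
      have h2 : z i ∈ d n i := hzd n i (by omega)
      rw [show d n i = d (l + 1) i by rw [hl]] at h1 h2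
      have h3 := (hC l).dist_le i (by simp; omega) _ h1 _ h2
      exact (h3.trans (pow_le_pow_of_le_one (by norm_num) (by norm_num) (by omega))).trans_lt hk
    · have h1 := hzd (n + 1) (n + 1) (by omega)
      have h2 := hzd (n + 1) i (by omega)
      exact disjoint_left.1 hs.disjoint h2 (h ▸ h1)
  obtain ⟨e, he, -, hinj⟩ := hpre.perfect_closure.exists_nat_bool_injection
    (range_nonempty z).closure
  have hsub : closure (range z) ⊆ p ⁻¹' {p (z 0)} :=
    closure_minimal (by rintro _ ⟨j, rfl⟩; exact hpz j) (isClosed_singleton.preimage hp)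
  have hr : (range e).Countable := (hcount _).mono (he.trans hsub)
  have := hr.to_subtype
  have := (rangeFactorization_injective.2 hinj).countable
  obtain ⟨a, ha⟩ := exists_surjective_nat (ℕ → Bool)
  obtain ⟨k, hk⟩ := ha fun n => !a n n
  exact Bool.not_eq_not.2 rfl (congr_fun hk k)

theorem sigmaInjOn_univ_of_countable_fibers [MeasurableSpace P] [StandardBorelSpace P]
    [MeasurableSpace X] [StandardBorelSpace X] {p : P → X} (hp : Measurable p)
    (hcount : ∀ x, (p ⁻¹' {x}).Countable) : SigmaInjOn p univ := by
  let := upgradeStandardBorel X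
  obtain ⟨t, hborel, hpolish⟩ := StandardBorelSpace.polish (α := P)
  obtain ⟨t', hle, hcont, hpolish'⟩ := hp.exists_continuous
  have : @BorelSpace P t' _ := by
    refine @BorelSpace.mk P t' _ ?_
    rw [hborel.measurable_eq, borel_eq_borel_of_le hpolish' hpolish hle]
  exact @sigmaInjOn_univ_of_continuous P X t' _ _ _ _ _ _ _ p hcont hcount

/-- **Lusin–Novikov**: a measurable set with countable sections is covered by the graphs of
countably many measurable functions. -/
theorem exists_measurable_seq_of_countable_sections {α β : Type*} [MeasurableSpace α]
    [StandardBorelSpace α] [MeasurableSpace β] [StandardBorelSpace β] [Nonempty β]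
    {s : Set (α × β)} (hs : MeasurableSet s) (hcount : ∀ a, {y | (a, y) ∈ s}.Countable) :
    ∃ φ : ℕ → α → β, (∀ n, Measurable (φ n)) ∧ ∀ q ∈ s, ∃ n, φ n q.1 = q.2 := by
  have := hs.standardBorel
  have hfst : Measurable fun q : s => q.1.1 := measurable_fst.comp measurable_subtype_coe
  have hsnd : Measurable fun q : s => q.1.2 := measurable_snd.comp measurable_subtype_coe
  obtain ⟨B, hBc, hB, hBs⟩ := sigmaInjOn_univ_of_countable_fibers hfst (fun a => by
    refine MapsTo.countable_of_injOn (f := fun q : s => q.1.2) (t := {y | (a, y) ∈ s})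
      ?_ ?_ (hcount a)
    · rintro ⟨⟨x, y⟩, hq⟩ rfl
      exact hq
    · rintro ⟨⟨x, y⟩, hq⟩ rfl ⟨⟨x', y'⟩, hq'⟩ h rfl
      obtain rfl : x' = x := h
      rfl)
  have hext : ∀ t : B, ∃ g : α → β, Measurable g ∧ ∀ q ∈ t.1, g q.1.1 = q.1.2 := by
    rintro ⟨t, ht⟩
    obtain ⟨htm, hti⟩ := hB t ht
    have := htm.standardBorel
    have hemb : MeasurableEmbedding fun q : t => q.1.1.1 :=
      (hfst.comp measurable_subtype_coe).measurableEmbedding hti.injective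
    obtain ⟨g, hg, hgs⟩ := hemb.exists_measurable_extend
      (hsnd.comp measurable_subtype_coe) fun _ => inferInstance
    exact ⟨g, hg, fun q hq => congr_fun hgs ⟨q, hq⟩⟩
  choose g hg hgs using hext
  have := hBc.to_subtype
  have := Encodable.ofCountable B
  refine ⟨fun n => ((Encodable.decode n).map g).getD fun _ => Classical.arbitrary β,
    fun n => ?_, fun q hq => ?_⟩
  · dsimp only
    cases Encodable.decode (α := B) n with
    | none => exact measurable_const
    | some t => exact hg t
  · obtain ⟨t, ht, hqt⟩ := hBs (mem_univ (⟨q, hq⟩ : s))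
    refine ⟨Encodable.encode (⟨t, ht⟩ : B), ?_⟩
    dsimp only
    rw [Encodable.encodek]
    exact hgs ⟨t, ht⟩ _ hqt

end LusinNovikov


/-- Suppose `G` is a locally countable Borel graph on a standard Borel space `X` and `f`
is a partial Borel antimatching of `G` (with Borel domain `D`) such that
`ran(f) ⊆ dom(f)` and every connected component of `G` contains a point of `dom(f)`.
Then `f` extends to a total Borel antimatching of `G`. -/
theorem stmt_14 (X : Type) [MeasurableSpace X] [StandardBorelSpace X]
    (G : SimpleGraph X)
    (hGBorel : MeasurableSet {p : X × X | G.Adj p.1 p.2})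
    (hGlc : ∀ x, (G.neighborSet x).Countable)
    (D : Set X) (hD : MeasurableSet D)
    (f : X → X) (hf : Measurable f)
    (hfD : ∀ x ∈ D, f x ∈ D)
    (hfanti : ∀ x ∈ D, G.Adj x (f x) ∧ f (f x) ≠ x)
    (hcomp : ∀ x : X, ∃ y ∈ D, G.Reachable x y) :
    ∃ g : X → X, Measurable g ∧
      (∀ x, G.Adj x (g x) ∧ g (g x) ≠ x) ∧
      (∀ x ∈ D, g x = f x) := by
  classical
  rcases isEmpty_or_nonempty X with hX | hX
  · exact ⟨id, measurable_id, fun x => isEmptyElim x, fun x => isEmptyElim x⟩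
  obtain ⟨φ, hφ, hφG⟩ := exists_measurable_seq_of_countable_sections hGBorel hGlc
  have hadj : ∀ k, MeasurableSet {x | G.Adj x (φ k x)} := fun k =>
    (measurable_id.prodMk (hφ k)) hGBorel
  let A : ℕ → Set X := Nat.rec D fun _ S => S ∪ ⋃ k, {x | G.Adj x (φ k x)} ∩ φ k ⁻¹' S
  have hAm : ∀ n, MeasurableSet (A n) := fun n => by
    induction n with
    | zero => exact hD
    | succ n ih => exact ih.union (.iUnion fun k => (hadj k).inter (hφ k ih))
  have hAmono : Monotone A := monotone_nat_of_le_succ fun n => subset_union_left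
  have hAadj : ∀ {n x y}, y ∈ A n → G.Adj x y → x ∈ A (n + 1) := fun {n x y} hy h => by
    obtain ⟨k, hk⟩ := hφG (x, y) h
    dsimp only at hk
    exact Or.inr (mem_iUnion.2 ⟨k, by simpa [hk] using h, by simpa [hk] using hy⟩)
  have hAcover : ∀ x, ∃ n, x ∈ A n := fun x => by
    obtain ⟨y, hy, ⟨w⟩⟩ := hcomp x
    induction w with
    | nil => exact ⟨0, hy⟩
    | cons h w ih =>
      obtain ⟨n, hn⟩ := ih hy
      exact ⟨n + 1, hAadj hn h⟩
  let Q : ℕ → Set X := fun t => t.casesOn D fun t =>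
    (A (t.unpair.1 + 1) \ A t.unpair.1) ∩
      ({x | G.Adj x (φ t.unpair.2 x)} ∩ φ t.unpair.2 ⁻¹' A t.unpair.1)
  let F : ℕ → X → X := fun t => t.casesOn f fun t => φ t.unpair.2
  have hQm : ∀ t, MeasurableSet {x | x ∈ Q t} := by
    rintro (_ | t)
    · exact hD
    · exact ((hAm (t.unpair.1 + 1)).diff (hAm t.unpair.1)).inter
        ((hadj t.unpair.2).inter (hφ t.unpair.2 (hAm t.unpair.1)))
  have hFm : ∀ t, Measurable (F t) := by
    rintro (_ | t)
    · exact hf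
    · exact hφ _
  have hQcover : ∀ x, ∃ t, x ∈ Q t := fun x => by
    rcases hn : Nat.find (hAcover x) with _ | n
    · exact ⟨0, (hn ▸ Nat.find_spec (hAcover x) : x ∈ A 0)⟩
    · have h1 : x ∈ A (n + 1) := hn ▸ Nat.find_spec (hAcover x)
      have h2 : x ∉ A n := Nat.find_min (hAcover x) (by omega)
      obtain ⟨k, hk⟩ := mem_iUnion.1 (h1.resolve_left h2)
      refine ⟨Nat.pair n k + 1, ?_⟩
      change x ∈ (A ((Nat.pair n k).unpair.1 + 1) \ A (Nat.pair n k).unpair.1) ∩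
        ({x | G.Adj x (φ (Nat.pair n k).unpair.2 x)} ∩
          φ (Nat.pair n k).unpair.2 ⁻¹' A (Nat.pair n k).unpair.1)
      rw [Nat.unpair_pair]
      exact ⟨⟨h1, h2⟩, hk⟩
  obtain ⟨g, hgm, hgF⟩ : ∃ g : X → X, Measurable g ∧ ∀ x, ∃ t, x ∈ Q t ∧ (x ∈ D → t = 0) ∧
      g x = F t x :=
    ⟨fun x => F (@Nat.find _ (fun _ => Classical.propDecidable _) (hQcover x)) x,
      @Measurable.find _ _ _ _ _ _ (fun _ _ => Classical.propDecidable _) hFm hQm hQcover,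
      fun x => ⟨_, @Nat.find_spec _ (fun _ => Classical.propDecidable _) (hQcover x),
        fun hx => (@Nat.find_eq_zero _ (fun _ => Classical.propDecidable _) (hQcover x)).2 hx, rfl⟩⟩
  have hgD : ∀ x ∈ D, g x = f x := fun x hx => by
    obtain ⟨t, -, ht, hgx⟩ := hgF x
    rw [hgx, ht hx]
    rfl
  have hgA : ∀ x ∉ D, ∃ n, x ∉ A n ∧ G.Adj x (g x) ∧ g x ∈ A n := fun x hx => by
    obtain ⟨t, hs, -, hgx⟩ := hgF x
    rw [hgx]
    rcases t with _ | t
    · exact absurd hs hx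
    · exact ⟨t.unpair.1, hs.1.2, hs.2.1, hs.2.2⟩
  refine ⟨g, hgm, fun x => ?_, hgD⟩
  by_cases hx : x ∈ D
  · rw [hgD x hx, hgD _ (hfD x hx)]
    exact hfanti x hx
  · obtain ⟨n, hxn, hxg, hgn⟩ := hgA x hx
    refine ⟨hxg, fun h => hxn ?_⟩
    rw [← h]
    by_cases hgx : g x ∈ D
    · rw [hgD _ hgx]
      exact hAmono n.zero_le (hfD _ hgx)
    · obtain ⟨m, hgm, -, hggm⟩ := hgA _ hgx
      exact hAmono (le_of_not_ge fun hnm => hgm (hAmono hnm hgn)) hggm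
end
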